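/- arXiv:1205.3937 — 5 statements merged into one kernel-verified Lean document; each statement's English description precedes it below -/
import Mathlib

section
/- For any finite set A ⊆ F_p (avoiding 0 and −1) there exists A' ⊆ A with |A'| ≥ c|A| such that |A' − A'| ≤ C · |A(A+1)|⁸ / |A|⁷, for absolute constants c, C > 0. -/
open Finset Pointwise

section aux
variable {F : Type*} [Field F] [DecidableEq F]

/-- common neighbours of `a` and `b` -/
def comN (A : Finset F) (a b : F) : Finset F :=
  A.image (fun x => a * x) ∩ A.image (fun x => b * x)

lemma comN_comm (A : Finset F) (a b : F) : comN A a b = comN A b a := by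
  unfold comN; rw [Finset.inter_comm]

/-- the set A(A+1) -/
def prodS (A : Finset F) : Finset F := Finset.image₂ (fun a b => a * (b + 1)) A A

lemma mem_prodS {A : Finset F} {a w : F} (ha : a ∈ A) (hw : w ∈ A.image (fun x => a * x)) :
    a + w ∈ prodS A := by
  obtain ⟨x, hx, rfl⟩ := Finset.mem_image.1 hw
  exact Finset.mem_image₂.2 ⟨a, ha, x, hx, by ring⟩

lemma ruzsa_aux (A : Finset F) (h0 : (0 : F) ∉ A) (h1 : (-1 : F) ∉ A) :
    (Finset.image₂ (fun a b => a / b) A A).card * A.card ≤ (prodS A).card * (prodS A).card := by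
  classical
  have hch : ∀ q : F, ∃ ab : F × F, q ∈ Finset.image₂ (fun a b => a / b) A A →
      ab.1 ∈ A ∧ ab.2 ∈ A ∧ ab.1 / ab.2 = q := by
    intro q
    by_cases hq : q ∈ Finset.image₂ (fun a b => a / b) A A
    · obtain ⟨a, ha, b, hb, h⟩ := Finset.mem_image₂.1 hq
      exact ⟨(a, b), fun _ => ⟨ha, hb, h⟩⟩
    · exact ⟨(0, 0), fun h => absurd h hq⟩
  choose f hf using hch
  rw [← Finset.card_product, ← Finset.card_product]
  apply Finset.card_le_card_of_injOn
    (fun qx : F × F => ((f qx.1).1 * (qx.2 + 1), (f qx.1).2 * (qx.2 + 1)))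
  · rintro ⟨q, x⟩ h
    simp only [Finset.coe_product, Set.mem_prod, Finset.mem_coe] at h ⊢
    obtain ⟨ha, hb, -⟩ := hf q h.1
    exact ⟨Finset.mem_image₂.2 ⟨_, ha, x, h.2, rfl⟩, Finset.mem_image₂.2 ⟨_, hb, x, h.2, rfl⟩⟩
  · rintro ⟨q, x⟩ h ⟨q', x'⟩ h' heq
    simp only [Finset.coe_product, Set.mem_prod, Finset.mem_coe] at h h'
    simp only [Prod.mk.injEq] at heq
    obtain ⟨ha, hb, hq⟩ := hf q h.1
    obtain ⟨ha', hb', hq'⟩ := hf q' h'.1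
    have hx : x + 1 ≠ 0 := fun e => h1 (by rw [← eq_neg_of_add_eq_zero_left e]; exact h.2)
    have hx' : x' + 1 ≠ 0 := fun e => h1 (by rw [← eq_neg_of_add_eq_zero_left e]; exact h'.2)
    have hqq : q = q' := by
      rw [← hq, ← hq', ← mul_div_mul_right _ _ hx, heq.1, heq.2, mul_div_mul_right _ _ hx']
    subst hqq
    have hb0 : (f q).2 ≠ 0 := fun e => h0 (e ▸ hb)
    have := mul_left_cancel₀ hb0 heq.2
    simpa using this

lemma r_le_comN (A : Finset F) (h0 : (0 : F) ∉ A) {a b : F} (ha : a ∈ A) (hb : b ∈ A) :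
    ((A ×ˢ A).filter (fun xy => xy.1 / xy.2 = a / b)).card ≤ (comN A a b).card := by
  have ha0 : a ≠ 0 := fun e => h0 (e ▸ ha)
  have hb0 : b ≠ 0 := fun e => h0 (e ▸ hb)
  have key : ∀ x y : F, y ∈ A → x / y = a / b → b * x = a * y := by
    intro x y hy h
    have hy0 : y ≠ 0 := fun e => h0 (e ▸ hy)
    rw [div_eq_div_iff hy0 hb0] at h
    linear_combination h
  apply Finset.card_le_card_of_injOn (fun xy : F × F => a * xy.2)
  · rintro ⟨x, y⟩ h
    simp only [Finset.coe_filter, Finset.mem_product, Set.mem_ofPred_eq] at h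
    simp only [comN, Finset.coe_inter, Set.mem_inter_iff, Finset.mem_coe, Finset.mem_image]
    exact ⟨⟨y, h.1.2, rfl⟩, ⟨x, h.1.1, key x y h.1.2 h.2⟩⟩
  · rintro ⟨x, y⟩ h ⟨x', y'⟩ h' e
    simp only [Finset.coe_filter, Finset.mem_product, Set.mem_ofPred_eq] at h h'
    have e1 : y = y' := mul_left_cancel₀ ha0 e
    subst e1
    have e2 : x = x' := mul_left_cancel₀ hb0 ((key x y h.1.2 h.2).trans (key x' y h'.1.2 h'.2).symm)
    rw [e2]

lemma bad_pairs (A : Finset F) (h0 : (0 : F) ∉ A) (t : ℝ) (ht : 0 ≤ t) :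
    (((A ×ˢ A).filter (fun ab => ((comN A ab.1 ab.2).card : ℝ) < t)).card : ℝ) ≤
      (Finset.image₂ (fun a b => a / b) A A).card * t := by
  classical
  set B := (A ×ˢ A).filter (fun ab => ((comN A ab.1 ab.2).card : ℝ) < t) with hB
  have hmaps : ∀ ab ∈ B, ab.1 / ab.2 ∈ Finset.image₂ (fun a b => a / b) A A := by
    intro ab h
    have := (Finset.mem_product.1 (Finset.mem_filter.1 h).1)
    exact Finset.mem_image₂.2 ⟨_, this.1, _, this.2, rfl⟩
  rw [Finset.card_eq_sum_card_fiberwise (f := fun ab : F × F => ab.1 / ab.2) hmaps]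
  push_cast
  rw [← nsmul_eq_mul]
  apply Finset.sum_le_card_nsmul
  intro q _
  rcases (B.filter (fun ab => ab.1 / ab.2 = q)).eq_empty_or_nonempty with h | ⟨ab, h⟩
  · rw [h]; simpa using ht
  · obtain ⟨hb, hq⟩ := Finset.mem_filter.1 h
    obtain ⟨hm, hlt⟩ := Finset.mem_filter.1 hb
    have hm := Finset.mem_product.1 hm
    have h1 := r_le_comN A h0 hm.1 hm.2
    have h2 : (B.filter (fun ab => ab.1 / ab.2 = q)).card ≤
        ((A ×ˢ A).filter (fun xy => xy.1 / xy.2 = ab.1 / ab.2)).card := by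
      rw [hq]
      exact Finset.card_le_card (Finset.filter_subset_filter _ (Finset.filter_subset _ _))
    have h3 : ((B.filter (fun ab => ab.1 / ab.2 = q)).card : ℝ) ≤ (comN A ab.1 ab.2).card := by
      exact_mod_cast h2.trans h1
    exact h3.trans hlt.le

lemma fiber_bound (A : Finset F) {a b : F} (ha : a ∈ A) (hb : b ∈ A) :
    ∑ z ∈ A, (comN A a z).card * (comN A b z).card ≤
      (((prodS A ×ˢ prodS A) ×ˢ (prodS A ×ˢ prodS A)).filter
        (fun s => s.1.1 - s.1.2 + s.2.1 - s.2.2 = a - b)).card := by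
  classical
  have : ∑ z ∈ A, (comN A a z).card * (comN A b z).card
      = (A.sigma (fun z => comN A a z ×ˢ comN A b z)).card := by
    rw [Finset.card_sigma]; simp
  rw [this]
  apply Finset.card_le_card_of_injOn
    (fun u : (_ : F) × (F × F) =>
      ((a + u.2.1, u.1 + u.2.1), (u.1 + u.2.2, b + u.2.2)))
  · rintro ⟨z, w1, w2⟩ h
    simp only [Finset.coe_sigma, Set.mem_sigma_iff, Finset.mem_coe, Finset.mem_product] at h
    obtain ⟨hz, h1, h2⟩ := h
    have h1 := Finset.mem_inter.1 h1
    have h2 := Finset.mem_inter.1 h2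
    simp only [Finset.coe_filter, Finset.mem_product, Set.mem_ofPred_eq]
    exact ⟨⟨⟨mem_prodS ha h1.1, mem_prodS hz h1.2⟩, ⟨mem_prodS hz h2.2, mem_prodS hb h2.1⟩⟩, by ring⟩
  · rintro ⟨z, w1, w2⟩ _ ⟨z', w1', w2'⟩ _ e
    simp only [Prod.mk.injEq, add_right_inj] at e
    obtain ⟨⟨e1, e2⟩, e3, e4⟩ := e
    subst e1 e4
    have := add_right_cancel e2
    subst this
    rfl

theorem main_aux (A : Finset F) (h0 : (0 : F) ∉ A) (h1 : (-1 : F) ∉ A) :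
    ∃ A' ⊆ A, (3 / 4 : ℝ) * A.card ≤ (A'.card : ℝ) ∧
        ((A' - A').card : ℝ) ≤ 512 * ((prodS A).card : ℝ) ^ 8 / (A.card : ℝ) ^ 7 := by
  classical
  rcases A.eq_empty_or_nonempty with rfl | hne
  · exact ⟨∅, by simp, by simp, by simp⟩
  have hn : (0 : ℝ) < A.card := by exact_mod_cast hne.card_pos
  have hM : (0 : ℝ) < (prodS A).card := by
    obtain ⟨a, ha⟩ := hne
    have : (prodS A).Nonempty := ⟨_, Finset.mem_image₂.2 ⟨a, ha, a, ha, rfl⟩⟩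
    exact_mod_cast this.card_pos
  have hR : ((Finset.image₂ (fun a b => a / b) A A).card : ℝ) * A.card ≤
      (prodS A).card * (prodS A).card := by exact_mod_cast ruzsa_aux A h0 h1
  set n : ℝ := (A.card : ℝ) with hn_def
  set M : ℝ := ((prodS A).card : ℝ) with hM_def
  set t : ℝ := n ^ 3 / (16 * M ^ 2) with ht_def
  have ht : 0 < t := by positivity
  have hbad := bad_pairs A h0 t ht.le
  have hbad2 : (((A ×ˢ A).filter (fun ab => ((comN A ab.1 ab.2).card : ℝ) < t)).card : ℝ) ≤
      n ^ 2 / 16 := by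
    refine hbad.trans ?_
    calc _ = ((Finset.image₂ (fun a b => a / b) A A).card * n) * (n ^ 2 / (16 * M ^ 2)) := by
            rw [ht_def]; ring
      _ ≤ (M * M) * (n ^ 2 / (16 * M ^ 2)) := by gcongr
      _ = n ^ 2 / 16 := by field_simp
  let bad : F → Finset F := fun a => A.filter (fun z => ((comN A a z).card : ℝ) < t)
  have hsum : (((A ×ˢ A).filter (fun ab => ((comN A ab.1 ab.2).card : ℝ) < t)).card : ℝ) =
      ∑ a ∈ A, ((bad a).card : ℝ) := by
    rw [Finset.card_filter, Finset.sum_product]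
    simp only [bad, Finset.card_filter]
    push_cast
    rfl
  set A' := A.filter (fun a => ((bad a).card : ℝ) ≤ n / 4) with hA'
  have hsub : A' ⊆ A := Finset.filter_subset _ _
  refine ⟨A', hsub, ?_, ?_⟩
  · have e : (A'.card : ℝ) + ((A.filter (fun a => ¬ ((bad a).card : ℝ) ≤ n / 4)).card : ℝ) = n := by
      rw [hn_def]; exact_mod_cast Finset.card_filter_add_card_filter_not (s := A) _
    have h2 : ((A.filter (fun a => ¬ ((bad a).card : ℝ) ≤ n / 4)).card : ℝ) * (n / 4) ≤ n ^ 2 / 16 := by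
      refine le_trans ?_ (hsum ▸ hbad2)
      refine le_trans ?_ (Finset.sum_le_sum_of_subset_of_nonneg
        (Finset.filter_subset (fun a => ¬ ((bad a).card : ℝ) ≤ n / 4) A) (fun _ _ _ => by positivity))
      rw [← nsmul_eq_mul]
      apply Finset.card_nsmul_le_sum
      intro a h
      exact (not_le.1 (Finset.mem_filter.1 h).2).le
    nlinarith
  · -- differences
    have hfib : ∀ d ∈ A' - A', n / 2 * t ^ 2 ≤
        ((((prodS A ×ˢ prodS A) ×ˢ (prodS A ×ˢ prodS A)).filter
        (fun s => s.1.1 - s.1.2 + s.2.1 - s.2.2 = d)).card : ℝ) := by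
      intro d hd
      obtain ⟨a, ha, b, hb, rfl⟩ := Finset.mem_sub.1 hd
      have hA := Finset.mem_filter.1 ha
      have hB := Finset.mem_filter.1 hb
      have hf := fiber_bound A hA.1 hB.1
      refine le_trans ?_ (Nat.cast_le.2 hf)
      push_cast
      set G := A \ (bad a ∪ bad b) with hG
      have hGc : n / 2 ≤ (G.card : ℝ) := by
        have h1 : A.card ≤ G.card + ((bad a).card + (bad b).card) := by
          have : A.card - (bad a ∪ bad b).card ≤ G.card := Finset.le_card_sdiff (bad a ∪ bad b) A
          have := Finset.card_union_le (bad a) (bad b)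
          omega
        have h2 : n ≤ G.card + ((bad a).card + (bad b).card) := by
          rw [hn_def]; exact_mod_cast h1
        linarith [hA.2, hB.2]
      calc n / 2 * t ^ 2 ≤ G.card * t ^ 2 := by gcongr
        _ ≤ ∑ z ∈ G, ((comN A a z).card : ℝ) * (comN A b z).card := by
            rw [← nsmul_eq_mul]
            apply Finset.card_nsmul_le_sum
            intro z hz
            simp only [hG, bad, Finset.mem_sdiff, Finset.mem_union, Finset.mem_filter, not_or,
              not_and, not_lt] at hz
            have := hz.2.1 hz.1
            have := hz.2.2 hz.1
            rw [sq]
            gcongr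
        _ ≤ _ := Finset.sum_le_sum_of_subset_of_nonneg Finset.sdiff_subset
            (fun _ _ _ => by positivity)
    have htot : ((A' - A').card : ℝ) * (n / 2 * t ^ 2) ≤ M ^ 4 := by
      rw [← nsmul_eq_mul]
      refine (Finset.card_nsmul_le_sum _ _ _ hfib).trans ?_
      have h3 : ∑ d ∈ A' - A', (((prodS A ×ˢ prodS A) ×ˢ (prodS A ×ˢ prodS A)).filter
        (fun s => s.1.1 - s.1.2 + s.2.1 - s.2.2 = d)).card ≤
          ((prodS A ×ˢ prodS A) ×ˢ (prodS A ×ˢ prodS A)).card := by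
        rw [← Finset.card_biUnion]
        · exact Finset.card_le_card (Finset.biUnion_subset.2 fun _ _ => Finset.filter_subset _ _)
        · intro x _ y _ hxy
          rw [Function.onFun, Finset.disjoint_left]
          intro s hs hs'
          exact hxy ((Finset.mem_filter.1 hs).2.symm.trans (Finset.mem_filter.1 hs').2)
      have h4 : ((prodS A ×ˢ prodS A) ×ˢ (prodS A ×ˢ prodS A)).card = (prodS A).card ^ 4 := by
        simp only [Finset.card_product]; ring
      rw [h4] at h3
      rw [hM_def]
      exact_mod_cast h3
    rw [le_div_iff₀ (by positivity)]
    have h5 : n / 2 * t ^ 2 = n ^ 7 / (512 * M ^ 4) := by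
      rw [ht_def]; field_simp; norm_num
    rw [h5, ← mul_div_assoc, div_le_iff₀ (by positivity)] at htot
    linarith [htot]

end aux

theorem stmt7 :
    ∃ c C : ℝ, 0 < c ∧ 0 < C ∧ ∀ (p : ℕ) [Fact p.Prime] (A : Finset (ZMod p)),
      (0 : ZMod p) ∉ A → (-1 : ZMod p) ∉ A →
      ∃ A' ⊆ A, c * A.card ≤ (A'.card : ℝ) ∧
        ((A' - A').card : ℝ) ≤
          C * ((Finset.image₂ (fun a b => a * (b + 1)) A A).card : ℝ) ^ 8 /
            (A.card : ℝ) ^ 7 := by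
  refine ⟨3 / 4, 512, by norm_num, by norm_num, ?_⟩
  intro p _ A h0 h1
  exact main_aux A h0 h1
end

section
/- If A ⊆ F_p with |A| < p^{1/2}, then |A(A+1)| ≥ c · |A|^{57/56} / (log |A|)^{C} for absolute constants c, C > 0, where A(A+1) = {a(b+1) : a, b ∈ A}. -/
open Finset
section helpers
open scoped Pointwise

lemma aux_mul_self {F : Type*} [Field F] [DecidableEq F] (A B : Finset F) (hA : (0:F) ∉ A)
    (hB : (0:F) ∉ B) : #(A * A) * #B ≤ #(A * B) * #(A * B) := by
  have key : ∀ S : Finset F, (0:F) ∉ S → ∃ S' : Finset Fˣ, S'.image (Units.coeHom F) = S := by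
    intro S hS
    refine ⟨S.attach.image (fun a => Units.mk0 a.1 (fun h => hS (h ▸ a.2))), ?_⟩
    ext x
    simp only [mem_image, mem_attach, true_and, Subtype.exists, Units.coeHom_apply]
    constructor
    · rintro ⟨_, ⟨a, ha, rfl⟩, rfl⟩; simpa using ha
    · intro hx; exact ⟨_, ⟨x, hx, rfl⟩, rfl⟩
  classical
  obtain ⟨A', rfl⟩ := key A hA
  obtain ⟨B', rfl⟩ := key B hB
  have hi : Function.Injective (Units.coeHom F) := Units.val_injective
  rw [← image_mul, ← image_mul, card_image_of_injective _ hi, card_image_of_injective _ hi,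
    card_image_of_injective _ hi]
  have := ruzsa_triangle_inequality_mul_mul_mul A' B' A'
  rwa [mul_comm B' A'] at this

lemma aux_pluennecke2 {G : Type*} [AddCommGroup G] [DecidableEq G] (U B₁ B₂ : Finset G)
    (hU : U.Nonempty) : ∃ X ⊆ U, X.Nonempty ∧
      #(X + B₁ + B₂) * #U ^ 2 ≤ 4 * (#(U + B₁) * #(U + B₂)) * #X := by
  classical
  set k₁ := #(U + B₁) with hk₁
  set k₂ := #(U + B₂) with hk₂
  let T : ℕ → Finset ℤ := fun k => (range k).map Nat.castEmbedding
  have hT : ∀ k, #(T k) = k := fun k => by simp [T]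
  let e : Finset G → Finset (G × ℤ × ℤ) := fun X => X ×ˢ ({0} ×ˢ {0})
  have he : ∀ X, #(e X) = #X := fun X => by simp [e]
  let B : Finset (G × ℤ × ℤ) := (B₁ ×ˢ (T k₂ ×ˢ {0})) ∪ (B₂ ×ˢ ({0} ×ˢ T k₁))
  have hU' : U ∈ U.powerset.erase ∅ :=
    mem_erase_of_ne_of_mem hU.ne_empty (mem_powerset_self _)
  obtain ⟨X, hX, hmin⟩ := exists_min_image (U.powerset.erase ∅)
    (fun X => (#(e X + B) : ℚ) / #X) ⟨U, hU'⟩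
  rw [mem_erase, mem_powerset, ← nonempty_iff_ne_empty] at hX
  obtain ⟨hXne, hXU⟩ := hX
  have hXpos : (0:ℚ) < #X := by exact_mod_cast hXne.card_pos
  have hmin' : ∀ W ⊆ U, #(e X + B) * #W ≤ #(e W + B) * #X := by
    intro W hW
    rcases W.eq_empty_or_nonempty with rfl | hWne
    · simp
    have := hmin W (by rw [mem_erase, mem_powerset]; exact ⟨hWne.ne_empty, hW⟩)
    have hWpos : (0:ℚ) < #W := by exact_mod_cast hWne.card_pos
    rw [div_le_div_iff₀ hXpos hWpos] at this
    exact_mod_cast this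
  refine ⟨X, hXU, hXne, ?_⟩
  have hpet := pluennecke_petridis_inequality_add (A := e X) (B := B) B (by
    intro A' hA'
    obtain ⟨W, hW, rfl⟩ : ∃ W ⊆ X, e W = A' := by
      refine ⟨A'.image Prod.fst, ?_, ?_⟩
      · intro x hx
        obtain ⟨y, hy, rfl⟩ := mem_image.1 hx
        have := hA' hy
        simp only [e, mem_product] at this
        exact this.1
      · ext ⟨x, i, j⟩
        simp only [e, mem_product, mem_image, mem_singleton, Prod.exists]
        constructor
        · rintro ⟨⟨x', i', j', h, rfl⟩, rfl, rfl⟩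
          have := hA' h
          simp only [e, mem_product, mem_singleton] at this
          obtain ⟨_, rfl, rfl⟩ := this
          exact h
        · intro h
          have := hA' h
          simp only [e, mem_product, mem_singleton] at this
          obtain ⟨_, rfl, rfl⟩ := this
          exact ⟨⟨_, _, _, h, rfl⟩, rfl, rfl⟩
    rw [he, he]
    exact hmin' W (hW.trans hXU))
  rw [he] at hpet
  have hcomm : B + e X = e X + B := add_comm _ _
  have h1 : #(e U + B) ≤ 2 * (k₁ * k₂) := by
    have : e U + B ⊆ ((U + B₁) ×ˢ (T k₂ ×ˢ {0})) ∪ ((U + B₂) ×ˢ ({0} ×ˢ T k₁)) := by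
      intro x hx
      obtain ⟨a, ha, b, hb, rfl⟩ := mem_add.1 hx
      simp only [e, B, mem_union, mem_product, mem_singleton] at ha hb ⊢
      obtain ⟨ha, h0, h0'⟩ := ha
      simp only [Prod.fst_add, Prod.snd_add, h0, h0', zero_add]
      rcases hb with hb | hb
      · exact Or.inl ⟨add_mem_add ha hb.1, hb.2⟩
      · exact Or.inr ⟨add_mem_add ha hb.1, hb.2⟩
    refine (card_le_card this).trans ((card_union_le _ _).trans ?_)
    simp only [card_product, hT, card_singleton]
    rw [← hk₁, ← hk₂]; ring_nf; rfl
  have h2 : #(X + B₁ + B₂) * (k₂ * k₁) ≤ #(B + e X + B) := by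
    have : (X + B₁ + B₂) ×ˢ (T k₂ ×ˢ T k₁) ⊆ B + e X + B := by
      rintro ⟨x, i, j⟩ hx
      simp only [mem_product] at hx
      obtain ⟨hx, hi, hj⟩ := hx
      obtain ⟨y, hy, b₂, hb₂, rfl⟩ := mem_add.1 hx
      obtain ⟨x₀, hx₀, b₁, hb₁, rfl⟩ := mem_add.1 hy
      have : ((x₀ + b₁ + b₂, i, j) : G × ℤ × ℤ) = (b₁, i, 0) + (x₀, 0, 0) + (b₂, 0, j) := by
        simp [add_comm]
      rw [this]
      refine add_mem_add (add_mem_add ?_ ?_) ?_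
      · simp only [B, mem_union, mem_product, mem_singleton]; exact Or.inl ⟨hb₁, hi, trivial⟩
      · simp only [e, mem_product, mem_singleton]; exact ⟨hx₀, trivial, trivial⟩
      · simp only [B, mem_union, mem_product, mem_singleton]; exact Or.inr ⟨hb₂, trivial, hj⟩
    have := card_le_card this
    simpa only [card_product, hT] using this
  have h3 := hmin' U subset_rfl
  rw [hcomm] at hpet h2
  rcases Nat.eq_zero_or_pos (k₁ * k₂) with h0 | hP
  · have : X + B₁ + B₂ = ∅ := by
      rcases Nat.mul_eq_zero.1 h0 with h | h
      · rw [hk₁, card_eq_zero, add_eq_empty] at h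
        rcases h with h | h
        · exact absurd h hU.ne_empty
        · simp [h]
      · rw [hk₂, card_eq_zero, add_eq_empty] at h
        rcases h with h | h
        · exact absurd h hU.ne_empty
        · simp [h]
    simp [this]
  · set Q := #(e X + B)
    set P := k₁ * k₂
    set R := #(X + B₁ + B₂)
    set x := #X
    set u := #U
    have hx : 0 < x := hXne.card_pos
    have e1 : Q * u ≤ 2 * P * x := h3.trans (Nat.mul_le_mul_right _ h1)
    have e2 : R * P * x ≤ Q * Q := by
      rw [mul_comm k₂ k₁] at h2
      exact (Nat.mul_le_mul_right _ h2).trans hpet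
    have e3 : (R * u ^ 2) * (P * x) ≤ (4 * P * x) * (P * x) := by
      calc (R * u ^ 2) * (P * x) = (R * P * x) * u ^ 2 := by ring
        _ ≤ (Q * Q) * u ^ 2 := Nat.mul_le_mul_right _ e2
        _ = (Q * u) * (Q * u) := by ring
        _ ≤ (2 * P * x) * (2 * P * x) := Nat.mul_le_mul e1 e1
        _ = _ := by ring
    exact Nat.le_of_mul_le_mul_right e3 (Nat.mul_pos hP hx)

lemma aux_2Z {G : Type*} [AddCommGroup G] [DecidableEq G] (A Z : Finset G) (hA : A.Nonempty) :
    #(Z + Z - (Z + Z)) * #A ^ 3 ≤ #(A - Z) ^ 4 := by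
  have h := pluennecke_ruzsa_inequality_nsmul_sub_nsmul_sub hA Z 2 2
  rw [two_nsmul] at h
  have hp : (0 : ℚ≥0) < #A := by exact_mod_cast hA.card_pos
  have : (#(Z + Z - (Z + Z)) : ℚ≥0) * #A ^ 3 ≤ #(A - Z) ^ 4 := by
    calc _ ≤ ((#(A - Z) / #A : ℚ≥0) ^ (2 + 2) * #A) * #A ^ 3 := by gcongr
      _ = _ := by rw [div_pow]; field_simp; ring
  exact_mod_cast this

lemma aux_cs {α β : Type*} [DecidableEq β] (S : Finset α) (f : α → β) :
    #S ^ 2 ≤ #(S.image f) * #((S ×ˢ S).filter (fun x => f x.1 = f x.2)) := by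
  classical
  have h1 : #S = ∑ b ∈ S.image f, #(S.filter (fun a => f a = b)) :=
    card_eq_sum_card_image f S
  have h2 : #((S ×ˢ S).filter (fun x => f x.1 = f x.2)) =
      ∑ b ∈ S.image f, #(S.filter (fun a => f a = b)) ^ 2 := by
    rw [card_eq_sum_card_fiberwise (f := fun x => f x.1) (t := S.image f)]
    · refine sum_congr rfl fun b hb => ?_
      rw [sq, ← card_product]
      congr 1
      ext ⟨x, y⟩
      simp only [mem_filter, mem_product]
      constructor
      · rintro ⟨⟨⟨hx, hy⟩, h⟩, h'⟩; exact ⟨⟨hx, h'⟩, hy, h ▸ h'⟩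
      · rintro ⟨⟨hx, h⟩, hy, h'⟩; exact ⟨⟨⟨hx, hy⟩, h.trans h'.symm⟩, h⟩
    · intro x hx
      simp only [coe_filter, mem_product, Set.mem_ofPred_eq] at hx
      exact mem_coe.2 (mem_image_of_mem _ hx.1.1)
  rw [h2]
  conv_lhs => rw [h1]
  exact sq_sum_le_card_mul_sum_sq

lemma aux_sumset_bound {F : Type*} [Field F] [DecidableEq F] (U V Z : Finset F) (p q s t r : F)
    (hst : s ≠ t) (hr : r * (s - t) = p - q) (hU : ∀ u ∈ U, s * u ∈ Z ∧ t * u ∈ Z)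
    (hV : ∀ v ∈ V, p * v ∈ Z ∧ q * v ∈ Z) :
    #(U + V.image (fun v => r * v)) ≤ #(Z + Z - (Z + Z)) := by
  refine card_le_card_of_injOn (fun x => (s - t) * x) ?_ ?_
  · intro x hx
    obtain ⟨u, hu, w, hw, rfl⟩ := mem_add.1 (mem_coe.1 hx)
    obtain ⟨v, hv, rfl⟩ := mem_image.1 hw
    have : (s - t) * (u + r * v) = (s * u + p * v) - (t * u + q * v) := by
      linear_combination v * hr
    simp only [this]
    exact mem_coe.2 (sub_mem_sub (add_mem_add (hU u hu).1 (hV v hv).1)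
      (add_mem_add (hU u hu).2 (hV v hv).2))
  · intro x _ y _ h
    exact mul_left_cancel₀ (sub_ne_zero.2 hst) h

lemma aux_endgame {p : ℕ} [Fact p.Prime] (A A' Z : Finset (ZMod p)) (hAA : A ⊆ A')
    (h0 : (0 : ZMod p) ∉ A) (hp : #A ^ 2 ≤ p)
    (hZ : ∀ s ∈ A, 6 * #(A.filter (fun a => s * (a + 1) ∉ Z)) ≤ #A) :
    #A ^ 3 * #A' ^ 3 ≤ 32 * #(A' - Z) ^ 5 := by
  classical
  rcases A.eq_empty_or_nonempty with rfl | hAne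
  · simp
  have hA'ne : A'.Nonempty := hAne.mono hAA
  have hq : 0 < #A := hAne.card_pos
  have hZne : Z.Nonempty := by
    obtain ⟨s, hs⟩ := hAne
    by_contra h
    rw [not_nonempty_iff_eq_empty] at h
    have := hZ s hs
    simp only [h, notMem_empty, not_false_eq_true, filter_true] at this
    omega
  have hDa : #A' ≤ #(A' - Z) := card_le_card_sub_right hZne
  have hqa : #A ≤ #A' := card_le_card hAA
  rcases Nat.lt_or_ge 1 #A with h1 | h1
  swap
  · have h1 : #A = 1 := by omega
    rw [h1]
    have : 1 ≤ #(A' - Z) := by omega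
    calc 1 ^ 3 * #A' ^ 3 ≤ #(A' - Z) ^ 3 := by simpa using Nat.pow_le_pow_left hDa 3
      _ ≤ #(A' - Z) ^ 5 := Nat.pow_le_pow_right this (by norm_num)
      _ ≤ _ := by omega
  set T := #(Z + Z - (Z + Z)) with hT
  have hTD : T * #A' ^ 3 ≤ #(A' - Z) ^ 4 := aux_2Z A' Z hA'ne
  -- the sets U, V
  have hUV : ∀ P : Finset (ZMod p), P ⊆ A → #P ≤ 3 → ∃ U : Finset (ZMod p),
      (∀ u ∈ U, u - 1 ∈ A) ∧ (∀ u ∈ U, ∀ s ∈ P, s * u ∈ Z) ∧ #A ≤ 2 * #U := by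
    intro P hP hP3
    refine ⟨(A.filter (fun a => ∀ s ∈ P, s * (a + 1) ∈ Z)).image (fun a => a + 1), ?_, ?_, ?_⟩
    · intro u hu
      obtain ⟨a, ha, rfl⟩ := mem_image.1 hu
      simpa using (mem_filter.1 ha).1
    · intro u hu
      obtain ⟨a, ha, rfl⟩ := mem_image.1 hu
      exact (mem_filter.1 ha).2
    · rw [card_image_of_injective _ (add_left_injective 1)]
      have hc := card_filter_add_card_filter_not (s := A) (fun a => ∀ s ∈ P, s * (a + 1) ∈ Z)
      have hb : #(A.filter (fun a => ¬ ∀ s ∈ P, s * (a + 1) ∈ Z)) ≤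
          ∑ s ∈ P, #(A.filter (fun a => s * (a + 1) ∉ Z)) := by
        refine (card_le_card ?_).trans card_biUnion_le
        intro a ha
        simp only [mem_filter, not_forall, mem_biUnion] at ha ⊢
        obtain ⟨ha, s, hs, h⟩ := ha
        exact ⟨s, hs, ha, h⟩
      have hb' : 6 * ∑ s ∈ P, #(A.filter (fun a => s * (a + 1) ∉ Z)) ≤ 3 * #A := by
        rw [mul_sum]
        refine (sum_le_sum fun s hs => hZ s (hP hs)).trans ?_
        rw [sum_const, smul_eq_mul]
        exact Nat.mul_le_mul_right _ hP3
      omega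
  let R : Set (ZMod p) := {ξ | ∃ u ∈ A, ∃ u' ∈ A, ∃ v ∈ A, ∃ v' ∈ A, v ≠ v' ∧
    ξ * (v - v') = u' - u}
  by_cases hR : ∀ ξ, ξ ∈ R
  · -- pivot-free case
    let coll : ZMod p → Finset ((ZMod p × ZMod p) × (ZMod p × ZMod p)) := fun ξ =>
      ((A ×ˢ A) ×ˢ (A ×ˢ A)).filter (fun x => x.1.2 ≠ x.2.2 ∧
        ξ * (x.1.2 - x.2.2) = x.2.1 - x.1.1)
    have hsum : ∑ ξ, #(coll ξ) ≤ #A ^ 4 := by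
      rw [← card_biUnion]
      · refine (card_le_card (biUnion_subset.2 fun ξ _ => filter_subset _ _)).trans ?_
        simp only [card_product]
        exact le_of_eq (by ring)
      · intro ξ _ ξ' _ hne
        refine disjoint_left.2 fun x hx hx' => hne ?_
        simp only [coll, mem_filter] at hx hx'
        exact mul_right_cancel₀ (sub_ne_zero.2 hx.2.1) (hx.2.2.trans hx'.2.2.symm)
    obtain ⟨ξ, hξ⟩ : ∃ ξ, #(coll ξ) ≤ #A ^ 2 := by
      by_contra! h
      have : ∑ _ξ : ZMod p, (#A ^ 2 + 1) ≤ ∑ ξ, #(coll ξ) := sum_le_sum fun ξ _ => h ξ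
      rw [sum_const, card_univ, ZMod.card, smul_eq_mul] at this
      have hp0 : 0 < p := (Fact.out : p.Prime).pos
      nlinarith [Nat.mul_le_mul_right (#A ^ 2) hp]
    obtain ⟨u, hu, u', hu', v, hv, v', hv', hne, hr⟩ := hR ξ
    obtain ⟨U, hU1, hU2, hU3⟩ := hUV {v, v'} (by
      intro x hx; simp only [mem_insert, mem_singleton] at hx
      rcases hx with rfl | rfl <;> assumption) (card_le_two.trans (by norm_num))
    obtain ⟨V, hV1, hV2, hV3⟩ := hUV {u', u} (by
      intro x hx; simp only [mem_insert, mem_singleton] at hx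
      rcases hx with rfl | rfl <;> assumption) (card_le_two.trans (by norm_num))
    have hb : #(U + V.image (fun v => ξ * v)) ≤ T := aux_sumset_bound U V Z u' u v v' ξ hne hr
      (fun x hx => ⟨hU2 x hx _ (by simp), hU2 x hx _ (by simp)⟩)
      (fun x hx => ⟨hV2 x hx _ (by simp), hV2 x hx _ (by simp)⟩)
    have hcs := aux_cs (U ×ˢ V) (fun x => x.1 + ξ * x.2)
    have him : (U ×ˢ V).image (fun x => x.1 + ξ * x.2) ⊆ U + V.image (fun v => ξ * v) := by
      intro x hx
      obtain ⟨y, hy, rfl⟩ := mem_image.1 hx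
      rw [mem_product] at hy
      exact add_mem_add hy.1 (mem_image_of_mem _ hy.2)
    have hE : #(((U ×ˢ V) ×ˢ (U ×ˢ V)).filter
        (fun x => x.1.1 + ξ * x.1.2 = x.2.1 + ξ * x.2.2)) ≤ 2 * #A ^ 2 := by
      have : #(((U ×ˢ V) ×ˢ (U ×ˢ V)).filter
        (fun x => x.1.1 + ξ * x.1.2 = x.2.1 + ξ * x.2.2)) ≤
          #(coll ξ ∪ (A ×ˢ A).image (fun y => (y, y))) := by
        refine card_le_card_of_injOn
          (fun x => ((x.1.1 - 1, x.1.2 - 1), (x.2.1 - 1, x.2.2 - 1))) ?_ ?_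
        · rintro ⟨⟨a, b⟩, ⟨c, d⟩⟩ hx
          simp only [coe_filter, mem_product, Set.mem_ofPred_eq] at hx
          obtain ⟨⟨⟨ha, hb⟩, hc, hd⟩, h⟩ := hx
          rw [mem_coe, mem_union]
          by_cases hbd : b = d
          · right
            subst hbd
            have : a = c := by simpa using h
            subst this
            exact mem_image.2 ⟨(a - 1, b - 1), mem_product.2 ⟨hU1 a ha, hV1 b hb⟩, rfl⟩
          · left
            simp only [coll, mem_filter, mem_product]
            refine ⟨⟨⟨hU1 a ha, hV1 b hb⟩, hU1 c hc, hV1 d hd⟩, ?_, ?_⟩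
            · intro h'; exact hbd (by simpa using h')
            · linear_combination h
        · rintro ⟨⟨a, b⟩, ⟨c, d⟩⟩ _ ⟨⟨a', b'⟩, ⟨c', d'⟩⟩ _ h
          simpa using h
      refine this.trans ((card_union_le _ _).trans ?_)
      have h2 : #((A ×ˢ A).image (fun y => (y, y))) ≤ #A ^ 2 := by
        refine card_image_le.trans ?_
        rw [card_product, sq]
      omega
    have hfin : (#U * #V) ^ 2 ≤ T * (2 * #A ^ 2) := by
      rw [card_product] at hcs
      exact hcs.trans (Nat.mul_le_mul ((card_le_card him).trans hb) hE)
    have h4 : #A ^ 2 * #A ^ 2 ≤ (32 * T) * #A ^ 2 := by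
      calc #A ^ 2 * #A ^ 2 = (#A * #A) ^ 2 := by ring
        _ ≤ ((2 * #U) * (2 * #V)) ^ 2 := Nat.pow_le_pow_left (Nat.mul_le_mul hU3 hV3) 2
        _ = 16 * (#U * #V) ^ 2 := by ring
        _ ≤ 16 * (T * (2 * #A ^ 2)) := Nat.mul_le_mul_left _ hfin
        _ = _ := by ring
    have h5 : #A ^ 2 ≤ 32 * T := Nat.le_of_mul_le_mul_right h4 (by positivity)
    calc #A ^ 3 * #A' ^ 3 = #A ^ 2 * #A' ^ 3 * #A := by ring
      _ ≤ (32 * T) * #A' ^ 3 * #(A' - Z) :=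
        Nat.mul_le_mul (Nat.mul_le_mul_right _ h5) (hqa.trans hDa)
      _ = 32 * (T * #A' ^ 3) * #(A' - Z) := by ring
      _ ≤ 32 * #(A' - Z) ^ 4 * #(A' - Z) := by gcongr
      _ = _ := by ring
  · obtain ⟨l, hl⟩ := hAne
    have hl0 : l ≠ 0 := fun h => h0 (h ▸ hl)
    obtain ⟨r, hrR, hrl⟩ : ∃ r ∈ R, r - l ∉ R := by
      by_contra! h
      apply hR
      have h00 : (0 : ZMod p) ∈ R := by
        obtain ⟨v, hv, v', hv', hne⟩ := one_lt_card.1 h1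
        exact ⟨v, hv, v, hv, v, hv, v', hv', hne, by simp⟩
      have hk : ∀ k : ℕ, -(k : ZMod p) * l ∈ R := by
        intro k
        induction k with
        | zero => simpa using h00
        | succ k ih =>
          have := h _ ih
          have e : -(k : ZMod p) * l - l = -((k + 1 : ℕ) : ZMod p) * l := by push_cast; ring
          rwa [e] at this
      intro ξ
      have := hk (-(ξ / l)).val
      rw [ZMod.natCast_zmod_val] at this
      have e : -(-(ξ / l)) * l = ξ := by field_simp
      rwa [e] at this
    obtain ⟨u, hu, u', hu', v, hv, v', hv', hne, hr⟩ := hrR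
    obtain ⟨U, hU1, hU2, hU3⟩ := hUV {v, v'} (by
      intro x hx; simp only [mem_insert, mem_singleton] at hx
      rcases hx with rfl | rfl <;> assumption) (card_le_two.trans (by norm_num))
    obtain ⟨V, hV1, hV2, hV3⟩ := hUV {u', u, l} (by
      intro x hx; simp only [mem_insert, mem_singleton] at hx
      rcases hx with rfl | rfl | rfl <;> assumption) card_le_three
    have hb : #(U + V.image (fun v => r * v)) ≤ T := aux_sumset_bound U V Z u' u v v' r hne hr
      (fun x hx => ⟨hU2 x hx _ (by simp), hU2 x hx _ (by simp)⟩)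
      (fun x hx => ⟨hV2 x hx _ (by simp), hV2 x hx _ (by simp)⟩)
    have hb2 : #(U + V.image (fun v => -l * v)) ≤ #(A' - Z) := by
      refine card_le_card_of_injOn (fun x => x - 1) ?_ (sub_left_injective.injOn)
      intro x hx
      obtain ⟨x, hx', w, hw, rfl⟩ := mem_add.1 (mem_coe.1 hx)
      obtain ⟨y, hy, rfl⟩ := mem_image.1 hw
      have e : x + -l * y - 1 = (x - 1) - l * y := by ring
      simp only [e]
      exact mem_coe.2 (sub_mem_sub (hAA (hU1 x hx')) (hV2 y hy _ (by simp)))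
    have hUne : U.Nonempty := by rw [← card_pos]; omega
    obtain ⟨X, hXU, hXne, hX⟩ := aux_pluennecke2 U (V.image (fun v => -l * v))
      (V.image (fun v => r * v)) hUne
    have hinj : #X * #V ≤ #(X + V.image (fun v => -l * v) + V.image (fun v => r * v)) := by
      rw [← card_product]
      refine card_le_card_of_injOn (fun x => x.1 + -l * x.2 + r * x.2) ?_ ?_
      · intro x hx
        rw [mem_coe, mem_product] at hx
        exact mem_coe.2 (add_mem_add (add_mem_add hx.1 (mem_image_of_mem _ hx.2))
          (mem_image_of_mem _ hx.2))
      · rintro ⟨a, b⟩ hx ⟨c, d⟩ hy h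
        rw [mem_coe, mem_product] at hx hy
        simp only at hx hy h
        by_cases hbd : b = d
        · subst hbd
          have : a = c := by simpa using h
          rw [this]
        · exfalso
          apply hrl
          refine ⟨a - 1, hU1 a (hXU hx.1), c - 1, hU1 c (hXU hy.1), b - 1, hV1 b hx.2,
            d - 1, hV1 d hy.2, ?_, ?_⟩
          · intro h'; exact hbd (by simpa using h')
          · linear_combination h
    have h6 : (#V * #U ^ 2) * #X ≤ (4 * (#(A' - Z) * T)) * #X := by
      calc (#V * #U ^ 2) * #X = #X * #V * #U ^ 2 := by ring
        _ ≤ _ := Nat.mul_le_mul_right _ hinj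
        _ ≤ _ := hX
        _ ≤ _ := by gcongr
    have h7 := Nat.le_of_mul_le_mul_right h6 hXne.card_pos
    calc #A ^ 3 * #A' ^ 3 = #A * #A ^ 2 * #A' ^ 3 := by ring
      _ ≤ (2 * #V) * (2 * #U) ^ 2 * #A' ^ 3 := by gcongr
      _ = 8 * (#V * #U ^ 2) * #A' ^ 3 := by ring
      _ ≤ 8 * (4 * (#(A' - Z) * T)) * #A' ^ 3 := by gcongr
      _ = 32 * #(A' - Z) * (T * #A' ^ 3) := by ring
      _ ≤ 32 * #(A' - Z) * #(A' - Z) ^ 4 := by gcongr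
      _ = _ := by ring

lemma aux_drc {α β : Type*} [DecidableEq α] (A : Finset α) (Y : Finset β)
    (N : β → Finset α) (hN : ∀ y ∈ Y, N y ⊆ A) (hNe : ∀ y ∈ Y, (N y).Nonempty) (hY : Y.Nonempty)
    (M ε n : ℝ) (hn : (#A : ℝ) = n) (hM : 0 < M) (hε : 0 < ε)
    (h1 : ∑ y ∈ Y, (#(N y) : ℝ) ≤ n ^ 2) (h2 : n ^ 4 ≤ M * ∑ y ∈ Y, (#(N y) : ℝ) ^ 2) :
    ∃ y ∈ Y, n ^ 2 ≤ 2 * M * #(N y) ∧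
      (#((N y ×ˢ N y).filter (fun x => (#(Y.filter (fun y' => x.1 ∈ N y' ∧ x.2 ∈ N y')) : ℝ)
        < ε * n ^ 2 / (2 * M))) : ℝ) ≤ ε * (#(N y) : ℝ) ^ 2 := by
  classical
  set τ := ε * n ^ 2 / (2 * M) with hτ
  let cod : α × α → Finset β := fun x => Y.filter (fun y' => x.1 ∈ N y' ∧ x.2 ∈ N y')
  let bad : β → Finset (α × α) := fun y => (N y ×ˢ N y).filter (fun x => (#(cod x) : ℝ) < τ)
  have hτ0 : 0 ≤ τ := by positivity
  have hbad : ∑ y ∈ Y, (#(bad y) : ℝ) ≤ n ^ 2 * τ := by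
    let BP := (A ×ˢ A).filter (fun x => (#(cod x) : ℝ) < τ)
    have e : ∑ y ∈ Y, #(bad y) ≤ ∑ x ∈ BP, #(cod x) := by
      have := sum_card_bipartiteAbove_eq_sum_card_bipartiteBelow (s := Y) (t := BP)
        (fun y x => x.1 ∈ N y ∧ x.2 ∈ N y)
      refine le_trans (sum_le_sum fun y hy => card_le_card ?_) this.le
      intro x hx
      simp only [bad, mem_filter, mem_product] at hx
      simp only [bipartiteAbove, BP, mem_filter, mem_product]
      exact ⟨⟨⟨hN y hy hx.1.1, hN y hy hx.1.2⟩, hx.2⟩, hx.1⟩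
    calc ∑ y ∈ Y, (#(bad y) : ℝ) ≤ ∑ x ∈ BP, (#(cod x) : ℝ) := by exact_mod_cast e
      _ ≤ ∑ x ∈ BP, τ := sum_le_sum fun x hx => (mem_filter.1 hx).2.le
      _ = #BP * τ := by rw [sum_const, nsmul_eq_mul]
      _ ≤ n ^ 2 * τ := by
        gcongr
        have : #BP ≤ #A * #A := (card_filter_le _ _).trans (card_product _ _).le
        rw [← hn, sq]; exact_mod_cast this
  have hex : ∃ y ∈ Y, 0 ≤ (#(N y) : ℝ) ^ 2 - #(bad y) / ε - n ^ 2 / (2 * M) * #(N y) := by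
    apply exists_le_of_sum_le hY
    rw [sum_const_zero, sum_sub_distrib, sum_sub_distrib, ← sum_div, ← mul_sum]
    have a1 : n ^ 4 / M ≤ ∑ y ∈ Y, (#(N y) : ℝ) ^ 2 := by
      rw [div_le_iff₀ hM]; linarith
    have a2 : (∑ y ∈ Y, (#(bad y) : ℝ)) / ε ≤ n ^ 4 / M / 2 := by
      rw [div_le_iff₀ hε]
      refine hbad.trans (le_of_eq ?_)
      rw [hτ]; field_simp
    have a3 : n ^ 2 / (2 * M) * ∑ y ∈ Y, (#(N y) : ℝ) ≤ n ^ 4 / M / 2 := by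
      calc _ ≤ n ^ 2 / (2 * M) * n ^ 2 := by gcongr
        _ = _ := by field_simp
    linarith
  obtain ⟨y, hy, h⟩ := hex
  refine ⟨y, hy, ?_, ?_⟩
  · have hm : (0 : ℝ) < #(N y) := by exact_mod_cast (hNe y hy).card_pos
    have b0 : 0 ≤ (#(bad y) : ℝ) / ε := by positivity
    have : n ^ 2 / (2 * M) * #(N y) ≤ #(N y) * #(N y) := by nlinarith
    have := le_of_mul_le_mul_right this hm
    rw [div_le_iff₀ (by positivity)] at this
    linarith
  · have b0 : 0 ≤ n ^ 2 / (2 * M) * (#(N y) : ℝ) := by positivity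
    have : (#(bad y) : ℝ) / ε ≤ (#(N y) : ℝ) ^ 2 := by linarith
    rw [div_le_iff₀ hε] at this
    rw [mul_comm]; exact this

/-- Markov-type counting: few elements have large fibres. -/
lemma aux_markov {α β : Type*} [DecidableEq α] [DecidableEq β] (S : Finset α) (T : Finset β)
    (r : α → β → Prop) [∀ a b, Decidable (r a b)] (k K : ℝ)
    (hK : (#((S ×ˢ T).filter (fun x => r x.1 x.2)) : ℝ) ≤ K) :
    (#(S.filter (fun a => k < (#(T.filter (r a)) : ℝ))) : ℝ) * k ≤ K := by
  have e : #((S ×ˢ T).filter (fun x => r x.1 x.2)) = ∑ a ∈ S, #(T.filter (r a)) := by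
    rw [card_filter, sum_product]
    simp only [card_filter]
  rw [e] at hK
  push_cast at hK
  calc (#(S.filter (fun a => k < (#(T.filter (r a)) : ℝ))) : ℝ) * k
      = ∑ a ∈ S.filter (fun a => k < (#(T.filter (r a)) : ℝ)), k := by
        rw [sum_const, nsmul_eq_mul]
    _ ≤ ∑ a ∈ S.filter (fun a => k < (#(T.filter (r a)) : ℝ)), (#(T.filter (r a)) : ℝ) :=
        sum_le_sum fun a ha => (mem_filter.1 ha).2.le
    _ ≤ ∑ a ∈ S, (#(T.filter (r a)) : ℝ) :=
        sum_le_sum_of_subset_of_nonneg (filter_subset _ _) fun _ _ _ => by positivity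
    _ ≤ K := hK

lemma aux_path {F : Type*} [Field F] [DecidableEq F] (A B A2 : Finset F) (h0 : (0 : F) ∉ A)
    (hB : B = A.image (fun a => a + 1)) (hA2 : A2 ⊆ A)
    (M m τ ε : ℝ) (hM : (#(A * B) : ℝ) = M) (hm : (#A2 : ℝ) = m) (hm0 : 0 < m) (hM0 : 0 < M)
    (hτ : 0 ≤ τ) (hε : 8 * ε * M ≤ m / 48)
    (hbad : (#((A2 ×ˢ A2).filter (fun x => (#((A * A).filter
      (fun y => (x.1 ∈ A ∧ y / x.1 ∈ A) ∧ (x.2 ∈ A ∧ y / x.2 ∈ A))) : ℝ) < τ)) : ℝ)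
        ≤ ε * m ^ 2) :
    ∃ A3 A' Z : Finset F, A3 ⊆ A' ∧ A' ⊆ A ∧ m ≤ 2 * #A3 ∧
      (∀ s ∈ A3, 6 * #(A3.filter (fun a => s * (a + 1) ∉ Z)) ≤ #A3) ∧
      (#(A' - Z) : ℝ) * (m ^ 2 / (96 * M)) * τ ≤ M ^ 2 * #(A * A) := by
  classical
  set θ := m ^ 2 / (48 * M) with hθ
  have hθ0 : 0 < θ := by positivity
  let cod : F → F → Finset F := fun a a' =>
    (A * A).filter (fun y => (a ∈ A ∧ y / a ∈ A) ∧ (a' ∈ A ∧ y / a' ∈ A))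
  let bad : F → F → Prop := fun a a' => (#(cod a a') : ℝ) < τ
  let nb : F → Finset F := fun c => A2.filter (fun a => c / a ∈ B)
  let Z := (A * B).filter (fun c => θ ≤ (#(nb c) : ℝ))
  let r : F → F → Prop := fun s a => s * (a + 1) ∉ Z
  let L1 := A2.filter (fun a => θ / 2 < (#(A2.filter (bad a)) : ℝ))
  let L2 := A2.filter (fun s => m / 12 < (#(A2.filter (r s)) : ℝ))
  have hne : ∀ a ∈ A2, a ≠ 0 := fun a ha h => h0 (h ▸ hA2 ha)
  have hL1 : (#L1 : ℝ) ≤ m / 4 := by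
    have := aux_markov A2 A2 bad (θ / 2) (ε * m ^ 2) hbad
    have h2 : ε * m ^ 2 ≤ m / 4 * (θ / 2) := by
      have : ε ≤ m / (384 * M) := by
        rw [le_div_iff₀ (by positivity)]; linarith
      calc ε * m ^ 2 ≤ m / (384 * M) * m ^ 2 := by gcongr
        _ = _ := by rw [hθ]; field_simp; norm_num
    exact le_of_mul_le_mul_right (this.trans h2) (by positivity)
  have hL2 : (#L2 : ℝ) ≤ m / 4 := by
    have hcount : (#((A2 ×ˢ A2).filter (fun x => r x.1 x.2)) : ℝ) ≤ m ^ 2 / 48 := by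
      let C0 := (A * B).filter (fun c => ¬ θ ≤ (#(nb c) : ℝ))
      have e : #((A2 ×ˢ A2).filter (fun x => r x.1 x.2)) ≤ ∑ c ∈ C0, #(nb c) := by
        rw [card_eq_sum_card_fiberwise (f := fun x => x.1 * (x.2 + 1)) (t := C0)]
        · refine sum_le_sum fun c hc => ?_
          refine card_le_card_of_injOn (fun x => x.1) ?_ ?_
          · rintro ⟨s, a⟩ hx
            simp only [coe_filter, mem_filter, mem_product, Set.mem_ofPred_eq] at hx
            obtain ⟨⟨⟨hs, ha⟩, _⟩, rfl⟩ := hx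
            simp only [nb, coe_filter, Set.mem_ofPred_eq]
            refine ⟨hs, ?_⟩
            rw [mul_div_cancel_left₀ _ (hne s hs), hB]
            exact mem_image_of_mem _ (hA2 ha)
          · rintro ⟨s, a⟩ hx ⟨s', a'⟩ hx' h
            simp only [coe_filter, mem_filter, mem_product, Set.mem_ofPred_eq] at hx hx' h
            subst h
            have := mul_left_cancel₀ (hne s hx.1.1.1) (hx.2.trans hx'.2.symm)
            have : a = a' := by simpa using this
            rw [this]
        · rintro ⟨s, a⟩ hx
          simp only [coe_filter, mem_product, Set.mem_ofPred_eq, r, Z, mem_filter, not_and] at hx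
          obtain ⟨⟨hs, ha⟩, h⟩ := hx
          have hmem : s * (a + 1) ∈ A * B :=
            mul_mem_mul (hA2 hs) (by rw [hB]; exact mem_image_of_mem _ (hA2 ha))
          exact mem_coe.2 (mem_filter.2 ⟨hmem, h hmem⟩)
      calc (#((A2 ×ˢ A2).filter (fun x => r x.1 x.2)) : ℝ) ≤ ∑ c ∈ C0, (#(nb c) : ℝ) := by
            exact_mod_cast e
        _ ≤ ∑ c ∈ C0, θ := sum_le_sum fun c hc => (not_le.1 (mem_filter.1 hc).2).le
        _ = #C0 * θ := by rw [sum_const, nsmul_eq_mul]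
        _ ≤ M * θ := by
          gcongr; rw [← hM]; exact_mod_cast card_filter_le _ _
        _ = _ := by rw [hθ]; field_simp
    have := aux_markov A2 A2 r (m / 12) (m ^ 2 / 48) hcount
    have h2 : m ^ 2 / 48 = m / 4 * (m / 12) := by ring
    rw [h2] at this
    exact le_of_mul_le_mul_right this (by positivity)
  have hc3 : m ≤ 2 * (#((A2 \ L1) \ L2) : ℝ) := by
    have k1 := le_card_sdiff L2 (A2 \ L1)
    have k2 := le_card_sdiff L1 A2
    have k3 : #A2 ≤ #((A2 \ L1) \ L2) + #L1 + #L2 := by omega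
    have k4 : m ≤ (#((A2 \ L1) \ L2) : ℝ) + #L1 + #L2 := by rw [← hm]; exact_mod_cast k3
    linarith
  refine ⟨(A2 \ L1) \ L2, A2 \ L1, Z, sdiff_subset, sdiff_subset.trans hA2, hc3, ?_, ?_⟩
  · intro s hs
    rw [mem_sdiff, mem_sdiff] at hs
    have hsL : ¬ (m / 12 < (#(A2.filter (r s)) : ℝ)) := fun h =>
      hs.2 (mem_filter.2 ⟨hs.1.1, h⟩)
    have hle : #(((A2 \ L1) \ L2).filter (fun a => s * (a + 1) ∉ Z)) ≤ #(A2.filter (r s)) :=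
      card_le_card (filter_subset_filter _ (sdiff_subset.trans sdiff_subset))
    have hle' : (#(((A2 \ L1) \ L2).filter (fun a => s * (a + 1) ∉ Z)) : ℝ)
      ≤ #(A2.filter (r s)) := by exact_mod_cast hle
    have : (6 : ℝ) * #(((A2 \ L1) \ L2).filter (fun a => s * (a + 1) ∉ Z))
      ≤ #((A2 \ L1) \ L2) := by linarith
    exact_mod_cast this
  · let P := (A * B) ×ˢ ((A * B) ×ˢ (A * A))
    let Q : F → Finset (F × F × F) := fun d => P.filter (fun x => x.1 - x.2.1 - x.2.2 = d)
    have hQ : ∀ d ∈ (A2 \ L1) - Z, θ / 2 * τ ≤ (#(Q d) : ℝ) := by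
      intro d hd
      obtain ⟨a, ha, z, hz, rfl⟩ := mem_sub.1 hd
      rw [mem_sdiff] at ha
      have haL : ¬ (θ / 2 < (#(A2.filter (bad a)) : ℝ)) := fun h =>
        ha.2 (mem_filter.2 ⟨ha.1, h⟩)
      have hz' := (mem_filter.1 hz).2
      let G := (nb z).filter (fun a1 => ¬ bad a a1)
      have hG : θ / 2 ≤ (#G : ℝ) := by
        have k1 := card_filter_add_card_filter_not (s := nb z) (fun a1 => bad a a1)
        have k2 : #((nb z).filter (fun a1 => bad a a1)) ≤ #(A2.filter (bad a)) :=
          card_le_card (filter_subset_filter _ (filter_subset _ _))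
        have k3 : #(nb z) ≤ #(A2.filter (bad a)) + #G := by
          have : #G = #((nb z).filter (fun a1 => ¬ bad a a1)) := rfl
          omega
        have k4 : (#(nb z) : ℝ) ≤ #(A2.filter (bad a)) + #G := by exact_mod_cast k3
        linarith
      have hinj : #(G.sigma (fun a1 => cod a a1)) ≤ #(Q (a - z)) := by
        refine card_le_card_of_injOn (fun x => (a + x.2, x.1 + x.2, z - x.1)) ?_ ?_
        · rintro ⟨a1, y1⟩ hx
          simp only [coe_sigma, Set.mem_sigma_iff, mem_coe] at hx
          obtain ⟨hx1, hx2⟩ := hx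
          simp only [G, nb, mem_filter] at hx1
          simp only [cod, mem_filter] at hx2
          obtain ⟨⟨ha1, hza⟩, _⟩ := hx1
          obtain ⟨_, ⟨haA, hya⟩, haA1, hya1⟩ := hx2
          have hsum : ∀ b ∈ A2, y1 / b ∈ A → b + y1 ∈ A * B := by
            intro b hb hyb
            have : b + y1 = b * (y1 / b + 1) := by
              have := hne b hb
              field_simp
              ring
            rw [this]
            exact mul_mem_mul (hA2 hb) (by rw [hB]; exact mem_image_of_mem _ hyb)
          have hzz : z - a1 ∈ A * A := by
            rw [hB, mem_image] at hza
            obtain ⟨b, hb, hbz⟩ := hza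
            have : z - a1 = a1 * b := by
              have h1 := hne a1 ha1
              rw [eq_div_iff h1] at hbz
              rw [← hbz]; ring
            rw [this]
            exact mul_mem_mul (hA2 ha1) hb
          simp only [Q, P, coe_filter, mem_product, Set.mem_ofPred_eq]
          exact ⟨⟨hsum a ha.1 hya, hsum a1 ha1 hya1, hzz⟩, by ring⟩
        · rintro ⟨a1, y1⟩ _ ⟨a2, y2⟩ _ h
          simp only [Prod.mk.injEq, add_right_inj, sub_right_inj] at h
          obtain ⟨rfl, _, rfl⟩ := h
          rfl
      rw [card_sigma] at hinj
      calc θ / 2 * τ ≤ #G * τ := by gcongr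
        _ = ∑ a1 ∈ G, τ := by rw [sum_const, nsmul_eq_mul]
        _ ≤ ∑ a1 ∈ G, (#(cod a a1) : ℝ) :=
          sum_le_sum fun a1 h => not_lt.1 (mem_filter.1 h).2
        _ ≤ _ := by exact_mod_cast hinj
    have hsum : ∑ d ∈ (A2 \ L1) - Z, #(Q d) ≤ #P := by
      rw [← card_biUnion]
      · exact card_le_card (biUnion_subset.2 fun _ _ => filter_subset _ _)
      · intro d _ d' _ hne
        refine disjoint_left.2 fun x hx hx' => hne ?_
        exact (mem_filter.1 hx).2.symm.trans (mem_filter.1 hx').2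
    calc (#((A2 \ L1) - Z) : ℝ) * (m ^ 2 / (96 * M)) * τ
        = ∑ d ∈ (A2 \ L1) - Z, θ / 2 * τ := by
          rw [sum_const, nsmul_eq_mul, hθ]; ring
      _ ≤ ∑ d ∈ (A2 \ L1) - Z, (#(Q d) : ℝ) := sum_le_sum hQ
      _ ≤ #P := by exact_mod_cast hsum
      _ = _ := by
        simp only [P, card_product]
        push_cast
        rw [hM]; ring

lemma aux_core {p : ℕ} [Fact p.Prime] (A B : Finset (ZMod p)) (hne : A.Nonempty)
    (h0 : (0 : ZMod p) ∉ A) (hB : B = A.image (fun a => a + 1)) (hB0 : (0 : ZMod p) ∉ B)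
    (hp : #A ^ 2 ≤ p) (hE : #A ^ 4 ≤ #(A * B) * mulEnergy A A) :
    (#A : ℝ) ^ 57 ≤ 2 ^ 16 * 2048 * 147456 ^ 5 * (#(A * B) : ℝ) ^ 56 := by
  classical
  let N : ZMod p → Finset (ZMod p) := fun y => A.filter (fun a => y / a ∈ A)
  have hne0 : ∀ a ∈ A, a ≠ 0 := fun a ha h => h0 (h ▸ ha)
  have hBc : #B = #A := by rw [hB, card_image_of_injective _ (add_left_injective 1)]
  have hBne : B.Nonempty := by rw [hB]; exact hne.image _
  have hNc : ∀ y, #(N y) = #((A ×ˢ A).filter (fun x => x.1 * x.2 = y)) := by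
    intro y
    refine card_bij (fun a _ => (a, y / a)) ?_ ?_ ?_
    · intro a ha
      simp only [N, mem_filter] at ha
      simp only [mem_filter, mem_product]
      exact ⟨ha, mul_div_cancel₀ _ (hne0 a ha.1)⟩
    · intro a _ b _ h
      exact (Prod.mk.inj h).1
    · rintro ⟨a, b⟩ h
      simp only [mem_filter, mem_product] at h
      obtain ⟨⟨ha, hb⟩, rfl⟩ := h
      refine ⟨a, ?_, ?_⟩
      · simp only [N, mem_filter, mul_div_cancel_left₀ _ (hne0 a ha)]
        exact ⟨ha, hb⟩
      · simp only [mul_div_cancel_left₀ _ (hne0 a ha)]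
  have hS1 : ∑ y ∈ A * A, #(N y) = #A ^ 2 := by
    rw [sq, ← card_product, card_eq_sum_card_fiberwise (f := fun x => x.1 * x.2) (t := A * A)]
    · exact sum_congr rfl fun y _ => hNc y
    · intro x hx
      rw [mem_coe, mem_product] at hx
      exact mem_coe.2 (mul_mem_mul hx.1 hx.2)
  have hS2 : mulEnergy A A = ∑ y ∈ A * A, #(N y) ^ 2 := by
    rw [mulEnergy_eq_sum_sq']
    exact sum_congr rfl fun y _ => by rw [hNc y]
  set n : ℝ := (#A : ℝ) with hn
  set M : ℝ := (#(A * B) : ℝ) with hM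
  have hn0 : 0 < n := by rw [hn]; exact_mod_cast hne.card_pos
  have hM0 : 0 < M := by rw [hM]; exact_mod_cast (hne.mul hBne).card_pos
  set ε : ℝ := n ^ 2 / (768 * M ^ 2) with hε
  have hε0 : 0 < ε := by positivity
  obtain ⟨y, hy, hm1, hm2⟩ := aux_drc A (A * A) N (fun _ _ => filter_subset _ _) (by
      intro y hy
      obtain ⟨a, ha, b, hb, rfl⟩ := mem_mul.1 hy
      refine ⟨a, mem_filter.2 ⟨ha, ?_⟩⟩
      rwa [mul_div_cancel_left₀ _ (hne0 a ha)]) (hne.mul hne) M ε n rfl hM0 hε0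
    (by rw [hn]; exact_mod_cast hS1.le)
    (by rw [hn, hM]; rw [hS2] at hE; exact_mod_cast hE)
  set m : ℝ := (#(N y) : ℝ) with hm
  have hm0 : 0 < m := by
    by_contra h
    have : 2 * M * m ≤ 0 := mul_nonpos_of_nonneg_of_nonpos (by positivity) (not_lt.1 h)
    have : 0 < n ^ 2 := by positivity
    linarith
  obtain ⟨A3, A', Z, h3, h', hmA, hZ, hD⟩ := aux_path A B (N y) h0 hB (filter_subset _ _) M m
    (ε * n ^ 2 / (2 * M)) ε rfl rfl hm0 hM0 (by positivity)
    (by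
      have : 8 * ε * M = n ^ 2 / (96 * M) := by rw [hε]; field_simp; norm_num
      rw [this, div_le_iff₀ (by positivity)]
      linarith)
    (by simpa only [N, mem_filter] using hm2)
  have hend := aux_endgame A3 A' Z h3 (fun h => h0 (h' (h3 h)))
    ((Nat.pow_le_pow_left (card_le_card (h3.trans h')) 2).trans hp) hZ
  have hY := aux_mul_self A B h0 hB0
  rw [hBc] at hY
  set D : ℝ := (#(A' - Z) : ℝ) with hDdef
  have hD0 : 0 ≤ D := by positivity
  have hYr : (#(A * A) : ℝ) * n ≤ M ^ 2 := by rw [sq, hn, hM]; exact_mod_cast hY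
  have e1 : D * m ^ 2 * n ^ 5 ≤ 147456 * M ^ 8 := by
    have k : D * (m ^ 2 / (96 * M)) * (ε * n ^ 2 / (2 * M)) =
        D * m ^ 2 * n ^ 4 / (147456 * M ^ 4) := by
      rw [hε]; field_simp; ring
    rw [k, div_le_iff₀ (by positivity)] at hD
    calc D * m ^ 2 * n ^ 5 = D * m ^ 2 * n ^ 4 * n := by ring
      _ ≤ (M ^ 2 * #(A * A) * (147456 * M ^ 4)) * n := by gcongr
      _ = 147456 * M ^ 6 * (#(A * A) * n) := by ring
      _ ≤ 147456 * M ^ 6 * M ^ 2 := by gcongr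
      _ = _ := by ring
  have e2 : m ^ 6 ≤ 2048 * D ^ 5 := by
    have k1 : (#A3 : ℝ) ^ 3 * (#A' : ℝ) ^ 3 ≤ 32 * D ^ 5 := by rw [hDdef]; exact_mod_cast hend
    have k2 : (#A3 : ℝ) ≤ #A' := by exact_mod_cast card_le_card h3
    calc m ^ 6 ≤ (2 * #A3 : ℝ) ^ 6 := by gcongr
      _ = 64 * ((#A3 : ℝ) ^ 3 * (#A3 : ℝ) ^ 3) := by ring
      _ ≤ 64 * ((#A3 : ℝ) ^ 3 * (#A' : ℝ) ^ 3) := by gcongr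
      _ ≤ 64 * (32 * D ^ 5) := by gcongr
      _ = _ := by ring
  calc n ^ 57 = (n ^ 2) ^ 16 * n ^ 25 := by ring
    _ ≤ (2 * M * m) ^ 16 * n ^ 25 := by gcongr
    _ = 2 ^ 16 * M ^ 16 * (m ^ 6 * (m ^ 10 * n ^ 25)) := by ring
    _ ≤ 2 ^ 16 * M ^ 16 * ((2048 * D ^ 5) * (m ^ 10 * n ^ 25)) := by gcongr
    _ = 2 ^ 16 * 2048 * M ^ 16 * (D * m ^ 2 * n ^ 5) ^ 5 := by ring
    _ ≤ 2 ^ 16 * 2048 * M ^ 16 * (147456 * M ^ 8) ^ 5 := by gcongr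
    _ = _ := by ring

lemma aux_energy_cs {p : ℕ} [Fact p.Prime] (A B : Finset (ZMod p)) (hA : (0 : ZMod p) ∉ A)
    (hB : (0 : ZMod p) ∉ B) : mulEnergy A B ^ 2 ≤ mulEnergy A A * mulEnergy B B := by
  classical
  let q : Finset (ZMod p) → ZMod p → ℕ := fun S ρ =>
    #((S ×ˢ S).filter (fun x => x.1 / x.2 = ρ))
  have key : ∀ S T : Finset (ZMod p), (0 : ZMod p) ∉ S → (0 : ZMod p) ∉ T →
      mulEnergy S T = ∑ ρ, q S ρ * q T ρ := by
    intro S T hS hT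
    unfold mulEnergy
    rw [card_eq_sum_card_fiberwise (f := fun x => x.1.1 / x.1.2) (t := univ) (by simp)]
    refine sum_congr rfl fun ρ _ => ?_
    simp only [q]
    rw [← card_product]
    refine card_bij (fun x _ => (x.1, (x.2.2, x.2.1))) ?_ ?_ ?_
    · rintro ⟨⟨a, b⟩, ⟨c, d⟩⟩ h
      simp only [mem_filter, mem_product] at h ⊢
      obtain ⟨⟨⟨⟨ha, hb⟩, hc, hd⟩, h⟩, rfl⟩ := h
      refine ⟨⟨⟨ha, hb⟩, rfl⟩, ⟨hd, hc⟩, ?_⟩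
      have hb0 : b ≠ 0 := fun e => hS (e ▸ hb)
      have hc0 : c ≠ 0 := fun e => hT (e ▸ hc)
      rw [div_eq_div_iff hc0 hb0]
      linear_combination -h
    · rintro ⟨⟨a, b⟩, ⟨c, d⟩⟩ _ ⟨⟨a', b'⟩, ⟨c', d'⟩⟩ _ h
      simp only [Prod.mk.injEq] at h ⊢
      tauto
    · rintro ⟨⟨a, b⟩, ⟨d, c⟩⟩ h
      simp only [mem_filter, mem_product] at h
      obtain ⟨⟨⟨ha, hb⟩, rfl⟩, ⟨hd, hc⟩, h⟩ := h
      refine ⟨((a, b), (c, d)), ?_, rfl⟩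
      simp only [mem_filter, mem_product]
      refine ⟨⟨⟨⟨ha, hb⟩, hc, hd⟩, ?_⟩, trivial⟩
      have hb0 : b ≠ 0 := fun e => hS (e ▸ hb)
      have hc0 : c ≠ 0 := fun e => hT (e ▸ hc)
      rw [div_eq_div_iff hc0 hb0] at h
      linear_combination -h
  rw [key A B hA hB, key A A hA hA, key B B hB hB]
  have := sum_mul_sq_le_sq_mul_sq (univ : Finset (ZMod p)) (q A) (q B)
  simpa only [sq] using this

lemma aux_main {p : ℕ} [Fact p.Prime] (A B : Finset (ZMod p)) (hne : A.Nonempty)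
    (h0 : (0 : ZMod p) ∉ A) (hB : B = A.image (fun a => a + 1)) (hB0 : (0 : ZMod p) ∉ B)
    (hp : #A ^ 2 ≤ p) :
    (#A : ℝ) ^ 57 ≤ 2 ^ 16 * 2048 * 147456 ^ 5 * (#(A * B) : ℝ) ^ 56 := by
  classical
  have hBc : #B = #A := by rw [hB, card_image_of_injective _ (add_left_injective 1)]
  have h1 := le_card_mul_mul_mulEnergy A B
  have h2 := aux_energy_cs A B h0 hB0
  rw [hBc] at h1
  rcases le_or_gt (#A ^ 4) (#(A * B) * mulEnergy A A) with h | h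
  · exact aux_core A B hne h0 hB hB0 hp h
  have h3 : #A ^ 4 ≤ #(A * B) * mulEnergy B B := by
    by_contra! h'
    have k1 := Nat.mul_lt_mul'' h h'
    have k2 : (#A ^ 2 * #A ^ 2) ^ 2 ≤ (#(A * B) * mulEnergy A B) ^ 2 := Nat.pow_le_pow_left h1 2
    have k3 : (#(A * B) * mulEnergy A B) ^ 2 ≤
        #(A * B) * mulEnergy A A * (#(A * B) * mulEnergy B B) := by
      calc _ = #(A * B) ^ 2 * mulEnergy A B ^ 2 := by ring
        _ ≤ #(A * B) ^ 2 * (mulEnergy A A * mulEnergy B B) := Nat.mul_le_mul_left _ h2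
        _ = _ := by ring
    have k4 : (#A ^ 2 * #A ^ 2) ^ 2 = #A ^ 4 * #A ^ 4 := by ring
    omega
  have hni : Function.Injective (fun x : ZMod p => -x) := neg_injective
  have hc1 : #(B.image (fun x => -x)) = #A := by rw [card_image_of_injective _ hni, hBc]
  have hmul : B.image (fun x => -x) * A.image (fun x => -x) = A * B := by
    ext x
    simp only [mem_mul, mem_image, exists_exists_and_eq_and]
    constructor
    · rintro ⟨b, hb, a, ha, rfl⟩; exact ⟨a, ha, b, hb, by ring⟩
    · rintro ⟨a, ha, b, hb, rfl⟩; exact ⟨b, hb, a, ha, by ring⟩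
  have hen : mulEnergy B B ≤ mulEnergy (B.image (fun x => -x)) (B.image (fun x => -x)) := by
    unfold mulEnergy
    refine card_le_card_of_injOn (fun x => ((-x.1.1, -x.1.2), (-x.2.1, -x.2.2))) ?_ ?_
    · rintro ⟨⟨a, b⟩, ⟨c, d⟩⟩ h
      simp only [coe_filter, mem_product, Set.mem_ofPred_eq] at h
      obtain ⟨⟨⟨ha, hb⟩, hc, hd⟩, h⟩ := h
      simp only [coe_filter, mem_product, Set.mem_ofPred_eq]
      refine ⟨⟨⟨mem_image_of_mem _ ha, mem_image_of_mem _ hb⟩, mem_image_of_mem _ hc,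
        mem_image_of_mem _ hd⟩, ?_⟩
      linear_combination h
    · rintro ⟨⟨a, b⟩, ⟨c, d⟩⟩ _ ⟨⟨a', b'⟩, ⟨c', d'⟩⟩ _ h
      simpa using h
  have := aux_core (B.image (fun x => -x)) (A.image (fun x => -x))
    (by rw [← card_pos, hc1]; exact hne.card_pos) (by simpa using hB0) (by
      rw [hB]
      ext x
      simp only [mem_image, exists_exists_and_eq_and]
      constructor
      · rintro ⟨a, ha, rfl⟩; exact ⟨a, ha, by ring⟩
      · rintro ⟨a, ha, rfl⟩; exact ⟨a, ha, by ring⟩) (by simpa using h0) (by rw [hc1]; exact hp)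
    (by rw [hc1, hmul]; exact h3.trans (Nat.mul_le_mul_left _ hen))
  rwa [hc1, hmul] at this

lemma aux_general {p : ℕ} [Fact p.Prime] (A : Finset (ZMod p)) (hne : A.Nonempty)
    (hp : #A ^ 2 ≤ p) (K L : ℝ) (hK : 1 ≤ K) (hL : 4 ^ 57 ≤ L)
    (H : ∀ (A B : Finset (ZMod p)), A.Nonempty → (0 : ZMod p) ∉ A →
      B = A.image (fun a => a + 1) → (0 : ZMod p) ∉ B → #A ^ 2 ≤ p →
      (#A : ℝ) ^ 57 ≤ K * (#(A * B) : ℝ) ^ 56) :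
    (#A : ℝ) ^ 57 ≤ L * K *
      (#(image₂ (fun a b => a * (b + 1)) A A) : ℝ) ^ 56 := by
  classical
  set M := #(image₂ (fun a b => a * (b + 1)) A A) with hM
  have hM1 : (1 : ℝ) ≤ M := by
    have : 0 < M := (hne.image₂ hne).card_pos
    exact_mod_cast this
  have hM56 : (1 : ℝ) ≤ (M : ℝ) ^ 56 := one_le_pow₀ hM1
  rcases le_or_gt #A 3 with h | h
  · have h4 : (#A : ℝ) ≤ 4 := by exact_mod_cast h.trans (by norm_num)
    have h5 : (#A : ℝ) ^ 57 ≤ L := (pow_le_pow_left₀ (by positivity) h4 57).trans hL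
    have hL0 : 0 ≤ L := le_trans (by positivity) h5
    calc (#A : ℝ) ^ 57 ≤ L := h5
      _ = L * 1 * 1 := by ring
      _ ≤ _ := by gcongr
  · let A0 := A \ {0, -1}
    have hc : #A ≤ 2 * #A0 := by
      have k1 := le_card_sdiff ({0, -1} : Finset (ZMod p)) A
      have k2 : #({0, -1} : Finset (ZMod p)) ≤ 2 := card_le_two
      have : #A0 = #(A \ {0, -1}) := rfl
      omega
    have hsub : A0 ⊆ A := sdiff_subset
    have hm := H A0 (A0.image (fun a => a + 1)) (by rw [← card_pos]; omega)
      (by simp [A0]) rfl (by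
        simp only [mem_image, not_exists, not_and, A0, mem_sdiff, mem_insert, mem_singleton]
        rintro x ⟨_, hx⟩ h
        exact hx (Or.inr (eq_neg_of_add_eq_zero_left h)))
      ((Nat.pow_le_pow_left (card_le_card hsub) 2).trans hp)
    have hMM : #(A0 * A0.image (fun a => a + 1)) ≤ M := by
      refine card_le_card ?_
      intro x hx
      obtain ⟨a, ha, b, hb, rfl⟩ := mem_mul.1 hx
      obtain ⟨b', hb', rfl⟩ := mem_image.1 hb
      exact mem_image₂.2 ⟨a, hsub ha, b', hsub hb', rfl⟩
    have hMM' : (#(A0 * A0.image (fun a => a + 1)) : ℝ) ≤ M := by exact_mod_cast hMM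
    have hc' : (#A : ℝ) ≤ 2 * #A0 := by exact_mod_cast hc
    have h24 : (2 : ℝ) ^ 57 ≤ 4 ^ 57 := pow_le_pow_left₀ (by norm_num) (by norm_num) 57
    have h2L : (2 : ℝ) ^ 57 ≤ L := h24.trans hL
    have hL0 : 0 ≤ L := le_trans (by positivity) h2L
    calc (#A : ℝ) ^ 57 ≤ (2 * #A0 : ℝ) ^ 57 := by gcongr
      _ = 2 ^ 57 * (#A0 : ℝ) ^ 57 := by rw [mul_pow]
      _ ≤ L * (K * (M : ℝ) ^ 56) := by
        refine mul_le_mul h2L (hm.trans ?_) (pow_nonneg (Nat.cast_nonneg _) _) hL0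
        gcongr
      _ = _ := by rw [mul_assoc]
end helpers

theorem stmt8 :
    ∃ c C : ℝ, 0 < c ∧ 0 < C ∧ ∀ (p : ℕ) [Fact p.Prime] (A : Finset (ZMod p)),
      A.Nonempty → (A.card : ℝ) < Real.sqrt p →
      c * (A.card : ℝ) ^ ((57 : ℝ) / 56) / (Real.log A.card) ^ C ≤
        ((Finset.image₂ (fun a b => a * (b + 1)) A A).card : ℝ) := by
  obtain ⟨K₁, hK₁, hK₁'⟩ : ∃ K₁ : ℝ, 1 ≤ K₁ ∧ K₁ = 2 ^ 16 * 2048 * 147456 ^ 5 :=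
    ⟨_, by norm_num, rfl⟩
  obtain ⟨L, hL, hL1⟩ : ∃ L : ℝ, 4 ^ 57 ≤ L ∧ 1 ≤ L := ⟨_, le_rfl, by norm_num⟩
  obtain ⟨K, hK1, hK⟩ : ∃ K : ℝ, 1 ≤ K ∧ ∀ (p : ℕ) [Fact p.Prime] (A : Finset (ZMod p)),
      A.Nonempty → #A ^ 2 ≤ p →
      (#A : ℝ) ^ 57 ≤ K * (#(image₂ (fun a b => a * (b + 1)) A A) : ℝ) ^ 56 := by
    refine ⟨L * K₁, one_le_mul_of_one_le_of_one_le hL1 hK₁, fun p _ A hne hp => ?_⟩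
    refine aux_general A hne hp K₁ L hK₁ hL fun A B h1 h2 h3 h4 h5 => ?_
    rw [hK₁']
    exact aux_main A B h1 h2 h3 h4 h5
  have hK0 : 0 < K := by linarith
  refine ⟨1 / (2 * K), 1, by positivity, one_pos, ?_⟩
  intro p _ A hne hA
  have hp : #A ^ 2 ≤ p := by
    have := (Real.lt_sqrt (by positivity)).1 hA
    have h : #A ^ 2 < p := by exact_mod_cast this
    exact h.le
  have h := hK p A hne hp
  set M : ℝ := (#(image₂ (fun a b => a * (b + 1)) A A) : ℝ) with hM
  have hM0 : 0 ≤ M := by positivity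
  rw [Real.rpow_one]
  have hroot : (#A : ℝ) ^ ((57 : ℝ) / 56) ≤ K * M := by
    have h1 : ((#A : ℝ) ^ ((57 : ℝ) / 56)) ^ 56 = (#A : ℝ) ^ 57 := by
      rw [← Real.rpow_natCast, ← Real.rpow_mul (by positivity), ← Real.rpow_natCast]
      norm_num
    refine le_of_pow_le_pow_left₀ (n := 56) (by norm_num) (by positivity) ?_
    rw [h1, mul_pow]
    refine h.trans ?_
    gcongr
    exact le_self_pow₀ hK1 (by norm_num)
  have hpos : 0 < #A := hne.card_pos
  rcases Nat.lt_or_ge 1 #A with h1 | h1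
  · have hlog : (1 : ℝ) / 2 ≤ Real.log #A := by
      have : Real.log 2 ≤ Real.log #A := Real.log_le_log (by norm_num) (by exact_mod_cast h1)
      have := Real.log_two_gt_d9
      linarith
    rw [div_le_iff₀ (by linarith)]
    calc 1 / (2 * K) * (#A : ℝ) ^ ((57 : ℝ) / 56) ≤ 1 / (2 * K) * (K * M) := by gcongr
      _ = M * (1 / 2) := by field_simp
      _ ≤ _ := by gcongr
  · have h1 : #A = 1 := by omega
    rw [h1]
    simpa using hM0
end

section
/- For any finite set A ⊆ ℝ, |A(A+1)| ≥ c · |A|^{24/19} / (log |A|)^{C} for absolute constants c, C > 0, where A(A+1) = {a(b+1) : a, b ∈ A}. -/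
open Finset

lemma block_map (X : Finset ℝ) (r : ℕ) (hr : 1 ≤ r) (hX : r ≤ #X) :
    ∃ (φ : ℝ → ℕ) (s : ℕ), Monotone φ ∧ (∀ x ∈ X, φ x < r) ∧
      (∀ k, #{x ∈ X | φ x = k} ≤ s) ∧ s * r ≤ 2 * #X := by
  classical
  set N := #X with hN
  set s := (N + r - 1) / r with hs
  have hs1 : s * r ≤ N + r - 1 := Nat.div_mul_le_self _ _
  have hs2 : N ≤ s * r := by
    have := Nat.lt_div_mul_add (a := N + r - 1) (b := r) (by omega)
    rw [← hs] at this
    omega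
  have hs0 : 0 < s := by
    rcases Nat.eq_zero_or_pos s with h | h
    · rw [h] at hs2; omega
    · exact h
  let rk : ℝ → ℕ := fun x => #{y ∈ X | y < x}
  have hmono : Monotone rk := by
    intro x y hxy
    apply card_le_card
    intro z hz
    simp only [mem_filter] at hz ⊢
    exact ⟨hz.1, lt_of_lt_of_le hz.2 hxy⟩
  have hstrict : ∀ x ∈ X, ∀ y, x < y → rk x < rk y := by
    intro x hx y hxy
    apply card_lt_card
    refine ⟨?_, ?_⟩
    · intro z hz
      simp only [mem_filter] at hz ⊢
      exact ⟨hz.1, lt_trans hz.2 hxy⟩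
    · intro h
      have := h (mem_filter.mpr ⟨hx, hxy⟩)
      simp at this
  have hlt : ∀ x ∈ X, rk x < N := by
    intro x hx
    apply card_lt_card
    refine ⟨filter_subset _ _, ?_⟩
    intro h
    have := h hx
    simp at this
  have hinj : Set.InjOn rk X := by
    intro x hx y hy hxy
    rcases lt_trichotomy x y with h | h | h
    · exact absurd hxy (hstrict x hx y h).ne
    · exact h
    · exact absurd hxy (hstrict y hy x h).ne'
  refine ⟨fun x => rk x / s, s, ?_, ?_, ?_, ?_⟩
  · intro x y hxy
    exact Nat.div_le_div_right (hmono hxy)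
  · intro x hx
    rw [Nat.div_lt_iff_lt_mul hs0]
    have := hlt x hx
    rw [mul_comm]; omega
  · intro k
    have : #{x ∈ X | rk x / s = k} ≤ #(Finset.Ico (k * s) (k * s + s)) := by
      apply card_le_card_of_injOn rk
      · intro x hx
        simp only [coe_filter, Set.mem_ofPred_eq] at hx
        simp only [coe_Ico, Set.mem_Ico]
        have h := hx.2
        rw [Nat.div_eq_iff hs0] at h
        constructor
        · exact h.1
        · have := h.2; omega
      · intro x hx y hy h
        simp only [coe_filter, Set.mem_ofPred_eq] at hx hy
        exact hinj hx.1 hy.1 h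
    simpa using this
  · omega

lemma card_le_offDiag {α : Type*} [DecidableEq α] (S : Finset α) (g : α → ℕ) (M : ℕ)
    (hg : ∀ x ∈ S, g x < M) :
    #S ≤ M + #{p ∈ S.offDiag | g p.1 = g p.2} := by
  have h1 : #S = ∑ k ∈ range M, #{x ∈ S | g x = k} :=
    card_eq_sum_card_fiberwise (fun x hx => by simpa using hg x hx)
  have h2 : #{p ∈ S.offDiag | g p.1 = g p.2} =
      ∑ k ∈ range M, #{p ∈ {p ∈ S.offDiag | g p.1 = g p.2} | g p.1 = k} :=
    card_eq_sum_card_fiberwise (fun p hp => by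
      simp only [coe_filter, mem_offDiag, Set.mem_ofPred_eq] at hp
      simpa using hg _ hp.1.1)
  rw [h1, h2]
  have h3 : M = ∑ k ∈ range M, 1 := by simp
  conv_rhs => rw [h3]
  simp only [sum_const, smul_eq_mul, mul_one, card_range]
  conv_rhs => enter [1]; rw [h3]
  rw [← sum_add_distrib]
  apply sum_le_sum
  intro k _
  have h4 : {p ∈ {p ∈ S.offDiag | g p.1 = g p.2} | g p.1 = k} = ({x ∈ S | g x = k}).offDiag := by
    ext ⟨a, b⟩
    simp only [mem_filter, mem_offDiag]
    constructor
    · rintro ⟨⟨⟨h1, h2, h3⟩, h4⟩, h5⟩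
      exact ⟨⟨h1, h5⟩, ⟨h2, by rw [← h4]; exact h5⟩, h3⟩
    · rintro ⟨⟨h1, h5⟩, ⟨h2, h6⟩, h3⟩
      exact ⟨⟨⟨h1, h2, h3⟩, by rw [h5, h6]⟩, h5⟩
  rw [h4, offDiag_card]
  generalize #{x ∈ S | g x = k} = m
  rcases m with _ | _ | m
  · simp
  · simp
  · have : (m+1+1) * (m+1+1) - (m+1+1) = (m+2)*(m+1) := by
      rw [Nat.sub_eq_iff_eq_add (by nlinarith)]; ring
    rw [this]; nlinarith

lemma st_grid (X Y : Finset ℝ) (L : Finset (ℝ × ℝ)) (hL : ∀ l ∈ L, l.1 ≠ 0) (r : ℕ)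
    (hr : 1 ≤ r) (hX : r ≤ #X) (hY : r ≤ #Y) :
    r ^ 2 * ∑ l ∈ L, #{x ∈ X | l.1 * x + l.2 ∈ Y} ≤ 2 * r ^ 3 * #L + 4 * #X ^ 2 * #Y ^ 2 := by
  classical
  obtain ⟨φ, s, hφm, hφr, hφs, hs⟩ := block_map X r hr hX
  obtain ⟨ψ, u, hψm, hψr, hψu, hu⟩ := block_map Y r hr hY
  let S : ℝ × ℝ → Finset ℝ := fun l => {x ∈ X | l.1 * x + l.2 ∈ Y}
  let T : ℝ × ℝ → Finset (ℝ × ℝ) := fun l => {p ∈ (S l).offDiag |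
    φ p.1 = φ p.2 ∧ ψ (l.1 * p.1 + l.2) = ψ (l.1 * p.2 + l.2)}
  have key : ∀ l ∈ L, #(S l) ≤ 2 * r + #(T l) := by
    intro l hl
    rcases lt_or_gt_of_ne (hL l hl) with h | h
    · refine (card_le_offDiag (S l) (fun x => φ x + (r - 1 - ψ (l.1 * x + l.2))) (2 * r) ?_).trans ?_
      · intro x hx
        simp only [S, mem_filter] at hx
        have := hφr x hx.1
        omega
      · gcongr 2 * r + ?_
        apply card_le_card
        intro p hp
        simp only [T, mem_filter] at hp ⊢
        refine ⟨hp.1, ?_⟩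
        have hp1 := hp.1
        simp only [S, mem_offDiag, mem_filter] at hp1
        have e1 := hψr _ hp1.1.2
        have e2 := hψr _ hp1.2.1.2
        have e3 := hp.2
        rcases le_total p.1 p.2 with hle | hle
        · have a1 := hφm hle
          have a2 : ψ (l.1 * p.2 + l.2) ≤ ψ (l.1 * p.1 + l.2) := hψm (by nlinarith)
          omega
        · have a1 := hφm hle
          have a2 : ψ (l.1 * p.1 + l.2) ≤ ψ (l.1 * p.2 + l.2) := hψm (by nlinarith)
          omega
    · refine (card_le_offDiag (S l) (fun x => φ x + ψ (l.1 * x + l.2)) (2 * r) ?_).trans ?_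
      · intro x hx
        simp only [S, mem_filter] at hx
        have := hφr x hx.1
        have := hψr _ hx.2
        omega
      · gcongr 2 * r + ?_
        apply card_le_card
        intro p hp
        simp only [T, mem_filter] at hp ⊢
        refine ⟨hp.1, ?_⟩
        have e3 := hp.2
        rcases le_total p.1 p.2 with hle | hle
        · have a1 := hφm hle
          have a2 : ψ (l.1 * p.1 + l.2) ≤ ψ (l.1 * p.2 + l.2) := hψm (by nlinarith)
          omega
        · have a1 := hφm hle
          have a2 : ψ (l.1 * p.2 + l.2) ≤ ψ (l.1 * p.1 + l.2) := hψm (by nlinarith)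
          omega
  have hT : ∑ l ∈ L, #(T l) ≤ #X * #Y * (s * u) := by
    rw [← card_sigma]
    have h1 : #(L.sigma T) ≤ #((X ×ˢ Y).sigma
        (fun p => {x ∈ X | φ x = φ p.1} ×ˢ {y ∈ Y | ψ y = ψ p.2})) := by
      apply card_le_card_of_injOn
        (fun q => (⟨(q.2.1, q.1.1 * q.2.1 + q.1.2), (q.2.2, q.1.1 * q.2.2 + q.1.2)⟩ :
          (_ : ℝ × ℝ) × (ℝ × ℝ)))
      · rintro ⟨⟨m, b⟩, ⟨x, x'⟩⟩ hq
        simp only [T, S, coe_sigma, Set.mem_sigma_iff, mem_coe, mem_filter, mem_offDiag, mem_product] at hq ⊢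
        obtain ⟨h1, ⟨⟨h2, h3⟩, ⟨h4, h5⟩, h6⟩, h7, h8⟩ := hq
        exact ⟨⟨h2, h3⟩, ⟨h4, h7.symm⟩, h5, h8.symm⟩
      · rintro ⟨⟨m, b⟩, ⟨x, x'⟩⟩ hq ⟨⟨m', b'⟩, ⟨z, z'⟩⟩ hq' heq
        simp only [T, S, coe_sigma, Set.mem_sigma_iff, mem_coe, mem_filter, mem_offDiag] at hq
        simp only [Sigma.mk.injEq, Prod.mk.injEq, heq_eq_eq] at heq
        obtain ⟨⟨rfl, h2⟩, rfl, h4⟩ := heq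
        have hne : x - x' ≠ 0 := sub_ne_zero.mpr hq.2.1.2.2
        have hm : m = m' := by
          apply mul_right_cancel₀ hne
          linarith
        subst hm
        have : b = b' := by linarith
        subst this
        rfl
    refine h1.trans ?_
    rw [card_sigma]
    calc _ ≤ ∑ p ∈ X ×ˢ Y, s * u := by
          apply sum_le_sum
          intro p _
          rw [card_product]
          exact Nat.mul_le_mul (hφs _) (hψu _)
      _ = _ := by simp
  have h2 : ∑ l ∈ L, #(S l) ≤ 2 * r * #L + #X * #Y * (s * u) := by
    calc _ ≤ ∑ l ∈ L, (2 * r + #(T l)) := sum_le_sum key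
      _ = 2 * r * #L + ∑ l ∈ L, #(T l) := by
          rw [sum_add_distrib]; simp; ring
      _ ≤ _ := by gcongr
  calc r ^ 2 * ∑ l ∈ L, #(S l) ≤ r ^ 2 * (2 * r * #L + #X * #Y * (s * u)) := by gcongr
    _ = 2 * r ^ 3 * #L + #X * #Y * ((s * r) * (u * r)) := by ring
    _ ≤ 2 * r ^ 3 * #L + #X * #Y * ((2 * #X) * (2 * #Y)) := by gcongr
    _ = _ := by ring

open scoped Pointwise in
/-- number of representations of `x` as a quotient `a / d` -/
def rr {G : Type*} [Mul G] [DecidableEq G] (A D : Finset G) (x : G) : ℕ := #{d ∈ D | x * d ∈ A}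

section grp
open scoped Pointwise
variable {G : Type*} [CommGroup G] [DecidableEq G]

lemma rr_eq_zero (A D : Finset G) (x : G) (hx : x ∉ A / D) : rr A D x = 0 := by
  rw [rr, card_eq_zero, filter_eq_empty_iff]
  intro d hd h
  apply hx
  rw [mem_div]
  exact ⟨x * d, h, d, hd, by simp⟩

lemma sum_rr (A D : Finset G) : ∑ x ∈ A / D, rr A D x = #A * #D := by
  unfold rr
  rw [← card_sigma, ← card_product]
  refine card_bij' (fun q _ => (q.1 * q.2, q.2)) (fun p _ => ⟨p.1 / p.2, p.2⟩) ?_ ?_ ?_ ?_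
  · rintro ⟨x, d⟩ h
    simp only [mem_sigma, mem_filter] at h
    simp [h]
  · rintro ⟨a, d⟩ h
    simp only [mem_product] at h
    simp only [mem_sigma, mem_filter]
    exact ⟨div_mem_div h.1 h.2, h.2, by simpa using h.1⟩
  · rintro ⟨x, d⟩ h
    simp
  · rintro ⟨x, d⟩ h
    simp

lemma energy_le (A B : Finset G) (V : Finset G) (hV : A / A ⊆ V) :
    mulEnergy A B ≤ ∑ x ∈ V, rr A A x * rr B B x := by
  unfold rr mulEnergy
  simp_rw [← card_product]
  rw [← card_sigma]
  apply card_le_card_of_injOn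
    (fun q => (⟨q.1.1 / q.1.2, (q.1.2, q.2.1)⟩ : (_ : G) × (G × G)))
  · rintro ⟨⟨a1, a2⟩, ⟨b1, b2⟩⟩ h
    simp only [coe_filter, Set.mem_ofPred_eq, mem_product] at h
    simp only [mem_coe, mem_sigma, mem_product, mem_filter]
    obtain ⟨⟨⟨h1, h2⟩, h3, h4⟩, h5⟩ := h
    refine ⟨hV (div_mem_div h1 h2), ⟨h2, by simpa using h1⟩, h3, ?_⟩
    have : a1 / a2 * b1 = b2 := by rw [div_mul_eq_mul_div, h5]; simp
    rwa [this]
  · rintro ⟨⟨a1, a2⟩, ⟨b1, b2⟩⟩ h ⟨⟨a1', a2'⟩, ⟨b1', b2'⟩⟩ h' he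
    simp only [coe_filter, Set.mem_ofPred_eq, mem_product] at h h'
    simp only [Sigma.mk.injEq, Prod.mk.injEq, heq_eq_eq] at he
    obtain ⟨e1, rfl, rfl⟩ := he
    have e2 : a1 = a1' := by simpa using e1
    subst e2
    have : b2 = b2' := by
      apply mul_left_cancel (a := a2)
      rw [← h.2, ← h'.2]
    subst this
    rfl

lemma cross_le (A D : Finset G) :
    ∑ s ∈ A / A, rr A A s * rr D D s ≤ ∑ x ∈ A / D, rr A D x ^ 2 := by
  unfold rr
  simp_rw [sq, ← card_product]
  rw [← card_sigma, ← card_sigma]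
  apply card_le_card_of_injOn
    (fun q => (⟨q.2.1 / q.2.2, (q.2.2, q.1 * q.2.2)⟩ : (_ : G) × (G × G)))
  · rintro ⟨s, a, d⟩ h
    simp only [mem_coe, mem_sigma, mem_product, mem_filter] at h ⊢
    obtain ⟨h1, ⟨h2, h3⟩, h4, h5⟩ := h
    refine ⟨div_mem_div h2 h4, ⟨h4, by simpa using h2⟩, h5, ?_⟩
    have : a / d * (s * d) = s * a := by
      rw [mul_left_comm]; simp
    rwa [this]
  · rintro ⟨s, a, d⟩ h ⟨s', a', d'⟩ h' he
    simp only [Sigma.mk.injEq, Prod.mk.injEq, heq_eq_eq] at he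
    obtain ⟨e1, rfl, e2⟩ := he
    have e3 : s = s' := by simpa using e2
    have e4 : a = a' := by simpa using e1
    subst e3 e4
    rfl

/-- the part of `A` that stays in `A` after multiplying by `s` -/
def shf (A : Finset G) (s : G) : Finset G := {a ∈ A | s * a ∈ A}

lemma shift_energy (A B : Finset G) (s : G) :
    rr A A s ^ 2 * #B ^ 2 ≤ rr (A * B) (A * B) s * mulEnergy (shf A s) B := by
  have h := le_card_mul_mul_mulEnergy (shf A s) B
  refine le_trans (le_of_eq rfl) (h.trans ?_)
  gcongr
  apply card_le_card
  intro p hp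
  rw [mem_mul] at hp
  obtain ⟨a, ha, b, hb, rfl⟩ := hp
  simp only [shf, mem_filter] at ha
  rw [mem_filter]
  refine ⟨mul_mem_mul ha.1 hb, ?_⟩
  rw [← mul_assoc]
  exact mul_mem_mul ha.2 hb

lemma sum_shift_energy (A B : Finset G) :
    ∑ s ∈ A / A, mulEnergy (shf A s) B ≤ ∑ x ∈ A / A, rr B B x * rr A A x ^ 2 := by
  unfold rr mulEnergy
  simp_rw [sq, ← card_product]
  rw [← card_sigma, ← card_sigma]
  apply card_le_card_of_injOn
    (fun q => (⟨q.2.1.1 / q.2.1.2, (q.2.2.1, (q.2.1.2, q.1 * q.2.1.2))⟩ : (_ : G) × (G × (G × G))))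
  · rintro ⟨s, ⟨a1, a2⟩, ⟨b1, b2⟩⟩ h
    simp only [mem_coe, mem_sigma, mem_product, mem_filter, shf] at h ⊢
    obtain ⟨h0, ⟨⟨⟨h1, h1'⟩, h2, h2'⟩, h3, h4⟩, h5⟩ := h
    have t1 : a1 / a2 * b1 = b2 := by rw [div_mul_eq_mul_div, h5]; simp
    have t2 : a1 / a2 * (s * a2) = s * a1 := by rw [mul_left_comm]; simp
    refine ⟨div_mem_div h1 h2, ⟨h3, by rwa [t1]⟩, ⟨h2, by simpa using h1⟩, h2', by rwa [t2]⟩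
  · rintro ⟨s, ⟨a1, a2⟩, ⟨b1, b2⟩⟩ h ⟨s', ⟨a1', a2'⟩, ⟨b1', b2'⟩⟩ h' he
    simp only [mem_coe, mem_sigma, mem_product, mem_filter] at h h'
    simp only [Sigma.mk.injEq, Prod.mk.injEq, heq_eq_eq] at he
    obtain ⟨e1, rfl, rfl, e3⟩ := he
    have e2 : a1 = a1' := by simpa using e1
    have e4 : s = s' := by simpa using e3
    subst e2 e4
    have : b2 = b2' := by
      apply mul_left_cancel (a := a2)
      rw [← h.2.2, ← h'.2.2]
    subst this
    rfl

lemma holder_aux {ι : Type*} (S : Finset ι) (w : ι → ℝ) (hw : ∀ i, 0 ≤ w i) :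
    (∑ i ∈ S, w i ^ 4) ^ 3 ≤ (∑ i ∈ S, w i ^ 3) ^ 2 * ∑ i ∈ S, w i ^ 6 := by
  have h1 : (∑ i ∈ S, w i ^ 4) ^ 2 ≤ (∑ i ∈ S, w i ^ 3) * ∑ i ∈ S, w i ^ 5 :=
    sum_sq_le_sum_mul_sum_of_sq_le_mul S (fun i _ => by have := hw i; positivity)
      (fun i _ => by have := hw i; positivity) (fun i _ => le_of_eq (by ring))
  have h2 : (∑ i ∈ S, w i ^ 5) ^ 2 ≤ (∑ i ∈ S, w i ^ 4) * ∑ i ∈ S, w i ^ 6 :=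
    sum_sq_le_sum_mul_sum_of_sq_le_mul S (fun i _ => by have := hw i; positivity)
      (fun i _ => by have := hw i; positivity) (fun i _ => le_of_eq (by ring))
  have p3 : 0 ≤ ∑ i ∈ S, w i ^ 3 := sum_nonneg (fun i _ => by have := hw i; positivity)
  have p4 : 0 ≤ ∑ i ∈ S, w i ^ 4 := sum_nonneg (fun i _ => by have := hw i; positivity)
  have p5 : 0 ≤ ∑ i ∈ S, w i ^ 5 := sum_nonneg (fun i _ => by have := hw i; positivity)
  have p6 : 0 ≤ ∑ i ∈ S, w i ^ 6 := sum_nonneg (fun i _ => by have := hw i; positivity)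
  generalize (∑ i ∈ S, w i ^ 3) = x3 at *
  generalize (∑ i ∈ S, w i ^ 4) = x4 at *
  generalize (∑ i ∈ S, w i ^ 5) = x5 at *
  generalize (∑ i ∈ S, w i ^ 6) = x6 at *
  rcases p4.eq_or_lt with h | h
  · rw [← h]; simp; positivity
  · apply le_of_mul_le_mul_left _ h
    calc x4 * x4 ^ 3 = (x4 ^ 2) ^ 2 := by ring
      _ ≤ (x3 * x5) ^ 2 := by gcongr
      _ = x3 ^ 2 * x5 ^ 2 := by ring
      _ ≤ x3 ^ 2 * (x4 * x6) := by gcongr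
      _ = _ := by ring

lemma sum_rr_pow_le (B V : Finset G) (k : ℕ) (hk : k ≠ 0) :
    ∑ x ∈ V, (rr B B x : ℝ) ^ k ≤ ∑ x ∈ B / B, (rr B B x : ℝ) ^ k := by
  have : ∑ x ∈ V, rr B B x ^ k ≤ ∑ x ∈ B / B, rr B B x ^ k := by
    apply sum_le_sum_of_ne_zero
    intro x _ hx
    by_contra hcon
    apply hx
    simp [rr_eq_zero _ _ _ hcon, hk]
  exact_mod_cast this

lemma amgm_aux (b a : ℝ) (hb : 0 ≤ b) (ha : 0 ≤ a) : b * a ^ 2 ≤ b ^ 3 + a ^ 3 := by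
  rcases le_total a b with h | h
  · have : b * a ^ 2 ≤ b * b ^ 2 := by gcongr
    have : 0 ≤ a ^ 3 := by positivity
    nlinarith
  · have : b * a ^ 2 ≤ a * a ^ 2 := by gcongr
    have : 0 ≤ b ^ 3 := by positivity
    nlinarith

set_option maxHeartbeats 1000000 in
lemma group_main (A B : Finset G) (hAB : #B = #A) (hpos : 0 < #A) (M : ℝ) (hM : 0 ≤ M)
    (hA : ∀ D : Finset G, (#A : ℝ) * ∑ x ∈ A / D, (rr A D x : ℝ) ^ 3 ≤
      M * (#(A * B) : ℝ) ^ 2 * (#D : ℝ) ^ 2)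
    (hB : ∀ D : Finset G, (#A : ℝ) * ∑ x ∈ B / D, (rr B D x : ℝ) ^ 3 ≤
      M * (#(A * B) : ℝ) ^ 2 * (#D : ℝ) ^ 2)
    (hE : ∑ x ∈ B / B, (rr B B x : ℝ) ^ 2 ≤ ∑ x ∈ A / A, (rr A A x : ℝ) ^ 2) :
    (#A : ℝ) ^ 24 ≤ 4 * M ^ 5 * (#(A * B) : ℝ) ^ 19 := by
  set n : ℝ := (#A : ℝ) with hn
  set K : ℝ := (#(A * B) : ℝ) with hK
  have hnB : (#B : ℝ) = n := by rw [hAB]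
  have hn0 : 0 < n := by rw [hn]; exact_mod_cast hpos
  have hK0 : 0 < K := by
    rw [hK]
    have : (A * B).Nonempty := (card_pos.mp hpos).mul (card_pos.mp (hAB ▸ hpos))
    exact_mod_cast card_pos.mpr this
  set E2 := ∑ x ∈ A / A, (rr A A x : ℝ) ^ 2 with hE2
  set E3 := ∑ x ∈ A / A, (rr A A x : ℝ) ^ 3 with hE3
  set E3B := ∑ x ∈ B / B, (rr B B x : ℝ) ^ 3 with hE3B
  set F := ∑ s ∈ A / A, (rr A A s : ℝ) * rr (A * B) (A * B) s with hF
  set Q := ∑ s ∈ A / A, (mulEnergy (shf A s) B : ℝ) with hQ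
  have hE20 : 0 ≤ E2 := sum_nonneg (fun i _ => by positivity)
  have hF0 : 0 ≤ F := sum_nonneg (fun i _ => by positivity)
  have hQ0 : 0 ≤ Q := sum_nonneg (fun i _ => by positivity)
  have hE30 : 0 ≤ E3 := sum_nonneg (fun i _ => by positivity)
  have b3 : E3 ≤ M * K ^ 2 * n := by
    have := hA A
    apply le_of_mul_le_mul_left _ hn0
    calc _ ≤ _ := this
      _ = _ := by ring
  have b3B : E3B ≤ M * K ^ 2 * n := by
    have := hB B
    rw [hnB] at this
    apply le_of_mul_le_mul_left _ hn0
    calc _ ≤ _ := this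
      _ = _ := by ring
  -- lower bound for `E2`
  have s1 : n ^ 4 ≤ K * E2 := by
    have e1 : n ^ 2 * n ^ 2 ≤ K * (mulEnergy A B : ℝ) := by
      have := le_card_mul_mul_mulEnergy A B
      rw [hAB] at this
      rw [hn, hK]
      exact_mod_cast this
    have e2 : (mulEnergy A B : ℝ) ≤ ∑ x ∈ A / A, (rr A A x : ℝ) * rr B B x := by
      exact_mod_cast energy_le A B _ subset_rfl
    have e3 : (∑ x ∈ A / A, (rr A A x : ℝ) * rr B B x) ^ 2 ≤ E2 * ∑ x ∈ A / A, (rr B B x : ℝ) ^ 2 :=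
      sum_mul_sq_le_sq_mul_sq _ _ _
    have e4 : ∑ x ∈ A / A, (rr B B x : ℝ) ^ 2 ≤ ∑ x ∈ B / B, (rr B B x : ℝ) ^ 2 :=
      sum_rr_pow_le B (A / A) 2 (by norm_num)
    have e5 : (∑ x ∈ A / A, (rr A A x : ℝ) * rr B B x) ^ 2 ≤ E2 ^ 2 := by
      calc _ ≤ _ := e3
        _ ≤ E2 * E2 := by gcongr; exact e4.trans hE
        _ = _ := by ring
    have e6 := abs_le_of_sq_le_sq' e5 hE20
    calc n ^ 4 = n ^ 2 * n ^ 2 := by ring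
      _ ≤ _ := e1
      _ ≤ K * E2 := by gcongr; exact e2.trans e6.2
  -- upper bound for `F`
  have s2 : F ^ 2 ≤ M * K ^ 5 := by
    have e1 : F ≤ ∑ x ∈ A / (A * B), (rr A (A * B) x : ℝ) ^ 2 := by
      rw [hF]
      exact_mod_cast cross_le A (A * B)
    have e2 : (∑ x ∈ A / (A * B), (rr A (A * B) x : ℝ) ^ 2) ^ 2 ≤
        (∑ x ∈ A / (A * B), (rr A (A * B) x : ℝ)) * ∑ x ∈ A / (A * B), (rr A (A * B) x : ℝ) ^ 3 :=
      sum_sq_le_sum_mul_sum_of_sq_le_mul _ (fun i _ => by positivity)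
        (fun i _ => by positivity) (fun i _ => le_of_eq (by ring))
    have e3 : (∑ x ∈ A / (A * B), (rr A (A * B) x : ℝ)) = n * K := by
      rw [hn, hK]
      exact_mod_cast sum_rr A (A * B)
    have e4 := hA (A * B)
    rw [e3] at e2
    calc F ^ 2 ≤ (∑ x ∈ A / (A * B), (rr A (A * B) x : ℝ) ^ 2) ^ 2 := by gcongr
      _ ≤ _ := e2
      _ = K * (n * ∑ x ∈ A / (A * B), (rr A (A * B) x : ℝ) ^ 3) := by ring
      _ ≤ K * (M * K ^ 2 * K ^ 2) := by gcongr
      _ = _ := by ring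
  -- upper bound for `Q`
  have s3 : Q ≤ 2 * M * K ^ 2 * n := by
    have e1 : Q ≤ ∑ x ∈ A / A, (rr B B x : ℝ) * (rr A A x : ℝ) ^ 2 := by
      rw [hQ]
      exact_mod_cast sum_shift_energy A B
    have e2 : ∑ x ∈ A / A, (rr B B x : ℝ) * (rr A A x : ℝ) ^ 2 ≤
        ∑ x ∈ A / A, ((rr B B x : ℝ) ^ 3 + (rr A A x : ℝ) ^ 3) := by
      apply sum_le_sum
      intro x _
      exact amgm_aux _ _ (by positivity) (by positivity)
    have e4 : ∑ x ∈ A / A, (rr B B x : ℝ) ^ 3 ≤ E3B :=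
      sum_rr_pow_le B (A / A) 3 (by norm_num)
    rw [sum_add_distrib] at e2
    linarith
  -- the main inequality
  have s4 : (n * ∑ s ∈ A / A, √(rr A A s : ℝ) ^ 3) ^ 2 ≤ Q * F := by
    have e1 : n * ∑ s ∈ A / A, √(rr A A s : ℝ) ^ 3 ≤
        ∑ s ∈ A / A, √((mulEnergy (shf A s) B : ℝ) * ((rr A A s : ℝ) * rr (A * B) (A * B) s)) := by
      rw [mul_sum]
      apply sum_le_sum
      intro s _
      apply Real.le_sqrt_of_sq_le
      have h1 : (rr A A s : ℝ) ^ 2 * n ^ 2 ≤ rr (A * B) (A * B) s * (mulEnergy (shf A s) B : ℝ) := by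
        rw [← hnB]
        exact_mod_cast shift_energy A B s
      have h2 : √(rr A A s : ℝ) ^ 2 = rr A A s := Real.sq_sqrt (by positivity)
      calc (n * √(rr A A s : ℝ) ^ 3) ^ 2 = n ^ 2 * (√(rr A A s : ℝ) ^ 2) ^ 3 := by ring
        _ = (rr A A s : ℝ) * ((rr A A s : ℝ) ^ 2 * n ^ 2) := by rw [h2]; ring
        _ ≤ (rr A A s : ℝ) * (rr (A * B) (A * B) s * (mulEnergy (shf A s) B : ℝ)) := by gcongr
        _ = _ := by ring
    calc _ ≤ (∑ s ∈ A / A, √((mulEnergy (shf A s) B : ℝ) *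
          ((rr A A s : ℝ) * rr (A * B) (A * B) s))) ^ 2 := by
          have : 0 ≤ n * ∑ s ∈ A / A, √(rr A A s : ℝ) ^ 3 :=
            mul_nonneg hn0.le (sum_nonneg (fun i _ => by positivity))
          gcongr
      _ ≤ Q * F := sum_sq_le_sum_mul_sum_of_sq_le_mul _ (fun i _ => by positivity)
        (fun i _ => by positivity) (fun i _ => (Real.sq_sqrt (by positivity)).le)
  have s5 : E2 ^ 3 ≤ (∑ s ∈ A / A, √(rr A A s : ℝ) ^ 3) ^ 2 * E3 := by
    have := holder_aux (A / A) (fun s => √(rr A A s : ℝ)) (fun s => Real.sqrt_nonneg _)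
    have h4 : ∀ s, √(rr A A s : ℝ) ^ 4 = (rr A A s : ℝ) ^ 2 := fun s => by
      rw [show 4 = 2 * 2 by norm_num, pow_mul, Real.sq_sqrt (by positivity)]
    have h6 : ∀ s, √(rr A A s : ℝ) ^ 6 = (rr A A s : ℝ) ^ 3 := fun s => by
      rw [show 6 = 2 * 3 by norm_num, pow_mul, Real.sq_sqrt (by positivity)]
    simpa only [h4, h6] using this
  have s6 : E2 ^ 3 ≤ 2 * M ^ 2 * K ^ 4 * F := by
    apply le_of_mul_le_mul_left _ (pow_pos hn0 2)
    calc n ^ 2 * E2 ^ 3 ≤ n ^ 2 * ((∑ s ∈ A / A, √(rr A A s : ℝ) ^ 3) ^ 2 * E3) := by gcongr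
      _ = (n * ∑ s ∈ A / A, √(rr A A s : ℝ) ^ 3) ^ 2 * E3 := by ring
      _ ≤ (Q * F) * E3 := by gcongr
      _ ≤ ((2 * M * K ^ 2 * n) * F) * (M * K ^ 2 * n) := by gcongr
      _ = _ := by ring
  have s7 : n ^ 12 ≤ 2 * M ^ 2 * K ^ 7 * F := by
    calc n ^ 12 = (n ^ 4) ^ 3 := by ring
      _ ≤ (K * E2) ^ 3 := by gcongr
      _ = K ^ 3 * E2 ^ 3 := by ring
      _ ≤ K ^ 3 * (2 * M ^ 2 * K ^ 4 * F) := by gcongr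
      _ = _ := by ring
  calc n ^ 24 = (n ^ 12) ^ 2 := by ring
    _ ≤ (2 * M ^ 2 * K ^ 7 * F) ^ 2 := by gcongr
    _ = 4 * M ^ 4 * K ^ 14 * F ^ 2 := by ring
    _ ≤ 4 * M ^ 4 * K ^ 14 * (M * K ^ 5) := by gcongr
    _ = _ := by ring

end grp

section real
open scoped Pointwise

lemma level_bound (A B D : Finset ℝˣ) (ε : ℝ) (hε : ε ≠ 0) (hAB : #B = #A)
    (h : ∀ a ∈ A, ∃ b ∈ B, (b : ℝ) = a + ε) (t : ℕ) (ht : 1 ≤ t) :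
    #A * #{x ∈ A / D | t ≤ rr A D x} * t ^ 3 ≤ 512 * #(A * B) ^ 2 * #D ^ 2 := by
  classical
  set X := {x ∈ A / D | t ≤ rr A D x} with hX
  set K := #(A * B) with hK
  rcases X.eq_empty_or_nonempty with h0 | ⟨x0, hx0⟩
  · rw [h0]; simp
  have hx0' := hx0
  rw [hX, mem_filter] at hx0'
  have hXpos : 0 < #X := card_pos.mpr ⟨x0, hx0⟩
  have htD : t ≤ #D := hx0'.2.trans (card_filter_le _ _)
  have htA : t ≤ #A := by
    refine hx0'.2.trans ?_
    apply card_le_card_of_injOn (fun d => x0 * d)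
    · intro d hd
      simp only [coe_filter, Set.mem_ofPred_eq] at hd
      exact hd.2
    · intro d _ d' _ hh
      simpa using hh
  have hAne : A.Nonempty := card_pos.mp (by omega)
  have hBne : B.Nonempty := card_pos.mp (by omega)
  have hAK : #A ≤ K := card_le_card_mul_right hBne
  have hXt : #X * t ≤ #A * #D := by
    rw [← sum_rr A D]
    calc #X * t = ∑ x ∈ X, t := by simp
      _ ≤ ∑ x ∈ X, rr A D x := sum_le_sum (fun x hx => (mem_filter.mp hx).2)
      _ ≤ _ := sum_le_sum_of_subset (filter_subset _ _)
  have hDpos : 0 < #D := by omega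
  by_cases hsmall : #X * t < 4 * #D
  · calc #A * #X * t ^ 3 = #A * (#X * t) * (t * t) := by ring
      _ ≤ K * (4 * #D) * (#D * K) := by
          gcongr
          exact htA.trans hAK
      _ ≤ 512 * K ^ 2 * #D ^ 2 := by nlinarith [Nat.zero_le (K ^ 2 * #D ^ 2)]
  push Not at hsmall
  set r := (#X * t) / (4 * #D) with hr
  have hr1 : 1 ≤ r := by
    rw [hr, Nat.le_div_iff_mul_le (by omega)]; omega
  have hr2 : r * (4 * #D) ≤ #X * t := Nat.div_mul_le_self _ _
  have hr3 : #X * t ≤ 8 * #D * r := by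
    have := Nat.lt_div_mul_add (a := #X * t) (b := 4 * #D) (by omega)
    rw [← hr] at this
    nlinarith
  have hrX : r ≤ #X := by
    by_contra hc
    push Not at hc
    have : #X * t < r * (4 * #D) := by
      calc #X * t ≤ #X * (4 * #D) := by gcongr; omega
        _ < r * (4 * #D) := by gcongr
    omega
  have hrK : r ≤ K := by
    have : r * #D ≤ #A * #D := by nlinarith
    exact (Nat.le_of_mul_le_mul_right this hDpos).trans hAK
  let X' : Finset ℝ := X.image (fun u : ℝˣ => (u : ℝ))
  let Y : Finset ℝ := (A * B).image (fun u : ℝˣ => (u : ℝ))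
  have hX' : #X' = #X := card_image_of_injective _ Units.val_injective
  have hY : #Y = K := card_image_of_injective _ Units.val_injective
  let f : ℝˣ × ℝˣ → ℝ × ℝ := fun p => ((p.1 : ℝ) * p.2, p.1 * ε)
  have hf : Function.Injective f := by
    rintro ⟨c, d⟩ ⟨c', d'⟩ hh
    simp only [f, Prod.mk.injEq] at hh
    have h1 : c = c' := Units.ext (mul_right_cancel₀ hε hh.2)
    subst h1
    have h2 : d = d' := Units.ext (mul_left_cancel₀ c.ne_zero hh.1)
    rw [h2]
  let L : Finset (ℝ × ℝ) := (A ×ˢ D).image f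
  have hLc : #L = #A * #D := by
    rw [card_image_of_injective _ hf, card_product]
  have hst := st_grid X' Y L (by
    intro l hl
    simp only [L, mem_image] at hl
    obtain ⟨p, _, rfl⟩ := hl
    exact mul_ne_zero p.1.ne_zero p.2.ne_zero) r hr1 (by omega) (by omega)
  have hinc : #A * (#X * t) ≤ ∑ l ∈ L, #{x ∈ X' | l.1 * x + l.2 ∈ Y} := by
    rw [sum_image (fun a _ b _ hh => hf hh), sum_product]
    calc #A * (#X * t) = ∑ c ∈ A, #X * t := by simp
      _ ≤ _ := by
        apply sum_le_sum
        intro c hc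
        calc #X * t = ∑ x ∈ X, t := by simp
          _ ≤ ∑ x ∈ X, rr A D x := sum_le_sum (fun x hx => (mem_filter.mp hx).2)
          _ = ∑ x ∈ X, ∑ d ∈ D, if x * d ∈ A then 1 else 0 := by
            apply sum_congr rfl
            intro x _
            rw [rr, card_filter]
          _ = ∑ d ∈ D, ∑ x ∈ X, if x * d ∈ A then 1 else 0 := sum_comm
          _ ≤ _ := by
            apply sum_le_sum
            intro d hd
            rw [← card_filter]
            apply card_le_card_of_injOn (fun u : ℝˣ => (u : ℝ))
            · intro x hx
              simp only [coe_filter, Set.mem_ofPred_eq] at hx ⊢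
              refine ⟨mem_image_of_mem _ hx.1, ?_⟩
              obtain ⟨b, hb, hb'⟩ := h _ hx.2
              have : (f (c, d)).1 * (x : ℝ) + (f (c, d)).2 = ((c * b : ℝˣ) : ℝ) := by
                simp only [f, Units.val_mul, hb']
                ring
              rw [this]
              exact mem_image_of_mem _ (mul_mem_mul hc hb)
            · exact Units.val_injective.injOn
  rw [hX', hY, hLc] at hst
  generalize #A = n at *
  generalize #X = N at *
  generalize #D = m at *
  have e1 : r ^ 2 * (n * (N * t)) ≤ 8 * N ^ 2 * K ^ 2 := by
    have a1 : r ^ 2 * (n * (N * t)) ≤ 2 * r ^ 3 * (n * m) + 4 * N ^ 2 * K ^ 2 :=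
      (Nat.mul_le_mul_left _ hinc).trans hst
    have a2 : r ^ 2 * n * (r * (4 * m)) ≤ r ^ 2 * n * (N * t) := Nat.mul_le_mul_left _ hr2
    nlinarith
  have hN2 : 0 < N ^ 2 := by positivity
  apply Nat.le_of_mul_le_mul_left _ hN2
  calc N ^ 2 * (n * N * t ^ 3) = (N * t) ^ 2 * (n * (N * t)) := by ring
    _ ≤ (8 * m * r) ^ 2 * (n * (N * t)) := by gcongr
    _ = 64 * m ^ 2 * (r ^ 2 * (n * (N * t))) := by ring
    _ ≤ 64 * m ^ 2 * (8 * N ^ 2 * K ^ 2) := by gcongr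
    _ = _ := by ring

lemma cube_le (m n : ℕ) (h : m ≤ n) :
    (m : ℝ) ^ 3 ≤ ∑ t ∈ Icc 1 n, if t ≤ m then 3 * (t : ℝ) ^ 2 else 0 := by
  rw [← sum_filter]
  have : {t ∈ Icc 1 n | t ≤ m} = Icc 1 m := by
    ext t; simp; omega
  rw [this]
  clear this h
  induction m with
  | zero => simp
  | succ k ih =>
    rw [sum_Icc_succ_top (by omega)]
    push_cast
    have : (0 : ℝ) ≤ k := by positivity
    nlinarith

lemma third_moment (A B D : Finset ℝˣ) (ε : ℝ) (hε : ε ≠ 0) (hAB : #B = #A)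
    (h : ∀ a ∈ A, ∃ b ∈ B, (b : ℝ) = a + ε) :
    (#A : ℝ) * ∑ x ∈ A / D, (rr A D x : ℝ) ^ 3 ≤
      (1536 * (1 + Real.log #A)) * (#(A * B) : ℝ) ^ 2 * (#D : ℝ) ^ 2 := by
  have hle : ∀ x, rr A D x ≤ #A := by
    intro x
    apply card_le_card_of_injOn (fun d => x * d)
    · intro d hd
      simp only [coe_filter, Set.mem_ofPred_eq] at hd
      exact hd.2
    · intro d _ d' _ hh
      simpa using hh
  have h1 : ∑ x ∈ A / D, (rr A D x : ℝ) ^ 3 ≤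
      ∑ t ∈ Icc 1 #A, 3 * (t : ℝ) ^ 2 * #{x ∈ A / D | t ≤ rr A D x} := by
    calc _ ≤ ∑ x ∈ A / D, ∑ t ∈ Icc 1 #A, (if t ≤ rr A D x then 3 * (t : ℝ) ^ 2 else 0) :=
          sum_le_sum (fun x _ => cube_le _ _ (hle x))
      _ = ∑ t ∈ Icc 1 #A, ∑ x ∈ A / D, (if t ≤ rr A D x then 3 * (t : ℝ) ^ 2 else 0) := sum_comm
      _ = _ := by
        apply sum_congr rfl
        intro t _
        rw [← sum_filter, sum_const, nsmul_eq_mul, mul_comm]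
  set P : ℝ := (#(A * B) : ℝ) ^ 2 * (#D : ℝ) ^ 2 with hP
  have hP0 : 0 ≤ P := by positivity
  have h2 : (#A : ℝ) * ∑ t ∈ Icc 1 #A, 3 * (t : ℝ) ^ 2 * #{x ∈ A / D | t ≤ rr A D x} ≤
      ∑ t ∈ Icc 1 #A, 1536 * P * (t : ℝ)⁻¹ := by
    rw [mul_sum]
    apply sum_le_sum
    intro t ht
    have ht1 : 1 ≤ t := (mem_Icc.mp ht).1
    have ht0 : (0 : ℝ) < t := by exact_mod_cast ht1
    have := level_bound A B D ε hε hAB h t ht1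
    have h3 : (#A : ℝ) * #{x ∈ A / D | t ≤ rr A D x} * (t : ℝ) ^ 3 ≤ 512 * P := by
      rw [hP, ← mul_assoc]
      exact_mod_cast this
    rw [← div_eq_mul_inv, le_div_iff₀ ht0]
    nlinarith
  have h3 : ∑ t ∈ Icc 1 #A, (t : ℝ)⁻¹ ≤ 1 + Real.log #A := by
    have := harmonic_le_one_add_log #A
    rw [harmonic_eq_sum_Icc] at this
    push_cast at this
    exact this
  calc _ ≤ (#A : ℝ) * ∑ t ∈ Icc 1 #A, 3 * (t : ℝ) ^ 2 * #{x ∈ A / D | t ≤ rr A D x} := by gcongr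
    _ ≤ _ := h2
    _ = 1536 * P * ∑ t ∈ Icc 1 #A, (t : ℝ)⁻¹ := by rw [mul_sum]
    _ ≤ 1536 * P * (1 + Real.log #A) := by gcongr
    _ = _ := by rw [hP]; ring

lemma units_main (A B : Finset ℝˣ) (hpos : 0 < #A) (hAB : #B = #A)
    (h : ∀ a ∈ A, ∃ b ∈ B, (b : ℝ) = a + 1) (h' : ∀ b ∈ B, ∃ a ∈ A, (a : ℝ) = b + (-1)) :
    (#A : ℝ) ^ 24 ≤ 4 * (1536 * (1 + Real.log #A)) ^ 5 * (#(A * B) : ℝ) ^ 19 := by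
  have hlog : 0 ≤ Real.log (#A : ℝ) := Real.log_natCast_nonneg _
  have hA := fun D => third_moment A B D 1 one_ne_zero hAB h
  have hB := fun D => third_moment B A D (-1) (by norm_num) hAB.symm h'
  rw [hAB, mul_comm B A] at hB
  rcases le_total (∑ x ∈ B / B, (rr B B x : ℝ) ^ 2) (∑ x ∈ A / A, (rr A A x : ℝ) ^ 2) with hE | hE
  · exact group_main A B hAB hpos _ (by positivity) hA hB hE
  · have := group_main B A hAB.symm (by omega) (1536 * (1 + Real.log #A)) (by positivity)
      (by rw [mul_comm B A, hAB]; exact hB) (by rw [mul_comm B A, hAB]; exact hA) hE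
    rw [mul_comm B A, hAB] at this
    exact this

lemma real_main (A : Finset ℝ) (h2 : 2 ≤ #A) :
    (#A : ℝ) ^ 24 ≤ (2 ^ 31 * 1536 ^ 5) * (Real.log #A) ^ 5 *
      (#(Finset.image₂ (fun a b => a * (b + 1)) A A) : ℝ) ^ 19 := by
  classical
  set S := Finset.image₂ (fun a b : ℝ => a * (b + 1)) A A with hS
  have hSne : S.Nonempty := by
    have : A.Nonempty := card_pos.mp (by omega)
    exact this.image₂ this
  have hS1 : (1 : ℝ) ≤ #S := by exact_mod_cast card_pos.mpr hSne
  by_cases hbig : 4 ≤ #A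
  · let A' : Finset ℝ := (A.erase 0).erase (-1)
    have hc1 : #A ≤ #A' + 2 := by
      have i1 := pred_card_le_card_erase (s := A) (a := (0 : ℝ))
      have i2 := pred_card_le_card_erase (s := A.erase 0) (a := (-1 : ℝ))
      show #A ≤ #((A.erase 0).erase (-1)) + 2; omega
    have hc2 : #A' ≤ #A := (card_erase_le).trans card_erase_le
    let g : ℝ → ℝˣ := fun x => if hx : x = 0 then 1 else Units.mk0 x hx
    have hg : ∀ x, x ≠ 0 → (g x : ℝ) = x := fun x hx => by simp [g, hx]
    have hA'0 : ∀ x ∈ A', x ≠ 0 := fun x hx => by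
      simp only [A', mem_erase] at hx; exact hx.2.1
    have hA'1 : ∀ x ∈ A', x + 1 ≠ 0 := fun x hx hh => by
      simp only [A', mem_erase] at hx
      exact hx.1 (by linarith)
    have hA'A : ∀ x ∈ A', x ∈ A := fun x hx => by
      simp only [A', mem_erase] at hx; exact hx.2.2
    let U := A'.image g
    let V := A'.image (fun x => g (x + 1))
    have hU : #U = #A' := card_image_of_injOn (fun x hx y hy hh => by
      have := congrArg (fun u : ℝˣ => (u : ℝ)) hh
      simpa [hg _ (hA'0 x hx), hg _ (hA'0 y hy)] using this)
    have hV : #V = #A' := card_image_of_injOn (fun x hx y hy hh => by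
      have := congrArg (fun u : ℝˣ => (u : ℝ)) hh
      simpa [hg _ (hA'1 x hx), hg _ (hA'1 y hy)] using this)
    have hm := units_main U V (by omega) (by omega)
      (by
        intro a ha
        obtain ⟨x, hx, rfl⟩ := mem_image.mp ha
        exact ⟨g (x + 1), mem_image_of_mem _ hx, by rw [hg _ (hA'1 x hx), hg _ (hA'0 x hx)]⟩)
      (by
        intro a ha
        obtain ⟨x, hx, rfl⟩ := mem_image.mp ha
        exact ⟨g x, mem_image_of_mem _ hx, by rw [hg _ (hA'1 x hx), hg _ (hA'0 x hx)]; ring⟩)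
    have hUV : #(U * V) ≤ #S := by
      apply card_le_card_of_injOn (fun u : ℝˣ => (u : ℝ))
      · intro u hu
        obtain ⟨a, ha, b, hb, rfl⟩ := mem_mul.mp (mem_coe.mp hu)
        obtain ⟨x, hx, rfl⟩ := mem_image.mp ha
        obtain ⟨y, hy, rfl⟩ := mem_image.mp hb
        simp only [Units.val_mul]
        rw [hg _ (hA'0 x hx), hg _ (hA'1 y hy)]
        exact mem_coe.mpr (mem_image₂_of_mem (hA'A x hx) (hA'A y hy))
      · exact Units.val_injective.injOn
    rw [hU] at hm
    have hn4 : (4 : ℝ) ≤ #A := by exact_mod_cast hbig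
    have hl1 : 1 ≤ Real.log (#A : ℝ) := by
      rw [Real.le_log_iff_exp_le (by linarith)]
      linarith [Real.exp_one_lt_d9]
    have hl2 : Real.log (#A' : ℝ) ≤ Real.log (#A : ℝ) := by
      apply Real.log_le_log
      · have : 0 < #A' := by omega
        exact_mod_cast this
      · exact_mod_cast hc2
    have hl0 : 0 ≤ Real.log (#A' : ℝ) := Real.log_natCast_nonneg _
    have hc3 : (#A : ℝ) ≤ 2 * #A' := by
      have : #A ≤ 2 * #A' := by omega
      exact_mod_cast this
    have hUV' : (#(U * V) : ℝ) ≤ #S := by exact_mod_cast hUV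
    calc (#A : ℝ) ^ 24 ≤ (2 * #A') ^ 24 := by gcongr
      _ = 2 ^ 24 * (#A' : ℝ) ^ 24 := by ring
      _ ≤ 2 ^ 24 * (4 * (1536 * (1 + Real.log #A')) ^ 5 * (#(U * V) : ℝ) ^ 19) := by gcongr
      _ ≤ 2 ^ 24 * (4 * (1536 * (2 * Real.log #A)) ^ 5 * (#S : ℝ) ^ 19) := by
          gcongr
          linarith
      _ = _ := by ring
  · have hn : (#A : ℝ) ≤ 3 := by
      have : #A ≤ 3 := by omega
      exact_mod_cast this
    have hn2 : (2 : ℝ) ≤ #A := by exact_mod_cast h2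
    have hl : (1 / 2 : ℝ) ≤ Real.log (#A : ℝ) := by
      have := Real.log_le_log (by norm_num) hn2
      linarith [Real.log_two_gt_d9]
    calc (#A : ℝ) ^ 24 ≤ 3 ^ 24 := by gcongr
      _ ≤ (2 ^ 31 * 1536 ^ 5) * (1 / 2) ^ 5 * 1 ^ 19 := by norm_num
      _ ≤ _ := by gcongr

end real

theorem stmt9 :
    ∃ c C : ℝ, 0 < c ∧ 0 < C ∧ ∀ (A : Finset ℝ), A.Nonempty →
      c * (A.card : ℝ) ^ ((24 : ℝ) / 19) / (Real.log A.card) ^ C ≤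
        ((Finset.image₂ (fun a b => a * (b + 1)) A A).card : ℝ) := by
  have hM : (0 : ℝ) < 2 ^ 31 * 1536 ^ 5 := by norm_num
  refine ⟨((2 ^ 31 * 1536 ^ 5 : ℝ) ^ ((1 : ℝ) / 19))⁻¹, 5 / 19, by positivity, by norm_num, ?_⟩
  intro A hA
  rcases Nat.lt_or_ge #A 2 with h | h
  · have : #A = 1 := by have := card_pos.mpr hA; omega
    rw [this]
    simp [Real.zero_rpow (show (5 / 19 : ℝ) ≠ 0 by norm_num)]
  · have hm := real_main A h
    have hn2 : (2 : ℝ) ≤ #A := by exact_mod_cast h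
    have hl : 0 < Real.log (#A : ℝ) := Real.log_pos (by linarith)
    set K : ℝ := ((Finset.image₂ (fun a b => a * (b + 1)) A A).card : ℝ) with hK
    have hK0 : 0 ≤ K := by positivity
    generalize (2 ^ 31 * 1536 ^ 5 : ℝ) = M at *
    generalize Real.log (#A : ℝ) = l at *
    have hn0 : (0 : ℝ) ≤ #A := by linarith
    generalize (#A : ℝ) = n at *
    have h1 := Real.rpow_le_rpow (by positivity) hm (show (0 : ℝ) ≤ 1 / 19 by norm_num)
    rw [Real.mul_rpow (by positivity) (by positivity), Real.mul_rpow (by positivity) (by positivity),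
      ← Real.rpow_natCast n, ← Real.rpow_natCast l, ← Real.rpow_natCast K, ← Real.rpow_mul hn0,
      ← Real.rpow_mul hl.le, ← Real.rpow_mul hK0] at h1
    norm_num at h1
    have hMp : 0 < M ^ ((1 : ℝ) / 19) := by positivity
    have hlp : 0 < l ^ ((5 : ℝ) / 19) := by positivity
    rw [div_le_iff₀ hlp, inv_mul_le_iff₀ hMp]
    norm_num
    linarith
end

section
/- Let L be a finite set of lines in ℝ². Then the number of points of ℝ² incident to at least k lines of L is at most C(|L|²/k³ + |L|/k), for an absolute constant C > 0. -/
open Finset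

/-- A line in ℝ² is encoded by coefficients (a, b, c), a·x + b·y = c, with (a,b) ≠ (0,0). -/
def linePts (l : ℝ × ℝ × ℝ) : Set (ℝ × ℝ) :=
  {q : ℝ × ℝ | l.1 * q.1 + l.2.1 * q.2 = l.2.2}


/-- slope of an edge -/
noncomputable def sl (e : (ℝ × ℝ) × (ℝ × ℝ)) : ℝ := (e.2.2 - e.1.2) / (e.2.1 - e.1.1)
/-- height of the line through an edge -/
noncomputable def ht (e : (ℝ × ℝ) × (ℝ × ℝ)) (x : ℝ) : ℝ := e.1.2 + sl e * (x - e.1.1)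
/-- transversal crossing in the interiors -/
def Crs (e f : (ℝ × ℝ) × (ℝ × ℝ)) : Prop :=
  ∃ x, e.1.1 < x ∧ x < e.2.1 ∧ f.1.1 < x ∧ x < f.2.1 ∧ ht e x = ht f x ∧ sl e ≠ sl f

lemma ht_left (e : (ℝ × ℝ) × (ℝ × ℝ)) : ht e e.1.1 = e.1.2 := by simp [ht]
lemma ht_right (e : (ℝ × ℝ) × (ℝ × ℝ)) (h : e.1.1 < e.2.1) : ht e e.2.1 = e.2.2 := by
  have : e.2.1 - e.1.1 ≠ 0 := by linarith
  simp only [ht, sl]; field_simp; ring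

lemma ht_sub (e : (ℝ × ℝ) × (ℝ × ℝ)) (x y : ℝ) : ht e y = ht e x + sl e * (y - x) := by
  simp only [ht]; ring

lemma crs_of (e f : (ℝ × ℝ) × (ℝ × ℝ)) (x y : ℝ) (hxy : x < y)
    (h1 : e.1.1 ≤ x) (h2 : y ≤ e.2.1) (h3 : f.1.1 ≤ x) (h4 : y ≤ f.2.1)
    (h5 : ht e x < ht f x) (h6 : ht f y < ht e y) : Crs e f := by
  have he := ht_sub e x y
  have hf := ht_sub f x y
  set d := ht f x - ht e x with hd
  have hd0 : 0 < d := by linarith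
  have hs : 0 < (sl e - sl f) * (y - x) - d := by nlinarith
  have hyx : 0 < y - x := by linarith
  have hsl : 0 < sl e - sl f := by
    by_contra hc
    push Not at hc
    nlinarith
  refine ⟨x + d / (sl e - sl f), ?_, ?_, ?_, ?_, ?_, ?_⟩
  · have : 0 < d / (sl e - sl f) := by positivity
    linarith
  · have : d / (sl e - sl f) < y - x := by rw [div_lt_iff₀ hsl]; linarith
    linarith
  · have : 0 < d / (sl e - sl f) := by positivity
    linarith
  · have : d / (sl e - sl f) < y - x := by rw [div_lt_iff₀ hsl]; linarith
    linarith
  · rw [ht_sub e x, ht_sub f x]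
    have : (sl e - sl f) * (d / (sl e - sl f)) = d := by field_simp
    linarith
  · intro h; linarith

/-- The second edge is the next edge above the first, and w is the first vertex in the wedge. -/
def Q (P : Finset (ℝ × ℝ)) (E : Finset ((ℝ × ℝ) × (ℝ × ℝ))) (e e' : (ℝ × ℝ) × (ℝ × ℝ))
    (w : ℝ × ℝ) : Prop :=
  e' ∈ E ∧ e'.1 = e.1 ∧ sl e < sl e' ∧ (∀ f ∈ E, f.1 = e.1 → sl e < sl f → sl e' ≤ sl f) ∧
  w ∈ P ∧ e.1.1 < w.1 ∧ w.1 ≤ e.2.1 ∧ w.1 ≤ e'.2.1 ∧ ht e w.1 ≤ w.2 ∧ w.2 ≤ ht e' w.1 ∧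
  ∀ z ∈ P, e.1.1 < z.1 → z.1 < w.1 → z.2 < ht e z.1 ∨ ht e' z.1 < z.2

lemma ht_lt_of_slope {e f : (ℝ × ℝ) × (ℝ × ℝ)} (h : f.1 = e.1) (hs : sl e < sl f) {x : ℝ}
    (hx : e.1.1 < x) : ht e x < ht f x := by
  simp only [ht, h]; nlinarith

lemma ht_le_of_slope {e f : (ℝ × ℝ) × (ℝ × ℝ)} (h : f.1 = e.1) (hs : sl e ≤ sl f) {x : ℝ}
    (hx : e.1.1 < x) : ht e x ≤ ht f x := by
  simp only [ht, h]; nlinarith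

section
variable (P : Finset (ℝ × ℝ)) (E : Finset ((ℝ × ℝ) × (ℝ × ℝ)))

lemma exists_Q (hE : ∀ e ∈ E, e.1 ∈ P ∧ e.2 ∈ P ∧ e.1.1 < e.2.1)
    (e) (he : e ∈ E) (hnt : ∃ f ∈ E, f.1 = e.1 ∧ sl e < sl f) : ∃ e' w, Q P E e e' w := by
  obtain ⟨f, hf, hf1, hf2⟩ := hnt
  obtain ⟨e', he', hmin⟩ := Finset.exists_min_image
    (E.filter (fun f => f.1 = e.1 ∧ sl e < sl f)) sl ⟨f, by simp [hf, hf1, hf2]⟩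
  simp only [Finset.mem_filter] at he' hmin
  obtain ⟨he'E, he'1, he's⟩ := he'
  have hne : (P.filter (fun w => e.1.1 < w.1 ∧ w.1 ≤ e.2.1 ∧ w.1 ≤ e'.2.1 ∧
      ht e w.1 ≤ w.2 ∧ w.2 ≤ ht e' w.1)).Nonempty := by
    have a := hE e he
    have b := hE e' he'E
    have hb : e.1.1 < e'.2.1 := by rw [← he'1]; exact b.2.2
    rcases le_total e.2.1 e'.2.1 with h | h
    · refine ⟨e.2, ?_⟩
      have := ht_lt_of_slope he'1 he's a.2.2
      rw [ht_right e a.2.2] at this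
      simp only [Finset.mem_filter]
      exact ⟨a.2.1, a.2.2, le_rfl, h, (ht_right e a.2.2).le, this.le⟩
    · refine ⟨e'.2, ?_⟩
      have := ht_lt_of_slope he'1 he's hb
      rw [ht_right e' b.2.2] at this
      simp only [Finset.mem_filter]
      exact ⟨b.2.1, hb, h, le_rfl, this.le, (ht_right e' b.2.2).ge⟩
  obtain ⟨w, hw, hwmin⟩ := Finset.exists_min_image _ (fun w => w.1) hne
  simp only [Finset.mem_filter] at hw hwmin
  refine ⟨e', w, he'E, he'1, he's, fun f a b c => hmin f ⟨a, b, c⟩, hw.1, hw.2.1, hw.2.2.1,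
    hw.2.2.2.1, hw.2.2.2.2.1, hw.2.2.2.2.2, ?_⟩
  intro z hz h1 h2
  by_contra hc
  push Not at hc
  have := hwmin z ⟨hz, h1, h2.le.trans hw.2.2.1, h2.le.trans hw.2.2.2.1, hc.1, hc.2⟩
  linarith

lemma edge_eq (hE : ∀ e ∈ E, e.1 ∈ P ∧ e.2 ∈ P ∧ e.1.1 < e.2.1)
    (hV : ∀ e ∈ E, ∀ z ∈ P, e.1.1 < z.1 → z.1 < e.2.1 → z.2 ≠ ht e z.1)
    (e f) (he : e ∈ E) (hf : f ∈ E) (h1 : e.1 = f.1) (hs : sl e = sl f) : e = f := by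
  have a := hE e he
  have b := hE f hf
  have hht : ∀ x, ht e x = ht f x := fun x => by simp only [ht, h1, hs]
  have h11 : e.1.1 = f.1.1 := by rw [h1]
  rcases lt_trichotomy e.2.1 f.2.1 with h | h | h
  · exact absurd (by rw [← hht, ht_right e a.2.2]) (hV f hf e.2 a.2.1 (by linarith [a.2.2]) h)
  · have : e.2.2 = f.2.2 := by rw [← ht_right e a.2.2, ← ht_right f b.2.2, hht, h]
    exact Prod.ext h1 (Prod.ext h this)
  · exact absurd (by rw [hht, ht_right f b.2.2]) (hV e he f.2 b.2.1 (by linarith [b.2.2]) h)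

lemma key_lt (hE : ∀ e ∈ E, e.1 ∈ P ∧ e.2 ∈ P ∧ e.1.1 < e.2.1)
    (hX : ∀ e ∈ E, ∀ f ∈ E, ¬ Crs e f)
    (e f e' f' w) (he : e ∈ E) (hf : f ∈ E) (hQe : Q P E e e' w) (hQf : Q P E f f' w)
    (h1 : ht e w.1 < ht f' w.1) (h2 : ht f w.1 < ht e' w.1) : ¬ e.1.1 < f.1.1 := by
  intro hlt
  obtain ⟨a1, a2, a3, a4, a5, a6, a7, a8, a9, a10, a11⟩ := hQe
  obtain ⟨b1, b2, b3, b4, b5, b6, b7, b8, b9, b10, b11⟩ := hQf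
  have e1 : e'.1.1 = e.1.1 := by rw [a2]
  have f1 : f'.1.1 = f.1.1 := by rw [b2]
  have f2 : ht f' f.1.1 = f.1.2 := by rw [← b2]; exact ht_left f'
  have f3 := ht_left f
  rcases a11 f.1 (hE f hf).1 hlt b6 with h | h
  · exact hX _ b1 _ he (crs_of f' e f.1.1 w.1 b6 f1.le b8 hlt.le a7 (by rw [f2]; exact h) h1)
  · exact hX _ a1 _ hf (crs_of e' f f.1.1 w.1 b6 (by linarith) a8 le_rfl b7
      (by rw [f3]; exact h) h2)

lemma key (hP : ∀ p ∈ P, ∀ q ∈ P, p.1 = q.1 → p = q)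
    (hE : ∀ e ∈ E, e.1 ∈ P ∧ e.2 ∈ P ∧ e.1.1 < e.2.1)
    (hV : ∀ e ∈ E, ∀ z ∈ P, e.1.1 < z.1 → z.1 < e.2.1 → z.2 ≠ ht e z.1)
    (hX : ∀ e ∈ E, ∀ f ∈ E, ¬ Crs e f)
    (e f e' f' w) (he : e ∈ E) (hf : f ∈ E) (hQe : Q P E e e' w) (hQf : Q P E f f' w)
    (h1 : ht e w.1 < ht f' w.1) (h2 : ht f w.1 < ht e' w.1) : e = f := by
  have k1 := key_lt P E hE hX e f e' f' w he hf hQe hQf h1 h2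
  have k2 := key_lt P E hE hX f e f' e' w hf he hQf hQe h2 h1
  have hv : e.1 = f.1 := hP _ (hE e he).1 _ (hE f hf).1 (le_antisymm (not_lt.1 k2) (not_lt.1 k1))
  obtain ⟨a1, a2, a3, a4, a5, a6, a7, a8, a9, a10, a11⟩ := hQe
  obtain ⟨b1, b2, b3, b4, b5, b6, b7, b8, b9, b10, b11⟩ := hQf
  rcases lt_trichotomy (sl e) (sl f) with h | h | h
  · have := ht_le_of_slope (e := e') (f := f) (by rw [a2, hv]) (a4 f hf hv.symm h)
      (x := w.1) (by rw [a2]; exact a6)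
    linarith
  · exact edge_eq P E hE hV e f he hf hv h
  · have := ht_le_of_slope (e := f') (f := e) (by rw [b2, hv]) (b4 e he hv h)
      (x := w.1) (by rw [b2]; exact b6)
    linarith

/-- A noncrossing geometric graph has at most `3|P|` edges. -/
lemma planar (hP : ∀ p ∈ P, ∀ q ∈ P, p.1 = q.1 → p = q)
    (hE : ∀ e ∈ E, e.1 ∈ P ∧ e.2 ∈ P ∧ e.1.1 < e.2.1)
    (hV : ∀ e ∈ E, ∀ z ∈ P, e.1.1 < z.1 → z.1 < e.2.1 → z.2 ≠ ht e z.1)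
    (hX : ∀ e ∈ E, ∀ f ∈ E, ¬ Crs e f) : E.card ≤ 3 * P.card := by
  classical
  have hex := exists_Q P E hE
  choose! n w hQ using hex
  set N := E.filter (fun e => ∃ f ∈ E, f.1 = e.1 ∧ sl e < sl f) with hN
  set T := E.filter (fun e => ¬ ∃ f ∈ E, f.1 = e.1 ∧ sl e < sl f) with hT
  have hTc : T.card ≤ P.card := by
    apply Finset.card_le_card_of_injOn (fun e => e.1)
    · intro e he
      exact (hE e (Finset.mem_filter.1 he).1).1
    · intro e he f hf hef
      simp only [hT, Finset.coe_filter, Set.mem_ofPred_eq] at he hf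
      obtain ⟨he, he2⟩ := he
      obtain ⟨hf, hf2⟩ := hf
      push Not at he2 hf2
      exact edge_eq P E hE hV e f he hf hef (le_antisymm (hf2 e he hef) (he2 f hf hef.symm))
  have hQN : ∀ e ∈ N, e ∈ E ∧ Q P E e (n e) (w e) := by
    intro e he
    obtain ⟨h1, h2⟩ := Finset.mem_filter.1 he
    exact ⟨h1, hQ e h1 h2⟩
  have hBc : (N.filter (fun e => ht e (w e).1 = (w e).2)).card ≤ P.card := by
    apply Finset.card_le_card_of_injOn w
    · intro e he
      exact (hQN e (Finset.mem_filter.1 he).1).2.2.2.2.2.1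
    · intro e he f hf hef
      obtain ⟨he, he2⟩ := Finset.mem_filter.1 he
      obtain ⟨hf, hf2⟩ := Finset.mem_filter.1 hf
      obtain ⟨he, hQe⟩ := hQN e he
      obtain ⟨hf, hQf⟩ := hQN f hf
      rw [hef] at hQe he2
      have x1 := ht_lt_of_slope hQe.2.1 hQe.2.2.1 hQe.2.2.2.2.2.1
      have x2 := ht_lt_of_slope hQf.2.1 hQf.2.2.1 hQf.2.2.2.2.2.1
      exact key P E hP hE hV hX e f _ _ _ he hf hQe hQf (by linarith) (by linarith)
  have hCc : (N.filter (fun e => ¬ ht e (w e).1 = (w e).2)).card ≤ P.card := by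
    apply Finset.card_le_card_of_injOn w
    · intro e he
      exact (hQN e (Finset.mem_filter.1 he).1).2.2.2.2.2.1
    · intro e he f hf hef
      obtain ⟨he, he2⟩ := Finset.mem_filter.1 he
      obtain ⟨hf, hf2⟩ := Finset.mem_filter.1 hf
      obtain ⟨he, hQe⟩ := hQN e he
      obtain ⟨hf, hQf⟩ := hQN f hf
      rw [hef] at hQe he2
      have y1 := lt_of_le_of_ne hQe.2.2.2.2.2.2.2.2.1 he2
      have y2 := lt_of_le_of_ne hQf.2.2.2.2.2.2.2.2.1 hf2
      have z1 := hQe.2.2.2.2.2.2.2.2.2.1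
      have z2 := hQf.2.2.2.2.2.2.2.2.2.1
      exact key P E hP hE hV hX e f _ _ _ he hf hQe hQf (by linarith) (by linarith)
  have s1 : N.card + T.card = E.card := Finset.card_filter_add_card_filter_not _
  have s2 := Finset.card_filter_add_card_filter_not (s := N) (fun e => ht e (w e).1 = (w e).2)
  omega

open Classical in
lemma planarX (hP : ∀ p ∈ P, ∀ q ∈ P, p.1 = q.1 → p = q)
    (hE : ∀ e ∈ E, e.1 ∈ P ∧ e.2 ∈ P ∧ e.1.1 < e.2.1)
    (hV : ∀ e ∈ E, ∀ z ∈ P, e.1.1 < z.1 → z.1 < e.2.1 → z.2 ≠ ht e z.1) :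
    E.card ≤ 3 * P.card + ((E ×ˢ E).filter (fun x => Crs x.1 x.2)).card := by
  set X := (E ×ˢ E).filter (fun x => Crs x.1 x.2) with hXd
  have h := planar P (E \ X.image Prod.fst) hP
    (fun e he => hE e (Finset.mem_sdiff.1 he).1) (fun e he => hV e (Finset.mem_sdiff.1 he).1) (by
      intro e he f hf hc
      rw [Finset.mem_sdiff] at he hf
      apply he.2
      rw [Finset.mem_image]
      exact ⟨(e, f), by simp [hXd, he.1, hf.1, hc], rfl⟩)
  have h2 : (X.image Prod.fst).card ≤ X.card := Finset.card_image_le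
  have h3 := Finset.le_card_sdiff (X.image Prod.fst) E
  omega

end

/-- Random sampling. -/
lemma sample {α : Type*} [DecidableEq α] (P A : Finset α) (hA : A ⊆ P) (p : ℝ) :
    ∑ S ∈ P.powerset, (p ^ S.card * (1 - p) ^ (P \ S).card) * (if A ⊆ S then 1 else 0)
      = p ^ A.card := by
  have h := Finset.prod_add (fun _ : α => p) (fun i => if i ∈ A then 0 else 1 - p) P
  have h2 : ∏ i ∈ P, (p + if i ∈ A then 0 else 1 - p) = p ^ A.card := by
    have : ∀ i ∈ P, (p + if i ∈ A then 0 else 1 - p) = if i ∈ A then p else 1 := by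
      intro i _; split_ifs <;> ring
    rw [Finset.prod_congr rfl this, Finset.prod_ite, Finset.filter_mem_eq_inter,
      Finset.inter_eq_right.2 hA]
    simp
  rw [← h2, h]
  apply Finset.sum_congr rfl
  intro S hS
  rw [mul_assoc]
  congr 1
  · simp
  · split_ifs with hAS
    · rw [mul_one, ← Finset.prod_const]
      apply Finset.prod_congr rfl
      intro i hi
      rw [if_neg (fun hiA => (Finset.mem_sdiff.1 hi).2 (hAS hiA))]
    · rw [mul_zero]
      obtain ⟨i, hi, hiS⟩ := Finset.not_subset.1 hAS
      exact (Finset.prod_eq_zero (Finset.mem_sdiff.2 ⟨hA hi, hiS⟩) (by simp [hi])).symm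

lemma sample_count {α β : Type*} [DecidableEq α] (P : Finset α) (X : Finset β)
    (A : β → Finset α) (hA : ∀ x ∈ X, A x ⊆ P) (m : ℕ) (hm : ∀ x ∈ X, (A x).card = m) (p : ℝ) :
    ∑ S ∈ P.powerset, (p ^ S.card * (1 - p) ^ (P \ S).card) *
      ((X.filter (fun x => A x ⊆ S)).card : ℝ) = p ^ m * X.card := by
  have : ∀ S, ((X.filter (fun x => A x ⊆ S)).card : ℝ) = ∑ x ∈ X, if A x ⊆ S then 1 else 0 := by
    intro S; simp
  simp_rw [this, Finset.mul_sum]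
  rw [Finset.sum_comm]
  rw [Finset.sum_congr rfl (fun x hx => by rw [sample P (A x) (hA x hx) p, hm x hx])]
  simp [mul_comm]

open Classical in
lemma crossing (P : Finset (ℝ × ℝ)) (E : Finset ((ℝ × ℝ) × (ℝ × ℝ)))
    (hP : ∀ p ∈ P, ∀ q ∈ P, p.1 = q.1 → p = q)
    (hE : ∀ e ∈ E, e.1 ∈ P ∧ e.2 ∈ P ∧ e.1.1 < e.2.1)
    (hV : ∀ e ∈ E, ∀ z ∈ P, e.1.1 < z.1 → z.1 < e.2.1 → z.2 ≠ ht e z.1)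
    (p : ℝ) (hp0 : 0 ≤ p) (hp1 : p ≤ 1) :
    p ^ 2 * E.card ≤ 3 * (p * P.card) +
      p ^ 4 * ((E ×ˢ E).filter (fun x => Crs x.1 x.2)).card := by
  set X := (E ×ˢ E).filter (fun x => Crs x.1 x.2) with hXd
  have c1 := sample_count P P (fun x => {x}) (by simp) 1 (by simp) p
  have c2 := sample_count P E (fun e => {e.1, e.2})
    (by
      intro e he z hz
      simp only [Finset.mem_insert, Finset.mem_singleton] at hz
      rcases hz with rfl | rfl
      · exact (hE e he).1
      · exact (hE e he).2.1) 2
    (by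
      intro e he
      apply Finset.card_pair
      intro h
      have := (hE e he).2.2
      rw [h] at this
      exact lt_irrefl _ this) p
  have c4 := sample_count P X (fun x => {x.1.1, x.1.2, x.2.1, x.2.2})
    (by
      intro x hx z hz
      simp only [hXd, Finset.mem_filter, Finset.mem_product] at hx
      have a := hE _ hx.1.1
      have b := hE _ hx.1.2
      simp only [Finset.mem_insert, Finset.mem_singleton] at hz
      rcases hz with rfl | rfl | rfl | rfl
      exacts [a.1, a.2.1, b.1, b.2.1]) 4
    (by
      intro x hx
      simp only [hXd, Finset.mem_filter, Finset.mem_product] at hx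
      obtain ⟨⟨h1, h2⟩, c, d1, d2, d3, d4, d5, d6⟩ := hx
      have a := hE _ h1
      have b := hE _ h2
      have ne : ∀ t, t ≠ c → ht x.1 t ≠ ht x.2 t := by
        intro t htc h
        rw [ht_sub x.1 c, ht_sub x.2 c, d5] at h
        have : (sl x.1 - sl x.2) * (t - c) = 0 := by linarith
        rcases mul_eq_zero.1 this with h | h
        · exact d6 (by linarith)
        · exact htc (by linarith)
      have n1 : x.1.1 ≠ x.1.2 := by intro h; have := a.2.2; rw [h] at this; linarith
      have n2 : x.2.1 ≠ x.2.2 := by intro h; have := b.2.2; rw [h] at this; linarith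
      have n3 : x.1.1 ≠ x.2.2 := by intro h; rw [h] at d1; linarith
      have n4 : x.1.2 ≠ x.2.1 := by intro h; rw [h] at d2; linarith
      have n5 : x.1.1 ≠ x.2.1 := by
        intro h
        apply ne x.1.1.1 (by linarith)
        rw [ht_left, h, ht_left]
      have n6 : x.1.2 ≠ x.2.2 := by
        intro h
        apply ne x.1.2.1 (by linarith)
        rw [ht_right _ a.2.2, h, ht_right _ b.2.2]
      rw [Finset.card_insert_of_notMem (by simp [n1, n5, n3]),
        Finset.card_insert_of_notMem (by simp [n4, n6]), Finset.card_pair n2]) p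
  rw [pow_one] at c1
  rw [← c1, ← c2, ← c4, Finset.mul_sum, ← Finset.sum_add_distrib]
  apply Finset.sum_le_sum
  intro S hS
  rw [Finset.mem_powerset] at hS
  have hmain := planarX S (E.filter (fun e => ({e.1, e.2} : Finset (ℝ × ℝ)) ⊆ S))
    (fun p hp q hq => hP p (hS hp) q (hS hq))
    (by
      intro e he
      rw [Finset.mem_filter] at he
      exact ⟨he.2 (by simp), he.2 (by simp), (hE e he.1).2.2⟩)
    (by
      intro e he z hz
      rw [Finset.mem_filter] at he
      exact hV e he.1 z (hS hz))
  have hPS : P.filter (fun x => ({x} : Finset (ℝ × ℝ)) ⊆ S) = S := by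
    ext z
    simp only [Finset.mem_filter, Finset.singleton_subset_iff]
    exact ⟨fun h => h.2, fun h => ⟨hS h, h⟩⟩
  have hXS : ((E.filter (fun e => ({e.1, e.2} : Finset (ℝ × ℝ)) ⊆ S)) ×ˢ
      (E.filter (fun e => ({e.1, e.2} : Finset (ℝ × ℝ)) ⊆ S))).filter (fun x => Crs x.1 x.2) ⊆
      X.filter (fun x => ({x.1.1, x.1.2, x.2.1, x.2.2} : Finset (ℝ × ℝ)) ⊆ S) := by
    intro x hx
    simp only [hXd, Finset.mem_filter, Finset.mem_product, Finset.insert_subset_iff,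
      Finset.singleton_subset_iff] at hx ⊢
    tauto
  have hXS' := Finset.card_le_card hXS
  have h3 : ((E.filter (fun e => ({e.1, e.2} : Finset (ℝ × ℝ)) ⊆ S)).card : ℝ) ≤ 3 * S.card +
      (X.filter (fun x => ({x.1.1, x.1.2, x.2.1, x.2.2} : Finset (ℝ × ℝ)) ⊆ S)).card := by
    exact_mod_cast hmain.trans (by omega)
  rw [hPS]
  have hw : 0 ≤ p ^ S.card * (1 - p) ^ (P \ S).card := by
    have : 0 ≤ 1 - p := by linarith
    positivity
  calc _ ≤ p ^ S.card * (1 - p) ^ (P \ S).card * (3 * S.card +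
      (X.filter (fun x => ({x.1.1, x.1.2, x.2.1, x.2.2} : Finset (ℝ × ℝ)) ⊆ S)).card) :=
        mul_le_mul_of_nonneg_left h3 hw
    _ = _ := by ring

lemma line_ht (a b c : ℝ) (hnd : a ≠ 0 ∨ b ≠ 0) (e : (ℝ × ℝ) × (ℝ × ℝ)) (h : e.1.1 < e.2.1)
    (h1 : a * e.1.1 + b * e.1.2 = c) (h2 : a * e.2.1 + b * e.2.2 = c) :
    b ≠ 0 ∧ a = - b * sl e ∧ ∀ x, b * ht e x = c - a * x := by
  have hd : e.2.1 - e.1.1 ≠ 0 := by linarith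
  have ha : a = - b * sl e := by
    simp only [sl]
    field_simp
    linarith
  refine ⟨?_, ha, ?_⟩
  · rintro rfl
    simp at ha
    simp [ha] at hnd
  · intro x
    have : b * ht e x = b * e.1.2 + (b * sl e) * (x - e.1.1) := by simp only [ht]; ring
    rw [this, show b * sl e = -a by linarith]
    linarith

section
variable {ι : Type*} (P : Finset (ℝ × ℝ)) (L : Finset ι) (A B C : ι → ℝ)

/-- consecutive points on a line -/
def Cons (l : ι) (e : (ℝ × ℝ) × (ℝ × ℝ)) : Prop :=
  A l * e.1.1 + B l * e.1.2 = C l ∧ A l * e.2.1 + B l * e.2.2 = C l ∧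
    ∀ z ∈ P, A l * z.1 + B l * z.2 = C l → e.1.1 < z.1 → e.2.1 ≤ z.1

open Classical in
/-- Edges of the Szekely graph. -/
noncomputable def Edg : Finset ((ℝ × ℝ) × (ℝ × ℝ)) :=
  (P ×ˢ P).filter (fun e => e.1.1 < e.2.1 ∧ ∃ l ∈ L, Cons P A B C l e)

lemma mem_Edg (e) : e ∈ Edg P L A B C ↔
    (e.1 ∈ P ∧ e.2 ∈ P) ∧ e.1.1 < e.2.1 ∧ ∃ l ∈ L, Cons P A B C l e := by
  simp [Edg]

lemma cons_eq (hP : ∀ p ∈ P, ∀ q ∈ P, p.1 = q.1 → p = q) (l : ι) (e f : (ℝ × ℝ) × (ℝ × ℝ))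
    (he : Cons P A B C l e) (hf : Cons P A B C l f) (c : ℝ)
    (e1 : e.1 ∈ P) (e2 : e.2 ∈ P) (f1 : f.1 ∈ P) (f2 : f.2 ∈ P)
    (h1 : e.1.1 < c) (h2 : c < e.2.1) (h3 : f.1.1 < c) (h4 : c < f.2.1) : e = f := by
  obtain ⟨a1, a2, a3⟩ := he
  obtain ⟨b1, b2, b3⟩ := hf
  have l1 : f.1.1 ≤ e.1.1 := by
    by_contra h
    have := a3 f.1 f1 b1 (not_le.1 h)
    linarith
  have l2 : e.1.1 ≤ f.1.1 := by
    by_contra h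
    have := b3 e.1 e1 a1 (not_le.1 h)
    linarith
  have r1 := a3 f.2 f2 b2 (by linarith)
  have r2 := b3 e.2 e2 a2 (by linarith)
  exact Prod.ext (hP _ e1 _ f1 (le_antisymm l2 l1)) (hP _ e2 _ f2 (le_antisymm r1 r2))

open Classical in
lemma cross_le_s10 (hP : ∀ p ∈ P, ∀ q ∈ P, p.1 = q.1 → p = q)
    (hnd : ∀ l ∈ L, A l ≠ 0 ∨ B l ≠ 0) :
    ((Edg P L A B C ×ˢ Edg P L A B C).filter (fun x => Crs x.1 x.2)).card ≤ L.card * L.card := by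
  rw [← Finset.card_product]
  have hg : ∀ e ∈ Edg P L A B C, ∃ l, l ∈ L ∧ Cons P A B C l e := by
    intro e he
    rw [mem_Edg] at he
    obtain ⟨l, h⟩ := he.2.2
    exact ⟨l, h⟩
  have hsame : ∀ e ∈ Edg P L A B C, ∀ f ∈ Edg P L A B C, ∀ l ∈ L, Cons P A B C l e →
      Cons P A B C l f → ∀ x, ht e x = ht f x := by
    intro e he f hf l hl ce cf x
    rw [mem_Edg] at he hf
    have a := line_ht _ _ _ (hnd l hl) e he.2.1 ce.1 ce.2.1
    have b := line_ht _ _ _ (hnd l hl) f hf.2.1 cf.1 cf.2.1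
    exact mul_left_cancel₀ a.1 (by rw [a.2.2, b.2.2])
  by_cases hEe : Edg P L A B C = ∅
  · simp [hEe]
  obtain ⟨e0, he0⟩ := Finset.nonempty_iff_ne_empty.2 hEe
  obtain ⟨l0, _⟩ := hg e0 he0
  have : Nonempty ι := ⟨l0⟩
  choose! g hgL hgC using hg
  apply Finset.card_le_card_of_injOn (fun x => (g x.1, g x.2))
  · intro x hx
    simp only [Finset.coe_filter, Finset.mem_product, Set.mem_ofPred_eq] at hx
    simp only [Finset.coe_product, Set.mem_prod, Finset.mem_coe]
    exact ⟨hgL _ hx.1.1, hgL _ hx.1.2⟩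
  · intro x hx y hy hxy
    simp only [Finset.coe_filter, Finset.mem_product, Set.mem_ofPred_eq] at hx hy
    simp only [Prod.mk.injEq] at hxy
    obtain ⟨⟨x1, x2⟩, c, d1, d2, d3, d4, d5, d6⟩ := hx
    obtain ⟨⟨y1, y2⟩, c', f1, f2, f3, f4, f5, f6⟩ := hy
    have cy1 := hgC _ y1
    have cy2 := hgC _ y2
    rw [← hxy.1] at cy1
    rw [← hxy.2] at cy2
    have s1 := hsame _ x1 _ y1 _ (hgL _ x1) (hgC _ x1) cy1
    have s2 := hsame _ x2 _ y2 _ (hgL _ x2) (hgC _ x2) cy2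
    have hc : c = c' := by
      rw [← s1, ← s2, ht_sub x.1 c, ht_sub x.2 c, d5] at f5
      have : (sl x.1 - sl x.2) * (c' - c) = 0 := by linarith
      rcases mul_eq_zero.1 this with h | h
      · exact absurd (by linarith) d6
      · linarith
    subst hc
    have m1 := (mem_Edg _ _ _ _ _ _).1 x1
    have m2 := (mem_Edg _ _ _ _ _ _).1 x2
    have m3 := (mem_Edg _ _ _ _ _ _).1 y1
    have m4 := (mem_Edg _ _ _ _ _ _).1 y2
    exact Prod.ext
      (cons_eq P A B C hP _ _ _ (hgC _ x1) cy1 c m1.1.1 m1.1.2 m3.1.1 m3.1.2 d1 d2 f1 f2)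
      (cons_eq P A B C hP _ _ _ (hgC _ x2) cy2 c m2.1.1 m2.1.2 m4.1.1 m4.1.2 d3 d4 f3 f4)

open Classical in
lemma inc_le (hP : ∀ p ∈ P, ∀ q ∈ P, p.1 = q.1 → p = q)
    (hu : ∀ l ∈ L, ∀ l' ∈ L, ∀ u ∈ P, ∀ v ∈ P, u ≠ v →
      A l * u.1 + B l * u.2 = C l → A l * v.1 + B l * v.2 = C l →
      A l' * u.1 + B l' * u.2 = C l' → A l' * v.1 + B l' * v.2 = C l' → l = l') :
    ((P ×ˢ L).filter (fun x => A x.2 * x.1.1 + B x.2 * x.1.2 = C x.2)).card ≤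
      L.card + (Edg P L A B C).card := by
  set I := (P ×ˢ L).filter (fun x => A x.2 * x.1.1 + B x.2 * x.1.2 = C x.2) with hI
  have hmem : ∀ x, x ∈ I ↔ (x.1 ∈ P ∧ x.2 ∈ L) ∧ A x.2 * x.1.1 + B x.2 * x.1.2 = C x.2 := by
    intro x; simp [hI]
  set R : (ℝ × ℝ) × ι → Prop :=
    fun x => ∃ z ∈ P, A x.2 * z.1 + B x.2 * z.2 = C x.2 ∧ x.1.1 < z.1 with hR
  have h1 : (I.filter (fun x => ¬ R x)).card ≤ L.card := by
    apply Finset.card_le_card_of_injOn Prod.snd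
    · intro x hx
      exact ((hmem x).1 (Finset.mem_filter.1 hx).1).1.2
    · intro x hx y hy hxy
      obtain ⟨hx, hx2⟩ := Finset.mem_filter.1 hx
      obtain ⟨hy, hy2⟩ := Finset.mem_filter.1 hy
      rw [hmem] at hx hy
      simp only [hR, not_exists, not_and, not_lt] at hx2 hy2
      have a := hx2 y.1 hy.1.1 (by rw [hxy]; exact hy.2)
      have b := hy2 x.1 hx.1.1 (by rw [← hxy]; exact hx.2)
      exact Prod.ext (hP _ hx.1.1 _ hy.1.1 (le_antisymm b a)) hxy
  have hs : ∀ x ∈ I.filter R, ∃ z, z ∈ P ∧ x.1.1 < z.1 ∧ Cons P A B C x.2 (x.1, z) := by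
    intro x hx
    obtain ⟨hx, z, hz, hz1, hz2⟩ := Finset.mem_filter.1 hx
    rw [hmem] at hx
    obtain ⟨m, hm, hmin⟩ := Finset.exists_min_image
      (P.filter (fun z => A x.2 * z.1 + B x.2 * z.2 = C x.2 ∧ x.1.1 < z.1)) (fun z => z.1)
      ⟨z, by simp [hz, hz1, hz2]⟩
    simp only [Finset.mem_filter] at hm hmin
    exact ⟨m, hm.1, hm.2.2, hx.2, hm.2.1, fun z a b c => hmin z ⟨a, b, c⟩⟩
  have h2 : (I.filter R).card ≤ (Edg P L A B C).card := by
    choose! s hsP hsl hsC using hs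
    apply Finset.card_le_card_of_injOn (fun x => (x.1, s x))
    · intro x hx
      have hx' := (hmem x).1 (Finset.mem_filter.1 hx).1
      rw [Finset.mem_coe, mem_Edg]
      exact ⟨⟨hx'.1.1, hsP x hx⟩, hsl x hx, x.2, hx'.1.2, hsC x hx⟩
    · intro x hx y hy hxy
      simp only [Prod.mk.injEq] at hxy
      have hx' := (hmem x).1 (Finset.mem_filter.1 hx).1
      have hy' := (hmem y).1 (Finset.mem_filter.1 hy).1
      have cx := hsC x hx
      have cy := hsC y hy
      rw [← hxy.1, ← hxy.2] at cy
      refine Prod.ext hxy.1 (hu _ hx'.1.2 _ hy'.1.2 _ hx'.1.1 _ (hsP x hx) ?_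
        cx.1 cx.2.1 cy.1 cy.2.1)
      intro h
      have := hsl x hx
      rw [← h] at this
      exact lt_irrefl _ this
  have := Finset.card_filter_add_card_filter_not (s := I) R
  omega

open Classical in
lemma main_aux_s10 (hP : ∀ p ∈ P, ∀ q ∈ P, p.1 = q.1 → p = q)
    (hnd : ∀ l ∈ L, A l ≠ 0 ∨ B l ≠ 0)
    (hu : ∀ l ∈ L, ∀ l' ∈ L, ∀ u ∈ P, ∀ v ∈ P, u ≠ v →
      A l * u.1 + B l * u.2 = C l → A l * v.1 + B l * v.2 = C l →
      A l' * u.1 + B l' * u.2 = C l' → A l' * v.1 + B l' * v.2 = C l' → l = l')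
    (k : ℕ) (hk : ∀ q ∈ P, k ≤ (L.filter (fun l => A l * q.1 + B l * q.2 = C l)).card)
    (p : ℝ) (hp0 : 0 ≤ p) (hp1 : p ≤ 1) :
    p ^ 2 * ((k : ℝ) * P.card - L.card) ≤ 3 * (p * P.card) + p ^ 4 * (L.card : ℝ) ^ 2 := by
  have h1 := crossing P (Edg P L A B C) hP
    (fun e he => by
      rw [mem_Edg] at he
      exact ⟨he.1.1, he.1.2, he.2.1⟩)
    (by
      intro e he z hz z1 z2 h
      rw [mem_Edg] at he
      obtain ⟨_, h2, l, hl, hc⟩ := he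
      have a := line_ht _ _ _ (hnd l hl) e h2 hc.1 hc.2.1
      have := hc.2.2 z hz (by rw [h, a.2.2]; ring) z1
      linarith) p hp0 hp1
  have h2 := cross_le_s10 P L A B C hP hnd
  have h3 := inc_le P L A B C hP hu
  have h4 : k * P.card ≤
      ((P ×ˢ L).filter (fun x => A x.2 * x.1.1 + B x.2 * x.1.2 = C x.2)).card := by
    rw [Finset.card_filter, Finset.sum_product]
    simp_rw [← Finset.card_filter]
    rw [mul_comm, ← smul_eq_mul]
    exact Finset.card_nsmul_le_sum _ _ _ hk
  have h5 : (k : ℝ) * P.card - L.card ≤ (Edg P L A B C).card := by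
    have : (k : ℝ) * P.card ≤ L.card + (Edg P L A B C).card := by exact_mod_cast h4.trans h3
    linarith
  have h6 : (((Edg P L A B C ×ˢ Edg P L A B C).filter (fun x => Crs x.1 x.2)).card : ℝ) ≤
      (L.card : ℝ) ^ 2 := by
    rw [pow_two]; exact_mod_cast h2
  have h7 := mul_le_mul_of_nonneg_left h5 (sq_nonneg p)
  have h8 := mul_le_mul_of_nonneg_left h6 (by positivity : (0 : ℝ) ≤ p ^ 4)
  linarith

end

lemma two_pts (a b c a' b' c' : ℝ) (h : a ≠ 0 ∨ b ≠ 0) (h' : a' ≠ 0 ∨ b' ≠ 0) (u v : ℝ × ℝ)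
    (huv : u ≠ v) (h1 : a * u.1 + b * u.2 = c) (h2 : a * v.1 + b * v.2 = c)
    (h3 : a' * u.1 + b' * u.2 = c') (h4 : a' * v.1 + b' * v.2 = c') (q : ℝ × ℝ)
    (hq : a * q.1 + b * q.2 = c) : a' * q.1 + b' * q.2 = c' := by
  have hdet : a * b' - a' * b = 0 := by
    by_contra hd
    apply huv
    apply Prod.ext
    · apply mul_left_cancel₀ hd; linear_combination b' * (h1 - h2) - b * (h3 - h4)
    · apply mul_left_cancel₀ hd; linear_combination a * (h3 - h4) - a' * (h1 - h2)
  rcases h with h | h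
  · apply mul_left_cancel₀ h
    linear_combination a' * (hq - h1) + a * h3 + (q.2 - u.2) * hdet
  · apply mul_left_cancel₀ h
    linear_combination b' * (hq - h1) + b * h3 - (q.1 - u.1) * hdet

lemma exists_shear (P : Finset (ℝ × ℝ)) :
    ∃ t : ℝ, ∀ p ∈ P, ∀ q ∈ P, p.1 + t * p.2 = q.1 + t * q.2 → p = q := by
  classical
  obtain ⟨t, ht⟩ := Infinite.exists_notMem_finset
    ((P ×ˢ P).image (fun x => -(x.1.1 - x.2.1) / (x.1.2 - x.2.2)))
  refine ⟨t, fun p hp q hq h => ?_⟩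
  by_cases hy : p.2 = q.2
  · rw [hy] at h
    exact Prod.ext (by linarith) hy
  · exfalso
    apply ht
    rw [Finset.mem_image]
    refine ⟨(p, q), by simp [hp, hq], ?_⟩
    have : p.2 - q.2 ≠ 0 := sub_ne_zero.2 hy
    simp only
    rw [div_eq_iff this]
    linarith

theorem stmt10 :
    ∃ C : ℝ, 0 < C ∧ ∀ (L : Finset (ℝ × ℝ × ℝ)),
      (∀ l ∈ L, l.1 ≠ 0 ∨ l.2.1 ≠ 0) →
      (∀ l ∈ L, ∀ l' ∈ L, linePts l = linePts l' → l = l') →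
      ∀ k : ℕ, 2 ≤ k →
      ∀ P : Finset (ℝ × ℝ),
        (∀ q ∈ P, k ≤ (L.filter (fun l => l.1 * q.1 + l.2.1 * q.2 = l.2.2)).card) →
        (P.card : ℝ) ≤ C * ((L.card : ℝ) ^ 2 / (k : ℝ) ^ 3 + (L.card : ℝ) / k) := by
  classical
  refine ⟨512, by norm_num, ?_⟩
  intro L hnd hdist k hk P hP
  have hu : ∀ l ∈ L, ∀ l' ∈ L, ∀ u v : ℝ × ℝ, u ≠ v →
      l.1 * u.1 + l.2.1 * u.2 = l.2.2 → l.1 * v.1 + l.2.1 * v.2 = l.2.2 →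
      l'.1 * u.1 + l'.2.1 * u.2 = l'.2.2 → l'.1 * v.1 + l'.2.1 * v.2 = l'.2.2 → l = l' := by
    intro l hl l' hl' u v huv h1 h2 h3 h4
    apply hdist l hl l' hl'
    ext q
    exact ⟨fun hq => two_pts _ _ _ _ _ _ (hnd l hl) (hnd l' hl') u v huv h1 h2 h3 h4 q hq,
      fun hq => two_pts _ _ _ _ _ _ (hnd l' hl') (hnd l hl) u v huv h3 h4 h1 h2 q hq⟩
  have hk0 : (0 : ℝ) < k := by exact_mod_cast (by omega : 0 < k)
  set n : ℝ := (P.card : ℝ) with hn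
  set m : ℝ := (L.card : ℝ) with hm
  have hm0 : 0 ≤ m := Nat.cast_nonneg _
  have hn0 : 0 ≤ n := Nat.cast_nonneg _
  have hb1 : 0 ≤ m ^ 2 / (k : ℝ) ^ 3 := by positivity
  have hb2 : 0 ≤ m / (k : ℝ) := by positivity
  by_cases hk8 : k < 8
  · -- trivial bound
    have htriv : P.card ≤ (L ×ˢ L).card := by
      have hex : ∀ q ∈ P, ∃ x : (ℝ × ℝ × ℝ) × (ℝ × ℝ × ℝ), x.1 ∈ L ∧ x.2 ∈ L ∧ x.1 ≠ x.2 ∧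
          x.1.1 * q.1 + x.1.2.1 * q.2 = x.1.2.2 ∧ x.2.1 * q.1 + x.2.2.1 * q.2 = x.2.2.2 := by
        intro q hq
        obtain ⟨a, ha, b, hb, hab⟩ := Finset.one_lt_card.1 (lt_of_lt_of_le hk (hP q hq))
        rw [Finset.mem_filter] at ha hb
        exact ⟨(a, b), ha.1, hb.1, hab, ha.2, hb.2⟩
      choose! x x1 x2 x3 x4 x5 using hex
      apply Finset.card_le_card_of_injOn x
      · intro q hq
        simp only [Finset.coe_product, Set.mem_prod, Finset.mem_coe]
        exact ⟨x1 q hq, x2 q hq⟩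
      · intro q hq r hr hqr
        by_contra hne
        have r4 := x4 r hr
        have r5 := x5 r hr
        rw [← hqr] at r4 r5
        exact x3 q hq (hu _ (x1 q hq) _ (x2 q hq) q r hne (x4 q hq) r4 (x5 q hq) r5)
    have h1 : n ≤ m ^ 2 := by
      rw [Finset.card_product] at htriv
      rw [pow_two, hn, hm]; exact_mod_cast htriv
    have h2 : m ^ 2 ≤ 512 * (m ^ 2 / (k : ℝ) ^ 3) := by
      rw [← mul_div_assoc, le_div_iff₀ (by positivity)]
      have : (k : ℝ) ≤ 8 := by exact_mod_cast hk8.le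
      have : (k : ℝ) ^ 3 ≤ 8 ^ 3 := by gcongr
      nlinarith [sq_nonneg m]
    linarith
  · push Not at hk8
    have hk8' : (8 : ℝ) ≤ k := by exact_mod_cast hk8
    obtain ⟨t, ht⟩ := exists_shear P
    have hinj : Set.InjOn (fun q : ℝ × ℝ => ((q.1 + t * q.2, q.2) : ℝ × ℝ)) P := by
      intro p hp q hq h
      exact ht p hp q hq (congrArg Prod.fst h)
    have hcard := Finset.card_image_of_injOn hinj
    have hmain := main_aux_s10 (P.image (fun q : ℝ × ℝ => ((q.1 + t * q.2, q.2) : ℝ × ℝ))) L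
      (fun l => l.1) (fun l => l.2.1 - l.1 * t) (fun l => l.2.2)
      (by
        intro p hp q hq h
        rw [Finset.mem_image] at hp hq
        obtain ⟨p, hp, rfl⟩ := hp
        obtain ⟨q, hq, rfl⟩ := hq
        rw [ht p hp q hq h])
      (by
        intro l hl
        by_contra hc
        push Not at hc
        obtain ⟨h1, h2⟩ := hc
        rcases hnd l hl with h | h
        · exact h h1
        · apply h; rw [h1] at h2; linarith)
      (by
        intro l hl l' hl' u hu' v hv' huv h1 h2 h3 h4
        refine hu l hl l' hl' (u.1 - t * u.2, u.2) (v.1 - t * v.2, v.2) ?_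
          (by linear_combination h1) (by linear_combination h2)
          (by linear_combination h3) (by linear_combination h4)
        intro h
        simp only [Prod.mk.injEq] at h
        apply huv
        refine Prod.ext ?_ h.2
        have := h.1
        rw [h.2] at this
        linarith)
      k
      (by
        intro q hq
        rw [Finset.mem_image] at hq
        obtain ⟨q, hq, rfl⟩ := hq
        refine (hP q hq).trans (Finset.card_le_card ?_)
        intro l hl
        rw [Finset.mem_filter] at hl ⊢
        exact ⟨hl.1, by simp only; linear_combination hl.2⟩)
      (8 / k) (by positivity) (by rw [div_le_one hk0]; exact hk8')
    rw [hcard, ← hn, ← hm] at hmain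
    by_cases hc : (k : ℝ) * n ≤ 2 * m
    · have : n ≤ 2 * (m / k) := by
        rw [← mul_div_assoc, le_div_iff₀ hk0]; linarith
      linarith
    · push Not at hc
      have h1 : (8 / (k : ℝ)) ^ 2 * (k * n / 2) ≤ (8 / (k : ℝ)) ^ 2 * (k * n - m) :=
        mul_le_mul_of_nonneg_left (by linarith) (by positivity)
      have h2 := h1.trans hmain
      have h3 : n ≤ 512 * (m ^ 2 / (k : ℝ) ^ 3) := by
        have e1 : (8 / (k : ℝ)) ^ 2 * (k * n / 2) = (32 * n) / k := by field_simp; ring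
        have e2 : 3 * (8 / (k : ℝ) * n) = (24 * n) / k := by field_simp; ring
        have e3 : (8 / (k : ℝ)) ^ 4 * m ^ 2 = (4096 * (m ^ 2 / (k : ℝ) ^ 3)) / k := by
          field_simp; ring
        rw [e1, e2, e3, ← add_div, div_le_div_iff_of_pos_right hk0] at h2
        linarith
      linarith
end

section
/- Let A, B ⊆ ℝ be finite sets with 0, −1 ∉ A and 0 ∉ B, and let 1 ≤ t ≤ min(|A|,|B|). Write S_t(A,B) = {s ∈ AB : |A ∩ sB^{−1}| ≥ t}, i.e. the set of products with at least t representations a·b with a ∈ A, b ∈ B. Then |S_t(A,B)| ≤ C · |A(A+1)|²|B|² / (|A| t³) for an absolute constant C. -/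
open Finset

lemma aux_card_le {α β : Type*} [DecidableEq α] [DecidableEq β] (f : α → β) (T : Finset α) :
    T.card ≤ (T.image f).card + (T.offDiag.filter (fun z => f z.1 = f z.2)).card := by
  induction T using Finset.induction_on with
  | empty => simp
  | insert a T ha ih =>
    rw [card_insert_of_notMem ha, image_insert]
    have hsub : T.offDiag.filter (fun z => f z.1 = f z.2) ⊆
        (insert a T).offDiag.filter (fun z => f z.1 = f z.2) :=
      filter_subset_filter _ (offDiag_mono (subset_insert a T))
    by_cases h : f a ∈ T.image f
    · rw [insert_eq_of_mem h]
      obtain ⟨b, hb, hab⟩ := mem_image.1 h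
      have : (T.offDiag.filter (fun z => f z.1 = f z.2)).card <
          ((insert a T).offDiag.filter (fun z => f z.1 = f z.2)).card := by
        apply card_lt_card
        refine ⟨hsub, fun hh => ?_⟩
        have hm : (a, b) ∈ (insert a T).offDiag.filter (fun z => f z.1 = f z.2) := by
          simp only [mem_filter, mem_offDiag, mem_insert]
          refine ⟨⟨by simp, Or.inr hb, ?_⟩, hab.symm⟩
          rintro rfl; exact ha hb
        have := hh hm
        simp only [mem_filter, mem_offDiag] at this
        exact ha this.1.1
      omega
    · rw [card_insert_of_notMem h]
      have := card_le_card hsub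
      omega

/-- the rank of a real in a finite set -/
noncomputable def rk (X : Finset ℝ) (x : ℝ) : ℕ := (X.filter (fun z => z < x)).card

lemma rk_mono (X : Finset ℝ) {x y : ℝ} (h : x ≤ y) : rk X x ≤ rk X y := by
  apply card_le_card
  intro z
  simp only [mem_filter]
  exact fun hz => ⟨hz.1, hz.2.trans_le h⟩

lemma rk_strict (X : Finset ℝ) {x y : ℝ} (hx : x ∈ X) (h : x < y) : rk X x < rk X y := by
  apply card_lt_card
  refine ⟨?_, fun hh => ?_⟩
  · intro z
    simp only [mem_filter]
    exact fun hz => ⟨hz.1, hz.2.trans h⟩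
  · have := hh (mem_filter.2 ⟨hx, h⟩)
    simp at this

lemma rk_inj (X : Finset ℝ) : Set.InjOn (rk X) X := by
  intro x hx y hy h
  rcases lt_trichotomy x y with h1 | h1 | h1
  · have := rk_strict X hx h1; omega
  · exact h1
  · have := rk_strict X hy h1; omega

lemma rk_le (X : Finset ℝ) (x : ℝ) : rk X x ≤ X.card := card_filter_le _ _

lemma rk_fiber (X : Finset ℝ) (p : ℕ) (hp : 0 < p) (c : ℕ) :
    (X.filter (fun x => c = rk X x / p)).card ≤ p := by
  have : ((X.filter (fun x => c = rk X x / p)).image (rk X)).card ≤ (Ico (c * p) (c * p + p)).card := by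
    apply card_le_card
    intro r hr
    obtain ⟨x, hx, rfl⟩ := mem_image.1 hr
    have h2 := (mem_filter.1 hx).2
    have := Nat.div_add_mod (rk X x) p
    have h3 := Nat.mod_lt (rk X x) hp
    rw [← h2] at this
    rw [mem_Ico]
    have h4 := Nat.zero_le (rk X x % p)
    rw [mul_comm] at this
    constructor <;> omega
  rw [card_image_of_injOn ((rk_inj X).mono (by intro x hx; exact (mem_filter.1 hx).1))] at this
  simpa using this

/-- cell of a point -/
noncomputable def cell (X Y : Finset ℝ) (p q : ℕ) (z : ℝ × ℝ) : ℕ × ℕ := (rk X z.1 / p, rk Y z.2 / q)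

lemma cells_line (X Y : Finset ℝ) (p q : ℕ) (m c : ℝ) (hm : m ≠ 0)
    (T : Finset (ℝ × ℝ)) (hT : ∀ z ∈ T, z.2 = m * z.1 + c) :
    (T.image (cell X Y p q)).card ≤ X.card / p + Y.card / q + 1 := by
  have hX : ∀ x, rk X x / p ≤ X.card / p := fun x => Nat.div_le_div_right (rk_le X x)
  have hY : ∀ x, rk Y x / q ≤ Y.card / q := fun x => Nat.div_le_div_right (rk_le Y x)
  have mX : ∀ {x y}, x ≤ y → rk X x / p ≤ rk X y / p := fun h => Nat.div_le_div_right (rk_mono X h)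
  have mY : ∀ {x y}, x ≤ y → rk Y x / q ≤ rk Y y / q := fun h => Nat.div_le_div_right (rk_mono Y h)
  rw [← card_range (X.card / p + Y.card / q + 1)]
  rcases lt_or_gt_of_ne hm with hm | hm
  · apply card_le_card_of_injOn (fun u => u.1 + (Y.card / q - u.2))
    · intro u hu
      obtain ⟨z, hz, rfl⟩ := mem_image.1 hu
      have := hX z.1
      have := Nat.sub_le (Y.card / q) (rk Y z.2 / q)
      simp only [cell, coe_range, Set.mem_Iio]
      linarith
    · intro u hu v hv huv
      obtain ⟨z, hz, rfl⟩ := mem_image.1 hu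
      obtain ⟨w, hw, rfl⟩ := mem_image.1 hv
      simp only [cell] at huv ⊢
      have h1 := hT z hz
      have h2 := hT w hw
      have h3 := hY z.2
      have h4 := hY w.2
      rcases le_total z.1 w.1 with h | h
      · have a1 := mX h
        have a2 := mY (x := w.2) (y := z.2) (by nlinarith)
        ext <;> simp only <;> omega
      · have a1 := mX h
        have a2 := mY (x := z.2) (y := w.2) (by nlinarith)
        ext <;> simp only <;> omega
  · apply card_le_card_of_injOn (fun u => u.1 + u.2)
    · intro u hu
      obtain ⟨z, hz, rfl⟩ := mem_image.1 hu
      have := hX z.1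
      have := hY z.2
      simp only [cell, coe_range, Set.mem_Iio]
      omega
    · intro u hu v hv huv
      obtain ⟨z, hz, rfl⟩ := mem_image.1 hu
      obtain ⟨w, hw, rfl⟩ := mem_image.1 hv
      simp only [cell] at huv ⊢
      have h1 := hT z hz
      have h2 := hT w hw
      rcases le_total z.1 w.1 with h | h
      · have a1 := mX h
        have a2 := mY (x := z.2) (y := w.2) (by nlinarith)
        ext <;> simp only <;> omega
      · have a1 := mX h
        have a2 := mY (x := w.2) (y := z.2) (by nlinarith)
        ext <;> simp only <;> omega

lemma incid (X Y : Finset ℝ) (L : Finset (ℝ × ℝ)) (hL : ∀ l ∈ L, l.1 ≠ 0) (p q : ℕ)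
    (hp : 0 < p) (hq : 0 < q) :
    ∑ l ∈ L, ((X ×ˢ Y).filter (fun z => z.2 = l.1 * z.1 + l.2)).card ≤
      L.card * (X.card / p + Y.card / q + 1) + X.card * Y.card * (p * q) := by
  classical
  set T : ℝ × ℝ → Finset (ℝ × ℝ) := fun l => (X ×ˢ Y).filter (fun z => z.2 = l.1 * z.1 + l.2) with hTd
  set f := cell X Y p q with hf
  have h1 : ∑ l ∈ L, (T l).card ≤ ∑ l ∈ L, ((X.card / p + Y.card / q + 1) +
      ((T l).offDiag.filter (fun z => f z.1 = f z.2)).card) := by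
    apply sum_le_sum
    intro l hl
    refine (aux_card_le f (T l)).trans (Nat.add_le_add_right ?_ _)
    exact cells_line X Y p q l.1 l.2 (hL l hl) _ (fun z hz => (mem_filter.1 hz).2)
  refine h1.trans ?_
  rw [sum_add_distrib, sum_const, smul_eq_mul]
  apply Nat.add_le_add_left
  rw [← card_biUnion]
  · have : L.biUnion (fun l => (T l).offDiag.filter (fun z => f z.1 = f z.2)) ⊆
      (X ×ˢ Y).biUnion (fun z => ((X.filter (fun x => rk X z.1 / p = rk X x / p)) ×ˢ
        (Y.filter (fun y => rk Y z.2 / q = rk Y y / q))).image (fun w => (z, w))) := by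
      rintro ⟨z, w⟩ h
      obtain ⟨l, hl, h⟩ := mem_biUnion.1 h
      obtain ⟨h, hfz⟩ := mem_filter.1 h
      obtain ⟨hz, hw, hne⟩ := mem_offDiag.1 h
      have hz' := (mem_filter.1 hz).1
      have hw' := mem_product.1 (mem_filter.1 hw).1
      simp only [hf, cell, Prod.mk.injEq] at hfz
      refine mem_biUnion.2 ⟨z, hz', mem_image.2 ⟨w, ?_, rfl⟩⟩
      exact mem_product.2 ⟨mem_filter.2 ⟨hw'.1, hfz.1⟩, mem_filter.2 ⟨hw'.2, hfz.2⟩⟩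
    refine (card_le_card this).trans ?_
    rw [← card_product]
    apply card_biUnion_le_card_mul
    intro z hz
    refine card_image_le.trans ?_
    rw [card_product]
    exact Nat.mul_le_mul (rk_fiber X p hp _) (rk_fiber Y q hq _)
  · intro l hl l' hl' hne
    rw [Function.onFun, disjoint_left]
    rintro ⟨z, w⟩ h h'
    apply hne
    simp only [mem_filter, mem_offDiag, hTd] at h h'
    obtain ⟨⟨⟨_, e1⟩, ⟨_, e2⟩, hzw⟩, _⟩ := h
    obtain ⟨⟨⟨_, e3⟩, ⟨_, e4⟩, _⟩, _⟩ := h'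
    have hx : z.1 - w.1 ≠ 0 := by
      intro h0
      apply hzw
      have : z.1 = w.1 := by linarith
      ext
      · exact this
      · rw [e1, e2, this]
    have hm : l.1 = l'.1 := by
      apply mul_right_cancel₀ hx
      linarith
    ext
    · exact hm
    · rw [hm] at e1; linarith

lemma final_arith (a s n t k : ℝ) (ha : 0 < a) (hs : 0 < s) (ht : 1 ≤ t) (htn : t ^ 2 ≤ n)
    (hk : k ≤ 4 * Real.sqrt (2 * (a * s) / t) + 1)
    (h : t * (a * s) / 2 ≤ n * k) : a * s * t ^ 3 ≤ 400 * n ^ 2 := by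
  set u := Real.sqrt (2 * (a * s) / t) with hu
  have hm : 0 < a * s := by positivity
  have ht0 : 0 < t := by linarith
  have hu0 : 0 ≤ u := Real.sqrt_nonneg _
  have hu2 : u ^ 2 = 2 * (a * s) / t := Real.sq_sqrt (by positivity)
  have hms : a * s = t * u ^ 2 / 2 := by rw [hu2]; field_simp
  have hn : 0 < n := by nlinarith
  rw [hms] at h ⊢
  have h2 : t ^ 2 * u ^ 2 ≤ 4 * n * (4 * u + 1) := by nlinarith [mul_le_mul_of_nonneg_left hk hn.le]
  rcases le_total u 1 with h1 | h1
  · have : t ^ 2 * u ^ 2 ≤ 20 * n := by nlinarith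
    have h3 : t ^ 2 * (t ^ 2 * u ^ 2) ≤ n * (20 * n) := by
      apply mul_le_mul htn this (by positivity) hn.le
    nlinarith
  · have : t ^ 2 * u ≤ 20 * n := by
      have hup : 0 < u := by linarith
      apply le_of_mul_le_mul_right _ hup
      nlinarith
    have h3 : (t ^ 2 * u) ^ 2 ≤ (20 * n) ^ 2 := by
      apply pow_le_pow_left₀ (by positivity) this
    nlinarith

lemma floor_half (x : ℝ) (hx : 1 ≤ x) : 0 < ⌊x⌋₊ ∧ (⌊x⌋₊ : ℝ) ≤ x ∧ x ≤ 2 * ⌊x⌋₊ := by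
  have h1 : 0 < ⌊x⌋₊ := Nat.floor_pos.2 hx
  have h2 := Nat.lt_floor_add_one x
  have h3 : (1 : ℝ) ≤ ⌊x⌋₊ := by exact_mod_cast h1
  exact ⟨h1, Nat.floor_le (by linarith), by linarith⟩

lemma div_floor_bound (a s t : ℝ) (ha : 0 < a) (hs : 0 < s) (ht : 0 < t) (p : ℝ) (hp : 0 < p)
    (h : Real.sqrt (t * a / (2 * s)) ≤ 2 * p) : a / p ≤ 2 * Real.sqrt (2 * (a * s) / t) := by
  rw [div_le_iff₀ hp]
  have : Real.sqrt (2 * (a * s) / t) * Real.sqrt (t * a / (2 * s)) = a := by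
    rw [← Real.sqrt_mul (by positivity)]
    rw [show 2 * (a * s) / t * (t * a / (2 * s)) = a ^ 2 by field_simp]
    exact Real.sqrt_sq ha.le
  nlinarith [Real.sqrt_nonneg (2 * (a * s) / t), mul_le_mul_of_nonneg_left h (Real.sqrt_nonneg (2 * (a * s) / t))]

theorem stmt11 :
    ∃ C : ℝ, 0 < C ∧ ∀ (A B : Finset ℝ),
      (0 : ℝ) ∉ A → (-1 : ℝ) ∉ A → (0 : ℝ) ∉ B →
      ∀ t : ℕ, 1 ≤ t → t ≤ A.card → t ≤ B.card →
      (((Finset.image₂ (· * ·) A B).filter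
          (fun s => t ≤ ((A ×ˢ B).filter (fun q => q.1 * q.2 = s)).card)).card : ℝ) ≤
        C * ((Finset.image₂ (fun a b => a * (b + 1)) A A).card : ℝ) ^ 2 *
          (B.card : ℝ) ^ 2 / ((A.card : ℝ) * (t : ℝ) ^ 3) := by
  classical
  refine ⟨400, by norm_num, ?_⟩
  intro A B hA0 hA1 hB0 t ht htA htB
  set S := (Finset.image₂ (· * ·) A B).filter
          (fun s => t ≤ ((A ×ˢ B).filter (fun q => q.1 * q.2 = s)).card) with hS
  set D := Finset.image₂ (fun a b => a * (b + 1)) A A with hD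
  have hSt : ∀ s ∈ S, t ≤ ((A ×ˢ B).filter (fun q => q.1 * q.2 = s)).card :=
    fun s hs => (mem_filter.1 hs).2
  have htR : (1 : ℝ) ≤ t := by exact_mod_cast ht
  have htAR : (t : ℝ) ≤ A.card := by exact_mod_cast htA
  have htBR : (t : ℝ) ≤ B.card := by exact_mod_cast htB
  have ha : (0 : ℝ) < A.card := by linarith
  have hb : (0 : ℝ) < B.card := by linarith
  -- |A| ≤ |D|
  have hAD : A.card ≤ D.card := by
    obtain ⟨a0, ha0⟩ : A.Nonempty := card_pos.1 (by omega)
    apply card_le_card_of_injOn (fun a => a0 * (a + 1))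
    · intro a ha
      exact mem_image₂_of_mem ha0 ha
    · intro x _ y _ h
      have h0 : a0 ≠ 0 := fun h => hA0 (h ▸ ha0)
      have := mul_left_cancel₀ h0 h
      linarith
  have hADR : (A.card : ℝ) ≤ D.card := by exact_mod_cast hAD
  -- t |S| ≤ |A||B|
  have htS : S.card * t ≤ A.card * B.card := by
    rw [← card_product]
    calc S.card * t = ∑ s ∈ S, t := by simp
      _ ≤ ∑ s ∈ S, ((A ×ˢ B).filter (fun q => q.1 * q.2 = s)).card := sum_le_sum hSt
      _ ≤ (A ×ˢ B).card := by
          rw [← card_biUnion]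
          · exact card_le_card (biUnion_subset.2 (fun s _ => filter_subset _ _))
          · intro s _ s' _ hne
            rw [Function.onFun, disjoint_left]
            intro z hz hz'
            exact hne ((mem_filter.1 hz).2.symm.trans (mem_filter.1 hz').2)
  have htSR : (S.card : ℝ) * t ≤ A.card * B.card := by exact_mod_cast htS
  rw [le_div_iff₀ (by positivity)]
  suffices H : (A.card : ℝ) * S.card * t ^ 3 ≤ 400 * ((D.card : ℝ) * B.card) ^ 2 by nlinarith
  rcases Nat.eq_zero_or_pos S.card with h0 | hSpos
  · rw [h0]; simp; positivity
  have hs : (0 : ℝ) < S.card := by exact_mod_cast hSpos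
  generalize hga : (A.card : ℝ) = a at *
  generalize hgb : (B.card : ℝ) = b at *
  generalize hgs : (S.card : ℝ) = s at *
  generalize hgd : (D.card : ℝ) = d at *
  generalize hgt : (t : ℝ) = τ at *
  have hd : 0 < d := by linarith
  have hab : (a * b) ^ 2 ≤ (d * b) ^ 2 := by gcongr
  rcases lt_or_ge (τ * a) (2 * s) with c1 | c1
  · have e1 : τ ^ 2 ≤ 2 * b := by
      apply le_of_mul_le_mul_right _ ha
      nlinarith
    have e2 : a * s * τ ^ 3 ≤ a * (a * b) * (2 * b) := by
      calc a * s * τ ^ 3 = a * (s * τ) * τ ^ 2 := by ring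
        _ ≤ a * (a * b) * (2 * b) := by gcongr
    nlinarith
  rcases lt_or_ge (τ * s) (2 * a) with c2 | c2
  · have e2 : a * s * τ ^ 3 ≤ a * (2 * a) * (b ^ 2) := by
      calc a * s * τ ^ 3 = a * (τ * s) * τ ^ 2 := by ring
        _ ≤ a * (2 * a) * (b ^ 2) := by gcongr
    nlinarith
  -- main case
  have hτ : 0 < τ := by linarith
  obtain ⟨p0, p1, p2⟩ := floor_half (Real.sqrt (τ * a / (2 * s)))
    (by rw [Real.one_le_sqrt, one_le_div (by positivity)]; exact c1)
  obtain ⟨q0, q1, q2⟩ := floor_half (Real.sqrt (τ * s / (2 * a)))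
    (by rw [Real.one_le_sqrt, one_le_div (by positivity)]; exact c2)
  set p := ⌊Real.sqrt (τ * a / (2 * s))⌋₊
  set q := ⌊Real.sqrt (τ * s / (2 * a))⌋₊
  have hp : (0 : ℝ) < p := by exact_mod_cast p0
  have hq : (0 : ℝ) < q := by exact_mod_cast q0
  have hpq : (p : ℝ) * q ≤ τ / 2 := by
    calc (p : ℝ) * q ≤ Real.sqrt (τ * a / (2 * s)) * Real.sqrt (τ * s / (2 * a)) := by gcongr
      _ = τ / 2 := by
        rw [← Real.sqrt_mul (by positivity)]
        rw [show τ * a / (2 * s) * (τ * s / (2 * a)) = (τ / 2) ^ 2 by field_simp]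
        exact Real.sqrt_sq (by positivity)
  -- lines
  set L : Finset (ℝ × ℝ) := (D ×ˢ B).image (fun z => (z.1 * z.2, - z.2)) with hL
  set X : Finset ℝ := A.image (fun x => x⁻¹) with hX
  have hXc : X.card = A.card := card_image_of_injective _ inv_injective
  have hLc : L.card ≤ D.card * B.card := by
    rw [← card_product]; exact card_image_le
  have hL0 : ∀ l ∈ L, l.1 ≠ 0 := by
    intro l hl
    obtain ⟨⟨al, b'⟩, hz, rfl⟩ := mem_image.1 hl
    obtain ⟨h1, h2⟩ := mem_product.1 hz
    obtain ⟨x, hx, y, hy, hxy⟩ := mem_image₂.1 h1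
    simp only at hxy h2 ⊢
    rw [← hxy]
    refine mul_ne_zero (mul_ne_zero (fun h => hA0 (h ▸ hx)) ?_) (fun h => hB0 (h ▸ h2))
    intro h
    apply hA1
    rw [show (-1 : ℝ) = y by linarith]
    exact hy
  have hinc := incid X S L hL0 p q p0 q0
  have hlow : X.card * S.card * t ≤
      ∑ l ∈ L, ((X ×ˢ S).filter (fun z => z.2 = l.1 * z.1 + l.2)).card := by
    have := sum_card_bipartiteAbove_eq_sum_card_bipartiteBelow
      (s := L) (t := X ×ˢ S) (fun (l z : ℝ × ℝ) => z.2 = l.1 * z.1 + l.2)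
    simp only [bipartiteAbove, bipartiteBelow] at this
    rw [this, ← card_product, ← smul_eq_mul]
    apply card_nsmul_le_sum
    rintro ⟨x, y⟩ hz
    obtain ⟨hx, hy⟩ := mem_product.1 hz
    obtain ⟨a', ha', rfl⟩ := mem_image.1 hx
    refine (hSt y hy).trans ?_
    have ha0 : a' ≠ 0 := fun h => hA0 (h ▸ ha')
    apply card_le_card_of_injOn (fun w => (a' * (w.1 + 1) * w.2, - w.2))
    · rintro ⟨u, v⟩ hw
      obtain ⟨hw, hwy⟩ := mem_filter.1 hw
      obtain ⟨hu, hv⟩ := mem_product.1 hw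
      simp only at hu hv hwy
      refine mem_filter.2 ⟨mem_image.2 ⟨(a' * (u + 1), v), mem_product.2 ⟨?_, hv⟩, rfl⟩, ?_⟩
      · exact mem_image₂_of_mem ha' hu
      · simp only
        rw [← hwy]
        field_simp
        ring
    · rintro ⟨u, v⟩ hw ⟨u', v'⟩ hw' h
      have hv := (mem_product.1 (mem_filter.1 hw).1).2
      have h1 := (mem_filter.1 hw).2
      have h2 := (mem_filter.1 hw').2
      simp only [Prod.mk.injEq, neg_inj] at h h1 h2 hv ⊢
      obtain ⟨_, rfl⟩ := h
      have hv0 : v ≠ 0 := fun h => hB0 (h ▸ hv)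
      exact ⟨mul_right_cancel₀ hv0 (h1.trans h2.symm), rfl⟩
  have hfin : (A.card * S.card * t : ℕ) ≤ (D.card * B.card) * (A.card / p + S.card / q + 1)
      + A.card * S.card * (p * q) := by
    rw [hXc] at hinc hlow
    refine hlow.trans (hinc.trans ?_)
    gcongr
  have hfinR : a * s * τ ≤ (d * b) * (((A.card / p : ℕ) : ℝ) + ((S.card / q : ℕ) : ℝ) + 1)
      + a * s * (p * q) := by
    rw [← hga, ← hgs, ← hgt, ← hgd, ← hgb]
    exact_mod_cast hfin
  apply final_arith a s (d * b) τ (((A.card / p : ℕ) : ℝ) + ((S.card / q : ℕ) : ℝ) + 1) ha hs htR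
  · rw [sq]; exact mul_le_mul (htAR.trans hADR) htBR hτ.le hd.le
  · have k1 : ((A.card / p : ℕ) : ℝ) ≤ a / p := by rw [← hga]; exact Nat.cast_div_le
    have k2 : ((S.card / q : ℕ) : ℝ) ≤ s / q := by rw [← hgs]; exact Nat.cast_div_le
    have k3 := div_floor_bound a s τ ha hs hτ p hp p2
    have k4 := div_floor_bound s a τ hs ha hτ q hq q2
    rw [mul_comm s a] at k4
    linarith
  · have : a * s * (p * q) ≤ a * s * (τ / 2) := by gcongr
    linarith
end
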